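/- Let Σ be a complete connected translating graph in a direction v_θ = sin θ·e₃ + cos θ·e₂ (θ ∈ [0,π)), contained in the slab {(x,y,z) : |x| ≤ w}, w > 0. Then there exists t₁ > 0 such that for every t > t₁ the sets Σ ∩ {y ≤ t} and Σ ∩ {y ≥ −t} are connected. -/

import Mathlib

open MeasureTheory Metric Real EuclideanSpace
open scoped RealInnerProductSpace ENNReal NNReal

noncomputable section

abbrev E3 : Type := EuclideanSpace ℝ (Fin 3)

def e1 : E3 := EuclideanSpace.single 0 1
def e2 : E3 := EuclideanSpace.single 1 1
def e3 : E3 := EuclideanSpace.single 2 1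

/-- First partial derivative of `u` in the first variable. -/
def pds (u : ℝ × ℝ → ℝ) (p : ℝ × ℝ) : ℝ := fderiv ℝ u p (1, 0)

/-- First partial derivative of `u` in the second variable. -/
def pdt (u : ℝ × ℝ → ℝ) (p : ℝ × ℝ) : ℝ := fderiv ℝ u p (0, 1)

/-- `S` is a translating graph in the direction of the unit vector `v`, with respect to the
orthonormal basis `(a, b, v)` of `ℝ³`, over the open connected domain `Ω ⊆ ℝ²`, given by the
smooth function `u : Ω → ℝ` solving the translator equation. -/
structure IsTranslatingGraph (a b v : E3) (Ω : Set (ℝ × ℝ)) (u : ℝ × ℝ → ℝ)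
    (S : Set E3) : Prop where
  norm_a : ‖a‖ = 1
  norm_b : ‖b‖ = 1
  norm_v : ‖v‖ = 1
  inner_ab : ⟪a, b⟫ = 0
  inner_av : ⟪a, v⟫ = 0
  inner_bv : ⟪b, v⟫ = 0
  isOpen_dom : IsOpen Ω
  isConnected_dom : IsConnected Ω
  smooth : ContDiffOn ℝ (⊤ : ℕ∞) u Ω
  pde : ∀ p ∈ Ω,
    (1 + (pdt u p) ^ 2) * pds (fun q => pds u q) p
      - 2 * pds u p * pdt u p * pdt (fun q => pds u q) p
      + (1 + (pds u p) ^ 2) * pdt (fun q => pdt u q) p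
    = (1 + (pds u p) ^ 2 + (pdt u p) ^ 2) *
        (⟪e3, v⟫ - pds u p * ⟪e3, a⟫ - pdt u p * ⟪e3, b⟫)
  graph_eq : S = {q : E3 | ∃ p ∈ Ω, q = p.1 • a + p.2 • b + u p • v}

/-- Entropy of a surface. -/
def entropy (S : Set E3) : ℝ≥0∞ :=
  ⨆ (x₀ : E3) (s₀ : ℝ) (_ : 0 < s₀),
    (ENNReal.ofReal (4 * π * s₀))⁻¹ *
      ∫⁻ q in S, ENNReal.ofReal (Real.exp (-‖q - x₀‖ ^ 2 / (4 * s₀))) ∂(μH[2])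

/-- Number of connected components (as a cardinal). -/
def numComponents (A : Set E3) : Cardinal := Cardinal.mk (ConnectedComponents A)

def vθ (θ : ℝ) : E3 := Real.sin θ • e3 + Real.cos θ • e2
def bθ (θ : ℝ) : E3 := Real.cos θ • e3 - Real.sin θ • e2


/-- The point of the translating graph over parameter `p`, for the basis `(e₁, b_θ, v_θ)`. -/
def graphPtθ (θ : ℝ) (u : ℝ × ℝ → ℝ) (p : ℝ × ℝ) : E3 :=
  p.1 • e1 + p.2 • bθ θ + u p • vθ θ

/-- The Gauss map of a translating graph in the direction `v_θ`, as a function of the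
parameter `p ∈ Ω`: `N = (v_θ − u_s e₁ − u_t b_θ)/√(1+u_s²+u_t²)`. -/
def gaussMapθ (θ : ℝ) (u : ℝ × ℝ → ℝ) (p : ℝ × ℝ) : E3 :=
  (Real.sqrt (1 + (pds u p) ^ 2 + (pdt u p) ^ 2))⁻¹ •
    (vθ θ - pds u p • e1 - pdt u p • bθ θ)

section

open Filter Topology Set

/-- A nowhere vanishing continuous function on the plane has a continuous logarithm. -/
lemma exists_continuous_log (φ : ℝ × ℝ → ℂ) (hφ : Continuous φ) (h0 : ∀ p, φ p ≠ 0) :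
    ∃ g : ℝ × ℝ → ℂ, Continuous g ∧ ∀ p, Complex.exp (g p) = φ p := by
  let f : C(ℝ × ℝ, {z : ℂ // z ≠ 0}) := ⟨fun p => ⟨φ p, h0 p⟩, by fun_prop⟩
  obtain ⟨F, ⟨-, hF⟩, -⟩ := Complex.isCoveringMap_exp.existsUnique_continuousMap_lifts f (0, 0)
    (Complex.log (φ (0, 0))) (Subtype.ext (by simp [f, Complex.exp_log (h0 _)]))
  refine ⟨F, F.continuous, fun p => ?_⟩
  have := congrFun hF p
  simpa [f] using congrArg Subtype.val this

lemma IsPreconnected.exists_int_eq {X : Type*} [TopologicalSpace X] {s : Set X}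
    (hs : IsPreconnected s) {f : X → ℝ} (hf : ContinuousOn f s)
    (h : ∀ x ∈ s, ∃ n : ℤ, f x = n) : ∃ n : ℤ, ∀ x ∈ s, f x = n := by
  rcases s.eq_empty_or_nonempty with rfl | ⟨x0, hx0⟩
  · exact ⟨0, by simp⟩
  obtain ⟨n, hn⟩ := h x0 hx0
  refine ⟨n, fun x hx => ?_⟩
  by_contra hne
  obtain ⟨k, hk⟩ := h x hx
  have hkn : k ≠ n := fun e => hne (by rw [hk, e])
  have him := hs.image f hf
  have hoc := him.ordConnected
  have key : ∀ a b : ℤ, a < b → (a : ℝ) ∈ f '' s → (b : ℝ) ∈ f '' s → False := by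
    intro a b hab ha hb
    have h1 : (a : ℝ) + 1 ≤ b := by exact_mod_cast hab
    obtain ⟨y, hy, hyv⟩ := hoc.out ha hb (show (a : ℝ) + 1 / 2 ∈ Icc (a : ℝ) b from
      ⟨by linarith, by linarith⟩)
    obtain ⟨j, hj⟩ := h y hy
    rw [hj] at hyv
    have h2 : ((2 * j : ℤ) : ℝ) = ((2 * a + 1 : ℤ) : ℝ) := by push_cast; linarith
    have h3 := Int.cast_injective h2
    omega
  rcases lt_or_gt_of_ne hkn with h' | h'
  · exact key k n h' ⟨x, hx, hk⟩ ⟨x0, hx0, hn⟩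
  · exact key n k h' ⟨x0, hx0, hn⟩ ⟨x, hx, hk⟩

/-- An increasing homeomorphism from `ℝ` onto `(-1, 1)`. -/
def rho (x : ℝ) : ℝ := x / (1 + |x|)

lemma rho_continuous : Continuous rho := by
  unfold rho
  exact continuous_id.div (by fun_prop) fun x => by positivity

lemma abs_rho_lt (x : ℝ) : |rho x| < 1 := by
  unfold rho
  rw [abs_div, abs_of_pos (by positivity : 0 < 1 + |x|), div_lt_one (by positivity)]
  linarith

lemma rho_strictMono : StrictMono rho := by
  intro x y h
  unfold rho
  rw [div_lt_div_iff₀ (by positivity) (by positivity)]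
  rcases abs_cases x with ⟨h1, h2⟩ | ⟨h1, h2⟩ <;> rcases abs_cases y with ⟨h3, h4⟩ | ⟨h3, h4⟩ <;>
    rw [h1, h3] <;> nlinarith

lemma rho_neg (x : ℝ) : rho (-x) = -rho x := by simp [rho, neg_div]

lemma exists_rho_eq {e : ℝ} (h : |e| < 1) : ∃ x, rho x = e := by
  refine ⟨e / (1 - |e|), ?_⟩
  have h1 : 0 < 1 - |e| := by linarith
  unfold rho
  rw [abs_div, abs_of_pos h1]
  field_simp
  ring

lemma tendsto_one_sub_abs_rho : Tendsto (fun x : ℝ => 1 - |rho x|) (comap abs atTop) (𝓝 0) := by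
  have h : (fun x : ℝ => 1 - |rho x|) = (fun y : ℝ => (1 + y)⁻¹) ∘ abs := by
    ext x
    unfold rho
    rw [abs_div, abs_of_pos (by positivity : 0 < 1 + |x|)]
    simp only [Function.comp]
    field_simp
    ring
  rw [h]
  exact (tendsto_inv_atTop_zero.comp (tendsto_atTop_add_const_left _ 1 tendsto_id)).comp
    tendsto_comap

/-- A continuous function on a connected open subset of the plane which blows up at every
point outside extends, after rescaling its values to `(-1, 1)`, to a continuous function on
the plane with values `±1` outside. -/
theorem exists_extension {Ω : Set (ℝ × ℝ)} (hO : IsOpen Ω) (hC : IsConnected Ω)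
    {v : ℝ × ℝ → ℝ} (hv : ContinuousOn v Ω)
    (hb : ∀ p, p ∉ Ω → Tendsto (fun q => |v q|) (𝓝[Ω] p) atTop) :
    ∃ χ : ℝ × ℝ → ℝ, Continuous χ ∧ (∀ p ∈ Ω, χ p = rho (v p)) ∧ ∀ p, p ∉ Ω → |χ p| = 1 := by
  classical
  let φ : ℝ × ℝ → ℂ := fun p =>
    if p ∈ Ω then Complex.exp ((π * rho (v p) : ℝ) * Complex.I) else -1
  have hφ : Continuous φ := by
    rw [continuous_iff_continuousAt]
    intro p
    by_cases hp : p ∈ Ω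
    · have h1 : ContinuousAt (fun q => Complex.exp ((π * rho (v q) : ℝ) * Complex.I)) p := by
        have hvp : ContinuousAt v p := hv.continuousAt (hO.mem_nhds hp)
        have : ContinuousAt (fun q => rho (v q)) p := rho_continuous.continuousAt.comp hvp
        fun_prop
      refine h1.congr ?_
      filter_upwards [hO.mem_nhds hp] with q hq
      simp [φ, hq]
    · have e1 : φ p = -1 := by simp [φ, hp]
      rw [ContinuousAt, e1]
      rw [← nhdsWithin_univ, ← union_compl_self Ω, nhdsWithin_union]
      refine Tendsto.sup ?_ ?_
      · have h1 : Tendsto (fun q => 1 - |rho (v q)|) (𝓝[Ω] p) (𝓝 0) :=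
          tendsto_one_sub_abs_rho.comp (tendsto_comap_iff.2 (hb p hp))
        rw [tendsto_iff_norm_sub_tendsto_zero]
        have h2 : Tendsto (fun q => π * (1 - |rho (v q)|)) (𝓝[Ω] p) (𝓝 0) := by
          simpa using h1.const_mul π
        refine tendsto_of_tendsto_of_tendsto_of_le_of_le' tendsto_const_nhds h2
          (Eventually.of_forall fun q => norm_nonneg _) ?_
        filter_upwards [self_mem_nhdsWithin] with q hq
        have key : ∀ x : ℝ, ‖Complex.exp ((x : ℝ) * Complex.I) - -1‖ ≤ |π - abs x| := by
          intro x
          have h3 : ∀ y : ℝ, ‖Complex.exp ((y : ℝ) * Complex.I) - -1‖ ≤ |y - π| := by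
            intro y
            have e : Complex.exp ((y : ℝ) * Complex.I) - -1
                = -(Complex.exp (((y - π : ℝ)) * Complex.I) - 1) := by
              have : Complex.exp (((y - π : ℝ)) * Complex.I)
                  = - Complex.exp ((y : ℝ) * Complex.I) := by
                push_cast
                rw [sub_mul, Complex.exp_sub, Complex.exp_pi_mul_I]
                ring
              rw [this]; ring
            rw [e, norm_neg]
            have h4 := Real.norm_exp_I_mul_ofReal_sub_one_le (x := y - π)
            rw [mul_comm]
            simpa using h4
          rcases abs_cases x with ⟨h4, h5⟩ | ⟨h4, h5⟩
          · rw [h4, abs_sub_comm]; exact h3 x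
          · rw [h4]
            have h6 := h3 (-x)
            rw [abs_sub_comm] at h6
            have e : Complex.exp (((-x : ℝ)) * Complex.I) - -1
              = (starRingEnd ℂ) (Complex.exp ((x : ℝ) * Complex.I) - -1) := by
              rw [map_sub, ← Complex.exp_conj]; simp
            rw [e, RCLike.norm_conj] at h6
            exact h6
        have h7 := key (π * rho (v q))
        simp only [φ, hq, if_true]
        refine h7.trans ?_
        rw [abs_mul, abs_of_pos pi_pos, abs_of_nonneg]
        · linarith
        · nlinarith [pi_pos, abs_rho_lt (v q)]
      · refine tendsto_const_nhds.congr' ?_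
        filter_upwards [self_mem_nhdsWithin] with q hq
        simp only [mem_compl_iff] at hq
        simp [φ, hq]
  have hφ0 : ∀ p, φ p ≠ 0 := by
    intro p
    by_cases hp : p ∈ Ω
    · simp only [φ, hp, if_true]; exact Complex.exp_ne_zero _
    · simp [φ, hp]
  obtain ⟨g, hg, hgφ⟩ := exists_continuous_log φ hφ hφ0
  let θ : ℝ × ℝ → ℝ := fun p => (g p).im
  have hθ : Continuous θ := Complex.continuous_im.comp hg
  have hex : ∀ (z : ℂ) (y : ℝ), Complex.exp z = Complex.exp (y * Complex.I) →
      ∃ n : ℤ, (z.im - y) / (2 * π) = n := by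
    intro z y h
    obtain ⟨n, hn⟩ := Complex.exp_eq_exp_iff_exists_int.1 h
    refine ⟨n, ?_⟩
    have h1 := congrArg Complex.im hn
    simp at h1
    rw [h1]; field_simp; ring
  have hcongr : ∀ p ∈ Ω, ∃ n : ℤ, (θ p - π * rho (v p)) / (2 * π) = n := by
    intro p hp
    refine hex _ _ ?_
    rw [hgφ]; simp [φ, hp]
  obtain ⟨n, hn⟩ := hC.isPreconnected.exists_int_eq (f := fun p => (θ p - π * rho (v p)) / (2 * π))
    (((hθ.continuousOn.sub (continuousOn_const.mul
      (rho_continuous.comp_continuousOn hv))).div_const _)) hcongr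
  refine ⟨fun p => max (-1) (min 1 (θ p / π - 2 * n)), by fun_prop, fun p hp => ?_, fun p hp => ?_⟩
  · have h1 := hn p hp
    have h2 : θ p / π - 2 * n = rho (v p) := by
      have := pi_pos
      field_simp at h1 ⊢
      linarith
    have h3 := abs_lt.1 (abs_rho_lt (v p))
    simp only [h2]
    rw [min_eq_right h3.2.le, max_eq_right h3.1.le]
  · obtain ⟨k, hk⟩ := hex (g p) π (by rw [hgφ]; simp [φ, hp])
    have h2 : θ p / π - 2 * n = ((2 * k + 1 - 2 * n : ℤ) : ℝ) := by
      have := pi_pos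
      have : θ p = (g p).im := rfl
      push_cast
      field_simp at hk ⊢
      linarith
    simp only [h2]
    rcases le_or_gt 0 (k - n) with h3 | h3
    · have : (1 : ℝ) ≤ ((2 * k + 1 - 2 * n : ℤ) : ℝ) := by exact_mod_cast (by omega)
      rw [min_eq_left this]; norm_num
    · have : ((2 * k + 1 - 2 * n : ℤ) : ℝ) ≤ -1 := by exact_mod_cast (by omega)
      rw [min_eq_right (by linarith), max_eq_left this]; norm_num

lemma isPreconnected_of_split {X : Type*} [TopologicalSpace X] {S : Set X} (hS : IsOpen S)
    (h : ∀ A B : Set X, IsOpen A → IsOpen B → Disjoint A B → A ∪ B = S → A.Nonempty →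
      B.Nonempty → False) : IsPreconnected S := by
  rw [isPreconnected_iff_subset_of_disjoint]
  intro U V hU hV hsub hdis
  by_contra! hcon
  obtain ⟨⟨a, haS, haU⟩, ⟨b, hbS, hbV⟩⟩ := And.imp not_subset.1 not_subset.1 hcon
  refine h (S ∩ U) (S ∩ V) (hS.inter hU) (hS.inter hV) ?_ ?_ ⟨b, hbS, ?_⟩ ⟨a, haS, ?_⟩
  · rw [disjoint_iff_inter_eq_empty, ← hdis]; ext; simp; tauto
  · rw [← inter_union_distrib_left, inter_eq_left.2 hsub]
  · exact (hsub hbS).resolve_right hbV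
  · exact (hsub haS).resolve_left haU

lemma isPreconnected_neg_one_lt {χ : ℝ × ℝ → ℝ} (hχ : Continuous χ) (h1 : ∀ p, |χ p| ≤ 1)
    (hne : {p | |χ p| < 1}.Nonempty)
    (hΩ : IsPreconnected {p | |χ p| < 1}) : IsPreconnected {p | -1 < χ p} := by
  have main : ∀ A B : Set (ℝ × ℝ), IsOpen A → IsOpen B → Disjoint A B →
      A ∪ B = {p | -1 < χ p} → B.Nonempty → {p | |χ p| < 1} ⊆ A → False := by
    intro A B hA hB hd hu hBn hsub
    have hB1 : B ⊆ {p | χ p = 1} := by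
      intro p hp
      have h2 : -1 < χ p := by have : p ∈ A ∪ B := Or.inr hp; rwa [hu] at this
      by_contra h3
      have h4 : χ p < 1 := lt_of_le_of_ne (abs_le.1 (h1 p)).2 h3
      exact disjoint_left.1 hd (hsub (abs_lt.2 ⟨h2, h4⟩)) hp
    have hcl : IsClosed B := by
      rw [← closure_subset_iff_isClosed]
      intro p hp
      have h2 : χ p = 1 := closure_minimal hB1 (isClosed_eq hχ continuous_const) hp
      have h3 : p ∈ A ∪ B := by rw [hu]; simp [h2]
      refine h3.resolve_left fun h4 => ?_
      exact disjoint_left.1 (hd.closure_right hA) h4 hp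
    rcases isClopen_iff.1 ⟨hcl, hB⟩ with h | h
    · exact hBn.ne_empty h
    · obtain ⟨x, hx⟩ := hne
      exact disjoint_left.1 hd (hsub hx) (h ▸ mem_univ _)
  refine isPreconnected_of_split (isOpen_lt continuous_const hχ) ?_
  intro A B hA hB hd hu hAn hBn
  have hs : {p | |χ p| < 1} ⊆ A ∪ B := by
    rw [hu]; intro p (hp : |χ p| < 1); exact (abs_lt.1 hp).1
  rcases hΩ.subset_or_subset hA hB hd hs with h | h
  · exact main A B hA hB hd hu hBn h
  · exact main B A hB hA hd.symm (by rw [union_comm, hu]) hAn h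

/-- Unicoherence of the plane, for two sets defined by a function with values in `[-1, 1]`. -/
theorem isPreconnected_inter_of_lt {χ : ℝ × ℝ → ℝ} (hχ : Continuous χ) (h1 : ∀ p, |χ p| ≤ 1)
    (hne : {p | |χ p| < 1}.Nonempty) (hΩ : IsPreconnected {p | |χ p| < 1}) {e : ℝ} (he : |e| < 1)
    (hOe : IsPreconnected {p | χ p < e}) : IsPreconnected {p | |χ p| < 1 ∧ χ p < e} := by
  classical
  have he' := abs_lt.1 he
  have hpos : IsPreconnected {p | -1 < χ p} := isPreconnected_neg_one_lt hχ h1 hne hΩ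
  refine isPreconnected_of_split
    ((isOpen_lt hχ.abs continuous_const).inter (isOpen_lt hχ continuous_const)) ?_
  intro A B hA hB hd hu ⟨a, ha⟩ ⟨b, hb⟩
  have hmem : ∀ p, p ∈ A ∪ B ↔ |χ p| < 1 ∧ χ p < e := fun p => by rw [hu]; rfl
  have ha1 := (hmem a).1 (Or.inl ha)
  have hb1 := (hmem b).1 (Or.inr hb)
  have hfr : ∀ p ∈ frontier A, χ p = e ∨ χ p = -1 := by
    intro p hp
    have hpA : p ∉ A := fun h => by rw [hA.frontier_eq] at hp; exact hp.2 h
    have hpc : p ∈ closure A := frontier_subset_closure hp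
    have hle : χ p ≤ e := by
      have : A ⊆ {p | χ p ≤ e} := fun q hq => ((hmem q).1 (Or.inl hq)).2.le
      exact closure_minimal this (isClosed_le hχ continuous_const) hpc
    by_contra! h
    have h2 : χ p < e := lt_of_le_of_ne hle h.1
    have h3 : -1 < χ p := lt_of_le_of_ne (abs_le.1 (h1 p)).1 (Ne.symm h.2)
    have h4 : p ∈ A ∪ B := (hmem p).2 ⟨abs_lt.2 ⟨h3, by linarith⟩, h2⟩
    exact disjoint_left.1 (hd.closure_left hB) hpc (h4.resolve_left hpA)
  let l : ℝ × ℝ → ℝ := fun p => (e - χ p) / (e + 1)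
  have hl : Continuous l := by fun_prop
  have hle : ∀ p, χ p = e → l p = 0 := fun p hp => by simp [l, hp]
  have hl1 : ∀ p, χ p = -1 → l p = 1 := fun p hp => by
    have : e + 1 ≠ 0 := by linarith
    simp only [l, hp]; field_simp; ring
  let φ : ℝ × ℝ → ℂ :=
    A.piecewise (fun p => Complex.exp ((2 * π * l p : ℝ) * Complex.I)) (fun _ => 1)
  have hφ : Continuous φ := by
    refine Continuous.piecewise (fun p hp => ?_) (by fun_prop) continuous_const
    rcases hfr p hp with h | h
    · simp [hle p h]
    · simp [hl1 p h, Complex.exp_two_pi_mul_I]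
  have hφ0 : ∀ p, φ p ≠ 0 := fun p => by
    by_cases hp : p ∈ A
    · simp only [φ, hp, piecewise_eq_of_mem]; exact Complex.exp_ne_zero _
    · simp [φ, hp]
  obtain ⟨G, hG, hGφ⟩ := exists_continuous_log φ hφ hφ0
  let θ : ℝ × ℝ → ℝ := fun p => (G p).im / (2 * π)
  have hθ : Continuous θ := (Complex.continuous_im.comp hG).div_const _
  have hcongr : ∀ p, ∀ y : ℝ, φ p = Complex.exp ((2 * π * y : ℝ) * Complex.I) →
      ∃ n : ℤ, θ p - y = n := by
    intro p y hy
    rw [← hGφ] at hy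
    obtain ⟨n, hn⟩ := Complex.exp_eq_exp_iff_exists_int.1 hy
    refine ⟨n, ?_⟩
    have h2 := congrArg Complex.im hn
    simp at h2
    simp only [θ]
    rw [h2]; field_simp; ring
  obtain ⟨k, hk⟩ := hpos.exists_int_eq (f := fun p => θ p - A.piecewise l 0 p)
    (hθ.continuousOn.sub (ContinuousOn.piecewise (fun p hp => by
      rcases hfr p hp.2 with h | h
      · simpa using hle p h
      · have := hp.1; simp [h] at this) hl.continuousOn continuousOn_const)) (by
    intro p _
    by_cases hp : p ∈ A
    · exact hcongr p _ (by simp [φ, hp])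
    · exact hcongr p _ (by simp [φ, hp]))
  obtain ⟨k', hk'⟩ := hOe.exists_int_eq (f := fun p => θ p - A.piecewise (fun p => l p - 1) 0 p)
    (hθ.continuousOn.sub (ContinuousOn.piecewise (fun p hp => by
      rcases hfr p hp.2 with h | h
      · have := hp.1; simp [h] at this
      · simp [hl1 p h]) (by fun_prop) continuousOn_const)) (by
    intro p _
    by_cases hp : p ∈ A
    · refine hcongr p _ ?_
      simp only [φ, hp, piecewise_eq_of_mem]
      rw [Complex.exp_eq_exp_iff_exists_int]
      exact ⟨1, by push_cast; ring⟩
    · exact hcongr p _ (by simp [φ, hp]))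
  have e1 := hk a (abs_lt.1 ha1.1).1
  have e2 := hk' a ha1.2
  have e3 := hk b (abs_lt.1 hb1.1).1
  have e4 := hk' b hb1.2
  have hbA : b ∉ A := fun h => disjoint_left.1 hd h hb
  simp only [ha, hbA, piecewise_eq_of_mem, piecewise_eq_of_notMem, not_false_eq_true,
    Pi.zero_apply, sub_zero] at e1 e2 e3 e4
  linarith

/-- Components of a compact set can be separated from closed sets by relatively clopen pieces. -/
lemma exists_clopen_piece {X : Type*} [TopologicalSpace X] [T2Space X] {K U : Set X}
    (hK : IsCompact K) (hU : IsOpen U) {f : X} (hf : f ∈ K) (hc : connectedComponentIn K f ⊆ U) :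
    ∃ Y ⊆ K, f ∈ Y ∧ Y ⊆ U ∧ IsCompact Y ∧ IsCompact (K \ Y) := by
  have : CompactSpace K := isCompact_iff_compactSpace.1 hK
  rw [connectedComponentIn_eq_image hf, image_subset_iff, connectedComponent_eq_iInter_isClopen]
    at hc
  have : Nonempty { s : Set K // IsClopen s ∧ (⟨f, hf⟩ : K) ∈ s } :=
    ⟨⟨univ, isClopen_univ, mem_univ _⟩⟩
  obtain ⟨Z, hZ⟩ := exists_subset_nhds_of_isCompact'
    (V := fun s : { s : Set K // IsClopen s ∧ (⟨f, hf⟩ : K) ∈ s } => (s : Set K))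
    (U := ((↑) : K → X) ⁻¹' U)
    (by
      rintro ⟨s, hs⟩ ⟨t, ht⟩
      exact ⟨⟨s ∩ t, hs.1.inter ht.1, hs.2, ht.2⟩, inter_subset_left, inter_subset_right⟩)
    (fun s => s.2.1.isClosed.isCompact) (fun s => s.2.1.isClosed)
    (fun x hx => (hU.preimage continuous_subtype_val).mem_nhds (hc hx))
  refine ⟨(↑) '' (Z : Set K), ?_, ⟨⟨f, hf⟩, Z.2.2, rfl⟩, image_subset_iff.2 hZ,
    Z.2.1.isClosed.isCompact.image continuous_subtype_val, ?_⟩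
  · rintro _ ⟨x, -, rfl⟩; exact x.2
  · have : K \ ((↑) '' (Z : Set K)) = ((↑) '' (Z : Set K)ᶜ : Set X) := by
      ext x
      constructor
      · rintro ⟨hx, h2⟩
        exact ⟨⟨x, hx⟩, fun h => h2 ⟨_, h, rfl⟩, rfl⟩
      · rintro ⟨y, hy, rfl⟩
        refine ⟨y.2, ?_⟩
        rintro ⟨z, hz, hzy⟩
        exact hy (Subtype.ext hzy ▸ hz)
    rw [this]
    exact Z.2.1.compl.isClosed.isCompact.image continuous_subtype_val

lemma mem_Ioo_of_sin_nonpos {f : ℝ → ℝ} (hf : Continuous f) (hs : ∀ t, Real.sin (f t) ≤ 0) {a : ℝ}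
    (ha : f a ∈ Ioo (-(3 * π / 2)) (π / 2)) (t : ℝ) : f t ∈ Ioo (-(3 * π / 2)) (π / 2) := by
  have hoc : (range f).OrdConnected := (isPreconnected_range hf).ordConnected
  have h1 : π / 2 ∉ range f := by
    rintro ⟨x, hx⟩; have := hs x; rw [hx, Real.sin_pi_div_two] at this; linarith
  have h2 : -(3 * π / 2) ∉ range f := by
    rintro ⟨x, hx⟩
    have := hs x
    have e : -(3 * π / 2) = π / 2 - 2 * π := by ring
    rw [hx, e, Real.sin_sub_two_pi, Real.sin_pi_div_two] at this
    linarith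
  constructor
  · by_contra h
    exact h2 (hoc.out (mem_range_self t) (mem_range_self a) ⟨not_lt.1 h, ha.1.le⟩)
  · by_contra h
    exact h1 (hoc.out (mem_range_self a) (mem_range_self t) ⟨ha.2.le, not_lt.1 h⟩)

lemma mem_Ioo_of_sin_nonneg {f : ℝ → ℝ} (hf : Continuous f) (hs : ∀ t, 0 ≤ Real.sin (f t)) {a : ℝ}
    (ha : f a ∈ Ioo (-(π / 2)) (3 * π / 2)) (t : ℝ) : f t ∈ Ioo (-(π / 2)) (3 * π / 2) := by
  have := mem_Ioo_of_sin_nonpos (f := fun t => -f t) hf.neg (fun t => by simpa using hs t)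
    (a := a) ⟨by linarith [ha.2], by linarith [ha.1]⟩ t
  exact ⟨by linarith [this.2], by linarith [this.1]⟩

lemma eq_int_mul_pi_of_sin_eq_zero {x : ℝ} (hs : Real.sin x = 0) :
    ∃ n : ℤ, x = n * π ∧ ((Even n ∧ Real.cos x = 1) ∨ (Odd n ∧ Real.cos x = -1)) := by
  obtain ⟨n, hn⟩ := Real.sin_eq_zero_iff.1 hs
  refine ⟨n, hn.symm, ?_⟩
  rw [← hn]
  rcases Int.even_or_odd n with h | h
  · exact Or.inl ⟨h, by rw [Real.cos_int_mul_pi, h.neg_one_zpow]⟩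
  · exact Or.inr ⟨h, by rw [Real.cos_int_mul_pi, h.neg_one_zpow]⟩

/-- Two paths in a half plane whose endpoints on the boundary line are interlaced meet. -/
lemma paths_meet {p q : ℝ → ℝ × ℝ} (hp : Continuous p) (hq : Continuous q) {H : ℝ}
    (hpH : ∀ t, (p t).2 ≤ H) (hqH : ∀ t, (q t).2 ≤ H)
    (hp0 : (p 0).2 = H) (hp1 : (p 1).2 = H) (hq0 : (q 0).2 = H) (hq1 : (q 1).2 = H)
    (h1 : (p 0).1 < (q 0).1) (h2 : (q 0).1 < (p 1).1) (h3 : (p 1).1 < (q 1).1) :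
    ∃ t t', p t = q t' := by
  by_contra! hne
  let F : ℝ × ℝ → ℂ := fun x => ⟨(q x.2).1 - (p x.1).1, (q x.2).2 - (p x.1).2⟩
  have hF : Continuous F := by
    have : F = fun x => Complex.equivRealProdCLM.symm (q x.2 - p x.1) := by
      ext x; apply Complex.ext <;> simp [F, Complex.equivRealProdCLM_symm_apply]
    rw [this]; fun_prop
  have hF0 : ∀ x, F x ≠ 0 := fun x h => hne x.1 x.2 <| by
    have hr := congrArg Complex.re h
    have hi := congrArg Complex.im h
    simp only [F, Complex.zero_re, Complex.zero_im] at hr hi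
    exact Prod.ext (by linarith) (by linarith)
  obtain ⟨G, hG, hGF⟩ := exists_continuous_log F hF hF0
  have him : ∀ x, Real.exp (G x).re * Real.sin (G x).im = (q x.2).2 - (p x.1).2 := fun x => by
    rw [← Complex.exp_im, hGF]
  have hre : ∀ x, Real.exp (G x).re * Real.cos (G x).im = (q x.2).1 - (p x.1).1 := fun x => by
    rw [← Complex.exp_re, hGF]
  have hs0 : ∀ x, (q x.2).2 = (p x.1).2 → Real.sin (G x).im = 0 := fun x hx => by
    have := him x
    rw [hx, sub_self] at this
    exact (mul_eq_zero.1 this).resolve_left (Real.exp_pos _).ne'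
  have hcp : ∀ x, (p x.1).1 < (q x.2).1 → 0 < Real.cos (G x).im := fun x hx => by
    have := hre x
    exact pos_of_mul_pos_right (by rw [this]; linarith) (Real.exp_pos _).le
  have hcn : ∀ x, (q x.2).1 < (p x.1).1 → Real.cos (G x).im < 0 := fun x hx => by
    have := hre x
    exact neg_of_mul_neg_right (by rw [this]; linarith) (Real.exp_pos _).le
  have hsn : ∀ x, (q x.2).2 ≤ (p x.1).2 → Real.sin (G x).im ≤ 0 := fun x hx => by
    have := him x
    exact nonpos_of_mul_nonpos_right (by rw [this]; linarith) (Real.exp_pos _)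
  have hsp : ∀ x, (p x.1).2 ≤ (q x.2).2 → 0 ≤ Real.sin (G x).im := fun x hx => by
    have := him x
    exact nonneg_of_mul_nonneg_right (by rw [this]; linarith) (Real.exp_pos _)
  obtain ⟨n, hn, hn'⟩ := eq_int_mul_pi_of_sin_eq_zero (hs0 (0, 0) (by simp [hp0, hq0]))
  have hn2 : Even n := by
    rcases hn' with h | h
    · exact h.1
    · have := hcp (0, 0) h1; rw [h.2] at this; linarith
  let θ : ℝ × ℝ → ℝ := fun x => (G x).im - n * π
  have hθ : Continuous θ := (Complex.continuous_im.comp hG).sub continuous_const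
  have hsin : ∀ x, Real.sin (θ x) = Real.sin (G x).im := fun x => by
    simp only [θ]; rw [Real.sin_sub_int_mul_pi, hn2.neg_one_zpow, one_mul]
  have hcos : ∀ x, Real.cos (θ x) = Real.cos (G x).im := fun x => by
    simp only [θ]; rw [Real.cos_sub_int_mul_pi, hn2.neg_one_zpow, one_mul]
  have hθ0 : θ (0, 0) = 0 := by simp only [θ]; rw [hn]; ring
  have hpi := pi_pos
  have c01 := mem_Ioo_of_sin_nonpos (f := fun t => θ (0, t)) (by fun_prop)
    (fun t => by rw [hsin]; exact hsn _ (by simp only [hp0]; exact hqH _)) (a := 0)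
    ⟨by simp only [hθ0]; linarith, by simp only [hθ0]; linarith⟩ 1
  have val : ∀ x, (q x.2).2 = (p x.1).2 → -(3 * π / 2) < θ x → θ x < 3 * π / 2 →
      (θ x = 0 ∧ (p x.1).1 ≤ (q x.2).1) ∨
      ((θ x = π ∨ θ x = -π) ∧ (q x.2).1 ≤ (p x.1).1) := by
    intro x hx hx1 hx2
    obtain ⟨k, hk, hk'⟩ := eq_int_mul_pi_of_sin_eq_zero ((hsin x).trans (hs0 x hx))
    have hk1 : (k : ℝ) < 2 := by
      by_contra h; push Not at h; nlinarith
    have hk2 : (-2 : ℝ) < k := by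
      by_contra h; push Not at h; nlinarith
    have hk3 : k < 2 := by exact_mod_cast hk1
    have hk4 : -2 < k := by exact_mod_cast hk2
    rcases hk' with h | h
    · left
      have hk0 : k = 0 := by
        obtain ⟨j, hj⟩ := h.1; omega
      refine ⟨by rw [hk, hk0]; simp, ?_⟩
      by_contra h6
      have := hcn x (not_le.1 h6)
      rw [← hcos, h.2] at this; linarith
    · right
      have hk0 : k = 1 ∨ k = -1 := by
        obtain ⟨j, hj⟩ := h.1; omega
      refine ⟨by rcases hk0 with h | h <;> [left; right] <;> rw [hk, h] <;> simp, ?_⟩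
      by_contra h6
      have := hcp x (not_le.1 h6)
      rw [← hcos, h.2] at this; linarith
  have hθ01 : θ (0, 1) = 0 := by
    rcases val (0, 1) (by simp [hp0, hq1]) c01.1 (by linarith [c01.2]) with h | h
    · exact h.1
    · have := h.2; dsimp only at this; linarith
  have c11 := mem_Ioo_of_sin_nonneg (f := fun t => θ (t, 1)) (by fun_prop)
    (fun t => by rw [hsin]; exact hsp _ (by simp only [hq1]; exact hpH _)) (a := 0)
    ⟨by simp only [hθ01]; linarith, by simp only [hθ01]; linarith⟩ 1
  have hθ11 : θ (1, 1) = 0 := by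
    rcases val (1, 1) (by simp [hp1, hq1]) (by linarith [c11.1]) c11.2 with h | h
    · exact h.1
    · have := h.2; dsimp only at this; linarith
  have c10 := mem_Ioo_of_sin_nonpos (f := fun t => θ (1, t)) (by fun_prop)
    (fun t => by rw [hsin]; exact hsn _ (by simp only [hp1]; exact hqH _)) (a := 1)
    ⟨by simp only [hθ11]; linarith, by simp only [hθ11]; linarith⟩ 0
  have c10' := mem_Ioo_of_sin_nonneg (f := fun t => θ (t, 0)) (by fun_prop)
    (fun t => by rw [hsin]; exact hsp _ (by simp only [hq0]; exact hpH _)) (a := 0)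
    ⟨by simp only [hθ0]; linarith, by simp only [hθ0]; linarith⟩ 1
  rcases val (1, 0) (by simp [hp1, hq0]) c10.1 c10'.2 with h | h
  · have := h.2; dsimp only at this; linarith
  · have h4 := c10.2
    have h5 := c10'.1
    rcases h.1 with h | h <;> linarith

lemma IsPreconnected.thickening {X : Type*} [NormedAddCommGroup X] [NormedSpace ℝ X] {s : Set X}
    (hs : IsPreconnected s) (δ : ℝ) : IsPreconnected (Metric.thickening δ s) := by
  rcases s.eq_empty_or_nonempty with rfl | ⟨x0, hx0⟩
  · simpa using isPreconnected_empty
  rcases le_or_gt δ 0 with hδ | hδ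
  · rw [Metric.thickening_of_nonpos hδ]; exact isPreconnected_empty
  refine isPreconnected_of_forall x0 fun y hy => ?_
  obtain ⟨x, hx, hxy⟩ := Metric.mem_thickening_iff.1 hy
  refine ⟨s ∪ ball x δ, union_subset (Metric.self_subset_thickening hδ s)
    (Metric.ball_subset_thickening hx δ), Or.inl hx0, Or.inr hxy, ?_⟩
  exact hs.union x hx (mem_ball_self hδ) (isPreconnected_ball)

/-- Two compact connected sets in a half plane with interlaced points on the boundary line
meet. -/
theorem connected_sets_meet {P Q : Set (ℝ × ℝ)} (hP : IsCompact P) (hQ : IsCompact Q)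
    (hPc : IsPreconnected P) (hQc : IsPreconnected Q) {H : ℝ}
    (hPH : ∀ x ∈ P, x.2 ≤ H) (hQH : ∀ x ∈ Q, x.2 ≤ H) {p1 p2 q1 q2 : ℝ}
    (hp1 : (p1, H) ∈ P) (hp2 : (p2, H) ∈ P) (hq1 : (q1, H) ∈ Q) (hq2 : (q2, H) ∈ Q)
    (h1 : p1 < q1) (h2 : q1 < p2) (h3 : p2 < q2) : ∃ x ∈ P, x ∈ Q := by
  by_contra! hdis
  obtain ⟨δ, hδ, hd⟩ := (disjoint_left.2 hdis : Disjoint P Q).exists_thickenings hP hQ.isClosed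
  have key : ∀ P : Set (ℝ × ℝ), IsPreconnected P → (∀ x ∈ P, x.2 ≤ H) → ∀ a b : ℝ,
      (a, H) ∈ P → (b, H) ∈ P → ∃ p : ℝ → ℝ × ℝ, Continuous p ∧ (∀ t, (p t).2 ≤ H) ∧
      p 0 = (a, H) ∧ p 1 = (b, H) ∧ ∀ t, p t ∈ Metric.thickening δ P := by
    intro P hPc hPH a b ha hb
    have hsub := Metric.self_subset_thickening hδ P
    have hpc : IsPathConnected (Metric.thickening δ P) :=
      (Metric.isOpen_thickening.isConnected_iff_isPathConnected).1
        ⟨⟨_, hsub ha⟩, hPc.thickening δ⟩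
    obtain ⟨γ, hγ⟩ := hpc.joinedIn _ (hsub ha) _ (hsub hb)
    refine ⟨fun t => ((γ.extend t).1, min (γ.extend t).2 H), ?_, fun t => min_le_right _ _, ?_, ?_,
      fun t => ?_⟩
    · have := γ.continuous_extend
      fun_prop
    · simp
    · simp
    · have hm : γ.extend t ∈ Metric.thickening δ P := hγ _
      obtain ⟨x, hx, hxd⟩ := Metric.mem_thickening_iff.1 hm
      refine Metric.mem_thickening_iff.2 ⟨x, hx, lt_of_le_of_lt ?_ hxd⟩
      rw [Prod.dist_eq, Prod.dist_eq]
      refine max_le_max le_rfl ?_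
      rw [Real.dist_eq, Real.dist_eq]
      dsimp only
      have hxH := hPH x hx
      rcases min_cases (γ.extend t).2 H with ⟨h, h'⟩ | ⟨h, h'⟩ <;> rw [h]
      rw [abs_of_nonneg (by linarith), abs_of_nonneg (by linarith)]
      linarith
  obtain ⟨p, hpc, hpH, hp0, hp1', hpP⟩ := key P hPc hPH p1 p2 hp1 hp2
  obtain ⟨q, hqc, hqH, hq0, hq1', hqQ⟩ := key Q hQc hQH q1 q2 hq1 hq2
  obtain ⟨t, t', ht⟩ := paths_meet hpc hqc hpH hqH (by rw [hp0]) (by rw [hp1']) (by rw [hq0])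
    (by rw [hq1']) (by rw [hp0, hq0]; exact h1) (by rw [hp1', hq0]; exact h2)
    (by rw [hp1', hq1']; exact h3)
  exact disjoint_left.1 hd (hpP t) (ht ▸ hqQ t')

/-- The linear form `(s, t) ↦ a s + b t`. -/
def lin (a b : ℝ) : ℝ × ℝ →L[ℝ] ℝ :=
  a • ContinuousLinearMap.fst ℝ ℝ ℝ + b • ContinuousLinearMap.snd ℝ ℝ ℝ

@[simp] lemma lin_apply (a b : ℝ) (p : ℝ × ℝ) : lin a b p = a * p.1 + b * p.2 := by simp [lin]

lemma eq_lin (L : ℝ × ℝ →L[ℝ] ℝ) : L = lin (L (1, 0)) (L (0, 1)) := by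
  ext <;> simp

/-- A smooth solution of the translator equation on a connected open subset of a strip whose
graph is complete. -/
structure Sol (σ c w : ℝ) (Ω : Set (ℝ × ℝ)) (u : ℝ × ℝ → ℝ) : Prop where
  isOpen : IsOpen Ω
  isConnected : IsConnected Ω
  smooth : ContDiffOn ℝ (⊤ : ℕ∞) u Ω
  pde : ∀ p ∈ Ω, (1 + (pdt u p) ^ 2) * pds (pds u) p - 2 * pds u p * pdt u p * pdt (pds u) p
      + (1 + (pds u p) ^ 2) * pdt (pdt u) p
    = (1 + (pds u p) ^ 2 + (pdt u p) ^ 2) * (σ - c * pdt u p)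
  strip : ∀ p ∈ Ω, |p.1| ≤ w
  blowup : ∀ p, p ∉ Ω → Tendsto (fun q => |u q|) (𝓝[Ω] p) atTop

lemma hasFDerivAt_lin {f : ℝ × ℝ → ℝ} {p : ℝ × ℝ} (hf : DifferentiableAt ℝ f p) :
    HasFDerivAt f (lin (pds f p) (pdt f p)) p := by
  have := hf.hasFDerivAt
  rwa [eq_lin (fderiv ℝ f p)] at this

lemma smooth_pds {Ω : Set (ℝ × ℝ)} (hO : IsOpen Ω) {f : ℝ × ℝ → ℝ}
    (hf : ContDiffOn ℝ (⊤ : ℕ∞) f Ω) : ContDiffOn ℝ (⊤ : ℕ∞) (pds f) Ω :=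
  (hf.fderiv_of_isOpen hO (m := (⊤ : ℕ∞)) (by simp)).clm_apply contDiffOn_const

lemma smooth_pdt {Ω : Set (ℝ × ℝ)} (hO : IsOpen Ω) {f : ℝ × ℝ → ℝ}
    (hf : ContDiffOn ℝ (⊤ : ℕ∞) f Ω) : ContDiffOn ℝ (⊤ : ℕ∞) (pdt f) Ω :=
  (hf.fderiv_of_isOpen hO (m := (⊤ : ℕ∞)) (by simp)).clm_apply contDiffOn_const

lemma smooth_hasFDerivAt {Ω : Set (ℝ × ℝ)} (hO : IsOpen Ω) {f : ℝ × ℝ → ℝ}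
    (hf : ContDiffOn ℝ (⊤ : ℕ∞) f Ω) {p : ℝ × ℝ} (hp : p ∈ Ω) :
    HasFDerivAt f (lin (pds f p) (pdt f p)) p :=
  hasFDerivAt_lin ((hf.contDiffAt (hO.mem_nhds hp)).differentiableAt (by simp))

lemma pdt_pds {Ω : Set (ℝ × ℝ)} (hO : IsOpen Ω) {f : ℝ × ℝ → ℝ}
    (hf : ContDiffOn ℝ (⊤ : ℕ∞) f Ω) {p : ℝ × ℝ} (hp : p ∈ Ω) :
    pds (pdt f) p = pdt (pds f) p := by
  have h := (hf.contDiffAt (hO.mem_nhds hp)).isSymmSndFDerivAt (by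
    rw [minSmoothness_of_isRCLikeNormedField]
    exact WithTop.coe_le_coe.2 (le_top : (2 : ℕ∞) ≤ ⊤))
  have hd : DifferentiableAt ℝ (fderiv ℝ f) p :=
    ((hf.fderiv_of_isOpen hO (m := (⊤ : ℕ∞)) (by simp)).contDiffAt
      (hO.mem_nhds hp)).differentiableAt (by simp)
  have key : ∀ a b, fderiv ℝ (fun q => fderiv ℝ f q a) p b = fderiv ℝ (fderiv ℝ f) p b a := by
    intro a b
    rw [fderiv_clm_apply hd (differentiableAt_const a)]
    simp
  unfold pds pdt
  rw [key, key]
  exact h _ _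

lemma deriv_test {h h' : ℝ → ℝ} {k : ℝ} (h1 : ∀ᶠ t in 𝓝 0, HasDerivAt h (h' t) t)
    (h2 : HasDerivAt h' k 0) (hm : IsLocalMin h 0) : h' 0 = 0 ∧ 0 ≤ k := by
  have h0 : h' 0 = 0 := hm.hasDerivAt_eq_zero h1.self_of_nhds
  refine ⟨h0, ?_⟩
  by_contra! hk
  have hd : deriv h =ᶠ[𝓝 0] h' := h1.mono fun t ht => ht.deriv
  have hdd : deriv (deriv h) 0 = k := by rw [hd.deriv_eq, h2.deriv]
  have hM := isLocalMax_of_deriv_deriv_neg (by rw [hdd]; exact hk)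
    (by rw [h1.self_of_nhds.deriv, h0]) h1.self_of_nhds.continuousAt
  have hc : h =ᶠ[𝓝 0] fun _ => h 0 := by
    filter_upwards [hm, hM] with t a b using le_antisymm b a
  have hc' : deriv h =ᶠ[𝓝 0] fun _ => 0 := by
    have := hc.deriv
    simpa using this
  have := hc'.deriv_eq
  rw [hdd] at this
  simp at this
  linarith

lemma hessian_test {f fs ft : ℝ × ℝ → ℝ} {p : ℝ × ℝ} {k11 k12 k22 : ℝ}
    (h1 : ∀ᶠ q in 𝓝 p, HasFDerivAt f (lin (fs q) (ft q)) q)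
    (hs : HasFDerivAt fs (lin k11 k12) p) (ht : HasFDerivAt ft (lin k12 k22) p)
    (hm : IsLocalMin f p) :
    fs p = 0 ∧ ft p = 0 ∧ ∀ a b : ℝ, 0 ≤ a ^ 2 * k11 + 2 * a * b * k12 + b ^ 2 * k22 := by
  have key : ∀ a b : ℝ, a * fs p + b * ft p = 0 ∧
      0 ≤ a ^ 2 * k11 + 2 * a * b * k12 + b ^ 2 * k22 := by
    intro a b
    let l : ℝ → ℝ × ℝ := fun t => p + t • (a, b)
    have hl : ∀ t, HasDerivAt l (a, b) t := fun t => by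
      have := ((hasDerivAt_id t).smul_const (a, b)).const_add p
      rwa [one_smul] at this
    have hl0 : l 0 = p := by simp [l]
    have hlc : Tendsto l (𝓝 0) (𝓝 p) := by
      have := (hl 0).continuousAt.tendsto; rwa [hl0] at this
    have := deriv_test (h := f ∘ l) (h' := fun t => a * fs (l t) + b * ft (l t))
      (k := a ^ 2 * k11 + 2 * a * b * k12 + b ^ 2 * k22) ?_ ?_ ?_
    · simpa [hl0] using this
    · filter_upwards [hlc.eventually h1] with t ht
      have := ht.comp_hasDerivAt t (hl t)
      simpa [mul_comm] using this
    · have e1 := (hl0 ▸ hs : HasFDerivAt fs (lin k11 k12) (l 0)).comp_hasDerivAt 0 (hl 0)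
      have e2 := (hl0 ▸ ht : HasFDerivAt ft (lin k12 k22) (l 0)).comp_hasDerivAt 0 (hl 0)
      refine ((e1.const_mul a).add (e2.const_mul b)).congr_deriv ?_
      simp only [lin_apply]; ring
    · have : IsLocalMin f (l 0) := hl0.symm ▸ hm
      exact this.comp_continuous (hl 0).continuousAt
  refine ⟨by simpa using (key 1 0).1, by simpa using (key 0 1).1, fun a b => (key a b).2⟩

/-- Comparison principle at an interior minimum of `u - U`. -/
theorem Sol.comparison {σ c w : ℝ} {Ω : Set (ℝ × ℝ)} {u : ℝ × ℝ → ℝ} (hS : Sol σ c w Ω u)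
    {p : ℝ × ℝ} (hp : p ∈ Ω) {U gs gt : ℝ × ℝ → ℝ} {h11 h12 h22 : ℝ}
    (hU : ∀ᶠ q in 𝓝 p, HasFDerivAt U (lin (gs q) (gt q)) q)
    (hgs : HasFDerivAt gs (lin h11 h12) p) (hgt : HasFDerivAt gt (lin h12 h22) p)
    (hmin : IsLocalMin (fun q => u q - U q) p) :
    (1 + gt p ^ 2) * h11 - 2 * gs p * gt p * h12 + (1 + gs p ^ 2) * h22
      ≤ (1 + gs p ^ 2 + gt p ^ 2) * (σ - c * gt p) := by
  have hlin : ∀ a b a' b', lin a b - lin a' b' = lin (a - a') (b - b') := by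
    intros; ext <;> simp
  have h1 : ∀ᶠ q in 𝓝 p, HasFDerivAt (fun q => u q - U q)
      (lin (pds u q - gs q) (pdt u q - gt q)) q := by
    filter_upwards [hU, hS.isOpen.mem_nhds hp] with q hq hqΩ
    rw [← hlin]
    exact (smooth_hasFDerivAt hS.isOpen hS.smooth hqΩ).sub hq
  have h2 : HasFDerivAt (fun q => pds u q - gs q)
      (lin (pds (pds u) p - h11) (pdt (pds u) p - h12)) p := by
    rw [← hlin]
    exact (smooth_hasFDerivAt hS.isOpen (smooth_pds hS.isOpen hS.smooth) hp).sub hgs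
  have h3 : HasFDerivAt (fun q => pdt u q - gt q)
      (lin (pdt (pds u) p - h12) (pdt (pdt u) p - h22)) p := by
    rw [← hlin, ← pdt_pds hS.isOpen hS.smooth hp]
    exact (smooth_hasFDerivAt hS.isOpen (smooth_pdt hS.isOpen hS.smooth) hp).sub hgt
  obtain ⟨es, et, hq⟩ := hessian_test h1 h2 h3 hmin
  have hpde := hS.pde p hp
  have es' : pds u p = gs p := by linarith
  have et' : pdt u p = gt p := by linarith
  rw [es', et'] at hpde
  have := hq 1 0
  have := hq 0 1
  have := hq (gt p) (-gs p)
  nlinarith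

/-- A bounded increasing concave barrier profile, with infinite slope at `0`. -/
structure Profile (A : ℝ) (φ φ1 φ2 : ℝ → ℝ) : Prop where
  deriv1 : ∀ r, 0 < r → HasDerivAt φ (φ1 r) r
  deriv2 : ∀ r, 0 < r → HasDerivAt φ1 (φ2 r) r
  cont : Continuous φ
  zero : φ 0 = 0
  nonneg : ∀ r, 0 ≤ φ r
  le : ∀ r, φ r ≤ A
  pos1 : ∀ r, 0 < r → 0 < φ1 r
  steep : ∀ M, ∀ᶠ r in 𝓝[>] 0, M * r < φ r

theorem exists_profile {k : ℝ} (hk : 0 < k) (Q X0 : ℝ) (hQ : 0 ≤ Q) :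
    ∃ A φ φ1 φ2, 0 < A ∧ Profile A φ φ1 φ2 ∧
      (∀ r, 0 < r → -φ2 r < k * φ1 r * (1 + φ1 r ^ 2)) ∧ ∀ r, 0 < r → r ≤ Q → X0 ≤ φ1 r := by
  obtain ⟨A, hA0, hA1, hA2⟩ : ∃ A : ℝ, 0 < A ∧ 8 * (1 + 2 / k) ^ 3 ≤ k * A ^ 2 ∧
      X0 * (2 * (1 + Q) ^ 2) ≤ A := by
    refine ⟨1 + 8 * (1 + 2 / k) ^ 3 / k + |X0| * (2 * (1 + Q) ^ 2), by positivity, ?_, ?_⟩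
    · have h1 : 0 ≤ |X0| * (2 * (1 + Q) ^ 2) := by positivity
      set B := 8 * (1 + 2 / k) ^ 3 / k with hB
      have hB0 : 0 < B := by positivity
      have h2 : 8 * (1 + 2 / k) ^ 3 = k * B := by rw [hB]; field_simp
      rw [h2]
      gcongr
      nlinarith
    · have : X0 * (2 * (1 + Q) ^ 2) ≤ |X0| * (2 * (1 + Q) ^ 2) := by gcongr; exact le_abs_self _
      have h3 : 0 ≤ 8 * (1 + 2 / k) ^ 3 / k := by positivity
      linarith
  let g : ℝ → ℝ := fun r => √(|r| / (1 + |r|))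
  have hgpos : ∀ r, 0 < r → 0 < g r := fun r hr => by
    simp only [g]; exact Real.sqrt_pos.2 (by positivity)
  have hgsq : ∀ r, 0 < r → g r ^ 2 = r / (1 + r) := fun r hr => by
    simp only [g]; rw [Real.sq_sqrt (by positivity), abs_of_pos hr]
  have hgle : ∀ r, g r ≤ 1 := fun r => by
    simp only [g]
    rw [Real.sqrt_le_one, div_le_one (by positivity)]
    linarith
  have hgd : ∀ r, 0 < r → HasDerivAt g (1 / (2 * g r * (1 + r) ^ 2)) r := fun r hr => by
    have h1 : HasDerivAt (fun r : ℝ => r / (1 + r)) (1 / (1 + r) ^ 2) r := by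
      refine ((hasDerivAt_id r).div ((hasDerivAt_id r).const_add 1) (by simp; positivity)).congr_deriv ?_
      simp
    have h2 : HasDerivAt (fun r : ℝ => |r| / (1 + |r|)) (1 / (1 + r) ^ 2) r := by
      refine h1.congr_of_eventuallyEq ?_
      filter_upwards [lt_mem_nhds hr] with x hx
      rw [abs_of_pos hx]
    refine (h2.sqrt (by positivity)).congr_deriv ?_
    have := hgpos r hr
    simp only [g] at this ⊢
    field_simp
  refine ⟨A, fun r => A * g r, fun r => A * (1 / (2 * g r * (1 + r) ^ 2)),
    fun r => A * (1 / (2 * g r * (1 + r) ^ 2)) * -(1 / (2 * r * (1 + r)) + 2 / (1 + r)), hA0,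
    ⟨fun r hr => (hgd r hr).const_mul A, fun r hr => ?_, ?_, by simp [g], fun r => ?_, fun r => ?_,
      fun r hr => ?_, fun M => ?_⟩, fun r hr => ?_, fun r hr hrQ => ?_⟩
  · have hg := hgpos r hr
    have h1 := ((hgd r hr).const_mul 2).mul (((hasDerivAt_id r).const_add 1).pow 2)
    have h2 := ((h1.inv (by simp; constructor <;> positivity)).const_mul A)
    refine (h2.congr_of_eventuallyEq (Eventually.of_forall fun x => ?_)).congr_deriv ?_
    · simp
    · have := hgsq r hr
      have e : 1 / (2 * r * (1 + r)) = 1 / (2 * g r ^ 2 * (1 + r) ^ 2) := by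
        rw [this]; field_simp
      rw [e]
      simp
      field_simp
  · refine continuous_const.mul (Real.continuous_sqrt.comp ?_)
    exact continuous_abs.div (by fun_prop) fun x => by positivity
  · exact mul_nonneg hA0.le (Real.sqrt_nonneg _)
  · exact mul_le_of_le_one_right hA0.le (hgle r)
  · have := hgpos r hr; positivity
  · have h1 : 0 < min 1 (A ^ 2 / (2 * (M ^ 2 + 1))) := lt_min one_pos (by positivity)
    filter_upwards [Ioo_mem_nhdsGT h1] with r hr
    have hr1 := hr.2.trans_le (min_le_left _ _)
    have hr2 := hr.2.trans_le (min_le_right _ _)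
    refine lt_of_pow_lt_pow_left₀ 2 (mul_nonneg hA0.le (Real.sqrt_nonneg _)) ?_
    rw [mul_pow, mul_pow, hgsq r hr.1]
    rw [lt_div_iff₀ (by positivity)] at hr2
    have h3 : M ^ 2 * r < A ^ 2 / 2 := by nlinarith [hr.1]
    have h4 : A ^ 2 / 2 ≤ A ^ 2 / (1 + r) := by
      have := hr.1
      gcongr; linarith
    have h5 := mul_lt_mul_of_pos_right (h3.trans_le h4) hr.1
    calc M ^ 2 * r ^ 2 = M ^ 2 * r * r := by ring
      _ < _ := h5
      _ = _ := by have := hr.1; field_simp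
  · have hg := hgpos r hr
    set x := A * (1 / (2 * g r * (1 + r) ^ 2)) with hx
    have hx0 : 0 < x := by positivity
    have hx2 : x ^ 2 = A ^ 2 / (4 * r * (1 + r) ^ 3) := by
      rw [hx]
      have : (A * (1 / (2 * g r * (1 + r) ^ 2))) ^ 2 = A ^ 2 / (4 * g r ^ 2 * (1 + r) ^ 4) := by
        field_simp; ring
      rw [this, hgsq r hr]; field_simp
    have h1 : 1 / (2 * r * (1 + r)) + 2 / (1 + r) < 2 / r := by
      rw [div_add_div _ _ (by positivity) (by positivity), div_lt_div_iff₀ (by positivity)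
        (by positivity)]
      nlinarith [mul_pos hr hr, mul_pos (mul_pos hr hr) hr]
    have h2 : 2 / r ≤ k * (1 + x ^ 2) := by
      rw [hx2]
      rcases le_or_gt r (2 / k) with h | h
      · have h3 : 8 * (1 + r) ^ 3 ≤ k * A ^ 2 := le_trans (by gcongr) hA1
        have h4 : 2 / r ≤ k * (A ^ 2 / (4 * r * (1 + r) ^ 3)) := by
          rw [← mul_div_assoc, div_le_div_iff₀ hr (by positivity)]
          nlinarith
        linarith
      · rw [div_lt_iff₀ hk] at h
        have h3 : 2 / r ≤ k := by rw [div_le_iff₀ hr]; linarith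
        have : 0 ≤ k * (A ^ 2 / (4 * r * (1 + r) ^ 3)) := by positivity
        linarith
    have := mul_lt_mul_of_pos_left (h1.trans_le h2) hx0
    linarith
  · have hg := hgpos r hr
    have h1 : 2 * g r * (1 + r) ^ 2 ≤ 2 * (1 + Q) ^ 2 := by
      have := hgle r
      have : (1 + r) ^ 2 ≤ (1 + Q) ^ 2 := by gcongr
      nlinarith
    dsimp only
    rw [mul_one_div, le_div_iff₀ (by positivity)]
    rcases le_or_gt X0 0 with h | h
    · exact (mul_nonpos_of_nonpos_of_nonneg h (by positivity)).trans hA0.le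
    · exact (mul_le_mul_of_nonneg_left h1 h.le).trans hA2

section

lemma hasFDerivAt_fst_lin (p : ℝ × ℝ) : HasFDerivAt (fun q : ℝ × ℝ => q.1) (lin 1 0) p :=
  hasFDerivAt_fst.congr_fderiv (by ext <;> simp)

lemma hasFDerivAt_snd_lin (p : ℝ × ℝ) : HasFDerivAt (fun q : ℝ × ℝ => q.2) (lin 0 1) p :=
  hasFDerivAt_snd.congr_fderiv (by ext <;> simp)

lemma hasFDerivAt_mul_snd (m : ℝ) (p : ℝ × ℝ) :
    HasFDerivAt (fun q : ℝ × ℝ => m * q.2) (lin 0 m) p :=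
  ((hasFDerivAt_snd_lin p).const_mul m).congr_fderiv (by ext <;> simp)

/-- The height function `u - m t`. -/
def hgt (m : ℝ) (u : ℝ × ℝ → ℝ) (p : ℝ × ℝ) : ℝ := u p - m * p.2

/-- A solution of the translator equation, together with a continuous extension `χ` to the plane
of its rescaled height function. -/
structure Data (σ c w m : ℝ) (Ω : Set (ℝ × ℝ)) (u χ : ℝ × ℝ → ℝ) : Prop where
  sol : Sol σ c w Ω u
  cont : Continuous χ
  eq_rho : ∀ p ∈ Ω, χ p = rho (hgt m u p)
  abs_eq : ∀ p, p ∉ Ω → |χ p| = 1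

section
variable {σ c w m : ℝ} {Ω : Set (ℝ × ℝ)} {u χ : ℝ × ℝ → ℝ}

lemma Data.mem_iff (hD : Data σ c w m Ω u χ) {p : ℝ × ℝ} : p ∈ Ω ↔ |χ p| < 1 := by
  by_cases hp : p ∈ Ω
  · simp only [hp, true_iff]; rw [hD.eq_rho p hp]; exact abs_rho_lt _
  · simp only [hp, false_iff]; rw [hD.abs_eq p hp]; exact lt_irrefl _

lemma Data.abs_le_one (hD : Data σ c w m Ω u χ) (p : ℝ × ℝ) : |χ p| ≤ 1 := by
  by_cases hp : p ∈ Ω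
  · exact (hD.mem_iff.1 hp).le
  · exact (hD.abs_eq p hp).le

lemma Data.neg_one_le (hD : Data σ c w m Ω u χ) (p : ℝ × ℝ) : -1 ≤ χ p :=
  (abs_le.1 (hD.abs_le_one p)).1

lemma neg_one_lt_rho (x : ℝ) : -1 < rho x := (abs_lt.1 (abs_rho_lt x)).1

lemma rho_lt_one (x : ℝ) : rho x < 1 := (abs_lt.1 (abs_rho_lt x)).2

lemma Data.mem_of (hD : Data σ c w m Ω u χ) {p : ℝ × ℝ} (h1 : -1 < χ p) (h2 : χ p < 1) : p ∈ Ω :=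
  hD.mem_iff.2 (abs_lt.2 ⟨h1, h2⟩)

lemma Data.eq_neg_one_of (hD : Data σ c w m Ω u χ) {p : ℝ × ℝ} (h1 : p ∉ Ω) (h2 : χ p < 1) :
    χ p = -1 := by
  by_contra h
  exact h1 (hD.mem_of (lt_of_le_of_ne (hD.neg_one_le p) (Ne.symm h)) h2)

lemma Data.lt_iff (hD : Data σ c w m Ω u χ) {p : ℝ × ℝ} (hp : p ∈ Ω) {x : ℝ} :
    χ p < rho x ↔ hgt m u p < x := by
  rw [hD.eq_rho p hp, rho_strictMono.lt_iff_lt]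

lemma Data.le_iff (hD : Data σ c w m Ω u χ) {p : ℝ × ℝ} (hp : p ∈ Ω) {x : ℝ} :
    χ p ≤ rho x ↔ hgt m u p ≤ x := by
  rw [hD.eq_rho p hp, rho_strictMono.le_iff_le]

lemma Sol.hgt_continuousOn (hS : Sol σ c w Ω u) : ContinuousOn (hgt m u) Ω :=
  hS.smooth.continuousOn.sub (by fun_prop)

lemma Sol.hgt_hasFDerivAt (hS : Sol σ c w Ω u) {p : ℝ × ℝ} (hp : p ∈ Ω) :
    HasFDerivAt (hgt m u) (lin (pds u p) (pdt u p - m)) p := by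
  have h1 := hasFDerivAt_mul_snd m p
  refine ((smooth_hasFDerivAt hS.isOpen hS.smooth hp).sub h1).congr_fderiv ?_
  ext <;> simp

/-- The quadratic coordinate used in the barriers. -/
def quad (a b d : ℝ) (p : ℝ × ℝ) : ℝ := a * p.1 ^ 2 + b * p.1 + d * p.2

/-- The quasilinear operator evaluated on the barrier `m t + φ (quad a b d)`, where `x` and `y`
are the first two derivatives of the profile `φ`. -/
def barrierOp (σ c m a d P x y : ℝ) : ℝ :=
  2 * a * x * (1 + (m + x * d) ^ 2) + y * (P ^ 2 + d ^ 2 + m ^ 2 * P ^ 2)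
    - (1 + x ^ 2 * P ^ 2 + (m + x * d) ^ 2) * (σ - c * (m + x * d))

lemma quad_hasFDerivAt (a b d : ℝ) (p : ℝ × ℝ) :
    HasFDerivAt (quad a b d) (lin (2 * a * p.1 + b) d) p := by
  have h1 := hasFDerivAt_fst_lin p
  have h2 := hasFDerivAt_snd_lin p
  refine (((h1.pow 2).const_mul a).add (h1.const_mul b)).add (h2.const_mul d) |>.congr_fderiv ?_
  ext <;> simp; ring

lemma quad_continuous (a b d : ℝ) : Continuous (quad a b d) := by unfold quad; fun_prop

lemma Sol.barrier (hS : Sol σ c w Ω u) {A : ℝ} {φ φ1 φ2 : ℝ → ℝ} (hφ : Profile A φ φ1 φ2)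
    {a b d κ : ℝ} {p : ℝ × ℝ} (hp : p ∈ Ω) (hκ : κ < quad a b d p)
    (hmin : IsLocalMin (fun q => hgt m u q - φ (quad a b d q - κ)) p) :
    barrierOp σ c m a d (2 * a * p.1 + b) (φ1 (quad a b d p - κ)) (φ2 (quad a b d p - κ)) ≤ 0 := by
  set r := quad a b d p - κ with hr
  have hr0 : 0 < r := by linarith
  have hq : ∀ q, HasFDerivAt (fun q => quad a b d q - κ) (lin (2 * a * q.1 + b) d) q := fun q =>
    (quad_hasFDerivAt a b d q).sub_const κ
  have hlinq := hasFDerivAt_mul_snd m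
  have hev : ∀ᶠ q in 𝓝 p, 0 < quad a b d q - κ :=
    (((quad_continuous a b d).sub continuous_const).continuousAt).eventually (lt_mem_nhds hr0)
  have hU : ∀ᶠ q in 𝓝 p, HasFDerivAt (fun q => m * q.2 + φ (quad a b d q - κ))
      (lin (φ1 (quad a b d q - κ) * (2 * a * q.1 + b)) (m + φ1 (quad a b d q - κ) * d)) q := by
    filter_upwards [hev] with q hq0
    refine ((hlinq q).add ((hφ.deriv1 _ hq0).comp_hasFDerivAt q (hq q))).congr_fderiv ?_
    ext <;> simp
  have hφ1 : HasFDerivAt (fun q => φ1 (quad a b d q - κ))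
      (lin (φ2 r * (2 * a * p.1 + b)) (φ2 r * d)) p := by
    refine ((hφ.deriv2 _ hr0).comp_hasFDerivAt p (hq p)).congr_fderiv ?_
    ext <;> simp
  have hP : HasFDerivAt (fun q : ℝ × ℝ => 2 * a * q.1 + b) (lin (2 * a) 0) p := by
    refine (((hasFDerivAt_fst_lin p).const_mul (2 * a)).add_const b).congr_fderiv ?_
    ext <;> simp
  have hgs : HasFDerivAt (fun q => φ1 (quad a b d q - κ) * (2 * a * q.1 + b))
      (lin (φ2 r * (2 * a * p.1 + b) ^ 2 + φ1 r * (2 * a)) (φ2 r * d * (2 * a * p.1 + b))) p := by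
    refine (hφ1.mul hP).congr_fderiv ?_
    ext <;> simp <;> ring
  have hgt' : HasFDerivAt (fun q => m + φ1 (quad a b d q - κ) * d)
      (lin (φ2 r * d * (2 * a * p.1 + b)) (φ2 r * d ^ 2)) p := by
    refine ((hφ1.mul_const d).const_add m).congr_fderiv ?_
    ext <;> simp <;> ring
  have := hS.comparison hp hU hgs hgt' (by
    convert hmin using 2 with q
    unfold hgt; ring)
  unfold barrierOp
  simp only [← hr] at this
  nlinarith

/-- Lower bound for the height by one-sided barriers. -/
theorem Data.barrier_bound (hD : Data σ c w m Ω u χ) {A : ℝ} {φ φ1 φ2 : ℝ → ℝ}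
    (hφ : Profile A φ φ1 φ2) {a b d L κ : ℝ} (hd : d ≠ 0) {X : Set (ℝ × ℝ)} (hX : IsCompact X)
    (hXL : ∀ p ∈ X, χ p ≤ rho (-L))
    (hnhds : ∀ p ∈ X, χ p < rho (-L) → κ < quad a b d p → X ∈ 𝓝 p)
    (hpos : ∀ p ∈ X, ∀ r, 0 < r → r ≤ quad a b d p - κ →
      0 < barrierOp σ c m a d (2 * a * p.1 + b) (φ1 r) (φ2 r)) {B : ℝ} (hB : A < B) :
    ∀ p ∈ X, κ < quad a b d p → rho (-L - B) < χ p := by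
  have hA : 0 ≤ A := (hφ.nonneg 0).trans (hφ.le 0)
  by_contra! hcon
  obtain ⟨p0, hp0, hκ0, hχ0⟩ := hcon
  set q := quad a b d with hq
  have hqc : Continuous q := quad_continuous a b d
  have hmove : ∀ (p : ℝ × ℝ) (t : ℝ), q (p + (0, t * d)) = q p + t * d ^ 2 := by
    intro p t; simp only [hq, quad, Prod.fst_add, Prod.snd_add]; ring
  have hmc : ∀ p : ℝ × ℝ, Tendsto (fun t : ℝ => p + (0, t * d)) (𝓝 0) (𝓝 p) := by
    intro p
    have : Continuous fun t : ℝ => p + ((0 : ℝ), t * d) := by fun_prop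
    have h := this.tendsto 0
    rwa [zero_mul, Prod.mk_zero_zero, add_zero] at h
  obtain ⟨ps, hps, hmax⟩ := (hX.inter_right
    (isClosed_le hD.cont (continuous_const (y := rho (-L - B))))).exists_isMaxOn ⟨p0, hp0, hχ0⟩
    hqc.continuousOn
  have hκs : κ < q ps := hκ0.trans_le (hmax ⟨hp0, hχ0⟩)
  have hχs : χ ps ≤ rho (-L - B) := hps.2
  have habove : ∀ p ∈ X, q ps < q p → p ∈ Ω ∧ -L - B < hgt m u p := by
    intro p hp hqp
    have h1 : rho (-L - B) < χ p := by
      by_contra! h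
      exact absurd (hmax ⟨hp, h⟩) (not_le.2 hqp)
    have hpΩ : p ∈ Ω := hD.mem_of ((neg_one_lt_rho _).trans h1) ((hXL p hp).trans_lt (rho_lt_one _))
    refine ⟨hpΩ, ?_⟩
    rw [hD.eq_rho p hpΩ] at h1
    exact rho_strictMono.lt_iff_lt.1 h1
  have hd2 : 0 < d ^ 2 := by positivity
  have key : ∀ t, 0 < t → ps + (0, t * d) ∈ X → rho (-L - A) ≤ χ (ps + (0, t * d)) := by
    intro t ht htX
    set κ' := q ps + t * d ^ 2 / 2 with hκ'
    have hκκ' : q ps < κ' := by rw [hκ']; nlinarith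
    have hYc : IsCompact (X ∩ {p | κ' ≤ q p}) :=
      hX.inter_right (isClosed_le continuous_const hqc)
    have hYΩ : X ∩ {p | κ' ≤ q p} ⊆ Ω := fun p hp => (habove p hp.1 (hκκ'.trans_le hp.2)).1
    have htY : ps + (0, t * d) ∈ X ∩ {p | κ' ≤ q p} := by
      refine ⟨htX, ?_⟩
      simp only [mem_ofPred_eq, hmove, hκ']
      nlinarith
    obtain ⟨p1, hp1, hmin⟩ := hYc.exists_isMinOn (f := fun p => hgt m u p - φ (q p - κ')) ⟨_, htY⟩
      ((hD.sol.hgt_continuousOn.mono hYΩ).sub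
        (hφ.cont.comp (hqc.sub continuous_const)).continuousOn)
    have hp1Ω := hYΩ hp1
    have hmin' : ∀ p ∈ X, κ' ≤ q p → hgt m u p1 - φ (q p1 - κ') ≤ hgt m u p - φ (q p - κ') :=
      fun p hp hq => hmin ⟨hp, hq⟩
    have hL : -L ≤ hgt m u p1 := by
      by_contra! hlt
      have hn : X ∈ 𝓝 p1 := hnhds p1 hp1.1 ((hD.lt_iff hp1Ω).2 hlt)
        (by linarith [show κ' ≤ q p1 from hp1.2])
      rcases eq_or_lt_of_le (show κ' ≤ q p1 from hp1.2) with heq | hlt'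
      · have hder : HasDerivAt (fun t : ℝ => hgt m u (p1 + (0, t * d))) ((pdt u p1 - m) * d) 0 := by
          have h1 : HasDerivAt (fun t : ℝ => p1 + ((0 : ℝ), t * d)) (0, d) 0 := by
            have := (((hasDerivAt_id (0 : ℝ)).mul_const d)).const_add p1.2
            have h2 := (hasDerivAt_const (0 : ℝ) p1.1).prodMk this
            simp only [one_mul] at h2
            refine h2.congr_of_eventuallyEq (Eventually.of_forall fun x => ?_)
            ext <;> simp
          have h2 : HasFDerivAt (hgt m u) (lin (pds u p1) (pdt u p1 - m))
              (p1 + ((0 : ℝ), (0 : ℝ) * d)) := by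
            rw [zero_mul, Prod.mk_zero_zero, add_zero]
            exact hD.sol.hgt_hasFDerivAt hp1Ω
          refine (h2.comp_hasDerivAt (0 : ℝ) h1).congr_deriv ?_
          simp
        have hslope := hder.tendsto_slope_zero_right
        set M := (pdt u p1 - m) * d
        have e1 : ∀ᶠ s in 𝓝[>] (0 : ℝ), s⁻¹ * (hgt m u (p1 + (0, s * d)) - hgt m u p1) < M + 1 := by
          have := hslope.eventually (gt_mem_nhds (lt_add_one M))
          simpa only [smul_eq_mul, zero_add, zero_mul, Prod.mk_zero_zero, add_zero] using this
        have e2 : ∀ᶠ s in 𝓝[>] (0 : ℝ), p1 + (0, s * d) ∈ X :=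
          ((hmc p1).eventually hn).filter_mono nhdsWithin_le_nhds
        have e3 : ∀ᶠ s in 𝓝[>] (0 : ℝ), (M + 1) / d ^ 2 * (s * d ^ 2) < φ (s * d ^ 2) := by
          have : Tendsto (fun s : ℝ => s * d ^ 2) (𝓝[>] 0) (𝓝[>] 0) := by
            refine tendsto_nhdsWithin_iff.2 ⟨?_, ?_⟩
            · have : Continuous fun s : ℝ => s * d ^ 2 := by fun_prop
              have := this.tendsto 0
              rw [zero_mul] at this
              exact this.mono_left nhdsWithin_le_nhds
            · filter_upwards [self_mem_nhdsWithin] with s (hs : 0 < s)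
              exact mul_pos hs hd2
          exact this.eventually (hφ.steep _)
        obtain ⟨s, hs1, hs2, hs3, hs⟩ := (e1.and (e2.and (e3.and self_mem_nhdsWithin))).exists
        have hs : 0 < s := hs
        have h4 := hmin' _ hs2 (by rw [hmove]; nlinarith)
        rw [hmove, ← heq] at h4
        have e4 : κ' + s * d ^ 2 - κ' = s * d ^ 2 := by ring
        rw [e4, sub_self, hφ.zero] at h4
        have e5 : (M + 1) / d ^ 2 * (s * d ^ 2) = (M + 1) * s := by field_simp
        rw [e5] at hs3
        rw [inv_mul_lt_iff₀ hs] at hs1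
        linarith
      · have hlm : IsLocalMin (fun p => hgt m u p - φ (q p - κ')) p1 := by
          filter_upwards [hn, hqc.continuousAt.eventually (lt_mem_nhds hlt')] with p hp hp'
          exact hmin' p hp hp'.le
        have := hD.sol.barrier hφ hp1Ω hlt' hlm
        have := hpos p1 hp1.1 (q p1 - κ') (by linarith) (by linarith)
        linarith
    have h5 := hmin' _ htX htY.2
    have h6 := hφ.le (q p1 - κ')
    have h7 := hφ.nonneg (q (ps + (0, t * d)) - κ')
    rw [hD.eq_rho _ (hYΩ htY)]
    exact rho_strictMono.monotone (by linarith)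
  have hn : X ∈ 𝓝 ps := hnhds ps hps.1 (hχs.trans_lt (rho_strictMono (by linarith))) hκs
  have hlim : rho (-L - A) ≤ χ ps := by
    have h1 : Tendsto (fun t : ℝ => χ (ps + (0, t * d))) (𝓝[>] 0) (𝓝 (χ ps)) :=
      (hD.cont.continuousAt.tendsto.comp (hmc ps)).mono_left nhdsWithin_le_nhds
    refine ge_of_tendsto h1 ?_
    filter_upwards [((hmc ps).eventually hn).filter_mono nhdsWithin_le_nhds,
      self_mem_nhdsWithin] with t ht1 ht2
    exact key t ht2 ht1
  have := rho_strictMono.le_iff_le.1 (hlim.trans hχs)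
  linarith
end

end

section

lemma one_add_sq_le (m x : ℝ) : (1 + x ^ 2) ≤ 2 * (1 + m ^ 2) * (1 + (m + x) ^ 2) := by
  nlinarith [sq_nonneg (m * (m + x)), sq_nonneg (2 * m + x), sq_nonneg (m + (m + x)),
    sq_nonneg m, sq_nonneg (m + x)]

lemma barrierOp_pos_vertical {c m x y k : ℝ} (hc : 0 < c) (hx : 0 < x)
    (hk : k * (2 * (1 + m ^ 2)) ≤ c) (hy : -y < k * x * (1 + x ^ 2)) :
    0 < barrierOp (c * m) c m 0 1 0 x y := by
  unfold barrierOp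
  have h1 := one_add_sq_le m x
  rcases le_or_gt k 0 with h0 | h0
  · have : k * x * (1 + x ^ 2) ≤ 0 := by
      have : 0 ≤ x * (1 + x ^ 2) := by positivity
      nlinarith
    have : 0 < x * c * (1 + (m + x) ^ 2) := by positivity
    nlinarith
  · have h3 : k * x * (1 + x ^ 2) ≤ k * x * (2 * (1 + m ^ 2) * (1 + (m + x) ^ 2)) := by gcongr
    have h4 : k * (2 * (1 + m ^ 2)) * (x * (1 + (m + x) ^ 2)) ≤ c * (x * (1 + (m + x) ^ 2)) := by
      gcongr
    nlinarith

lemma barrierOp_pos_tilted {c m x y k η P : ℝ} (hc : 0 < c) (hη : 0 < η) (hx : 0 < x)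
    (hP : P ^ 2 = 1) (hk : k * (1 + η ^ 2 + m ^ 2) ≤ c * η) (hy : -y < k * x * (1 + x ^ 2)) :
    0 < barrierOp (c * m) c m 0 η P x y := by
  unfold barrierOp
  rw [hP]
  have h1 : -y * (1 + η ^ 2 + m ^ 2) < k * x * (1 + x ^ 2) * (1 + η ^ 2 + m ^ 2) := by gcongr
  have h2 : k * (1 + η ^ 2 + m ^ 2) * (x * (1 + x ^ 2)) ≤ c * η * (x * (1 + x ^ 2)) := by gcongr
  have h3 : 0 ≤ c * η * x * (m + x * η) ^ 2 := by positivity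
  nlinarith

lemma barrierOp_pos_parabolic {c m x y k P : ℝ} (hc : 0 < c) (hx : 0 < x) (hk0 : 0 < k)
    (hP : P ^ 2 * (1 + m ^ 2) ≤ 1) (hk : k * (2 * (1 + m ^ 2)) ≤ c)
    (hy : -y < k * x * (1 + x ^ 2)) : 0 < barrierOp (c * m) c m (2 * c) (-1) P x y := by
  unfold barrierOp
  have h0 : x ^ 2 ≤ (1 + m ^ 2) * (1 + (m - x) ^ 2) := by nlinarith [sq_nonneg (1 - m * (x - m))]
  have h1 : x ^ 2 * P ^ 2 ≤ 1 + (m - x) ^ 2 := by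
    calc x ^ 2 * P ^ 2 ≤ (1 + m ^ 2) * (1 + (m - x) ^ 2) * P ^ 2 := by gcongr
      _ = P ^ 2 * (1 + m ^ 2) * (1 + (m - x) ^ 2) := by ring
      _ ≤ 1 * (1 + (m - x) ^ 2) := by gcongr
      _ = _ := one_mul _
  have h2 := one_add_sq_le m (-x)
  have h3 : k * x * (1 + x ^ 2) ≤ k * x * (2 * (1 + m ^ 2) * (1 + (m - x) ^ 2)) := by
    gcongr; nlinarith
  have h4 : k * (2 * (1 + m ^ 2)) * (x * (1 + (m - x) ^ 2)) ≤ c * (x * (1 + (m - x) ^ 2)) := by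
    gcongr
  have h5 : -y < c * (x * (1 + (m - x) ^ 2)) := by nlinarith
  have h6 : c * x * (x ^ 2 * P ^ 2) ≤ c * x * (1 + (m - x) ^ 2) := by gcongr
  have h7 : -y * (P ^ 2 * (1 + m ^ 2) + 1) ≤ c * (x * (1 + (m - x) ^ 2)) * 2 := by
    have h8 : 0 ≤ P ^ 2 * (1 + m ^ 2) := by positivity
    have h9 : 0 < c * (x * (1 + (m - x) ^ 2)) := by positivity
    nlinarith
  have h10 : 0 < c * x * (1 + (m - x) ^ 2) := by positivity
  have e : m + x * -1 = m - x := by ring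
  rw [e]
  have h11 : -y * (P ^ 2 * (1 + m ^ 2) + 1) < c * (x * (1 + (m - x) ^ 2)) * 2 := by
    have h8 : 0 ≤ P ^ 2 * (1 + m ^ 2) := by positivity
    have h9 : 0 < c * (x * (1 + (m - x) ^ 2)) := by positivity
    nlinarith
  nlinarith

lemma barrierOp_pos_horizontal {σ δ x y P : ℝ} (hσ : |σ| ≤ 1)
    (hP : P ^ 2 ≤ 1) (hx : 2 ≤ δ * x) (hx0 : 0 < x)
    (hy : -y < δ / 2 * x * (1 + x ^ 2)) : 0 < barrierOp σ 0 0 δ (-1) P x y := by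
  unfold barrierOp
  have h1 := abs_le.1 hσ
  have h2 : x ^ 2 * P ^ 2 ≤ x ^ 2 := by nlinarith [sq_nonneg x]
  have h3 : 2 * (1 + x ^ 2) ≤ δ * x * (1 + x ^ 2) := by gcongr
  have h4 : σ * (1 + x ^ 2 * P ^ 2 + x ^ 2) ≤ 1 * (1 + x ^ 2 * P ^ 2 + x ^ 2) := by
    gcongr; exact h1.2
  have h5 : -y * (P ^ 2 + 1) ≤ δ / 2 * x * (1 + x ^ 2) * 2 := by
    have : 0 ≤ δ / 2 * x * (1 + x ^ 2) := by nlinarith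
    nlinarith [sq_nonneg P]
  have h6 : (0 + x * -1) ^ 2 = x ^ 2 := by ring
  rw [h6]
  nlinarith [sq_nonneg x]

section
variable {σ c w m : ℝ} {Ω : Set (ℝ × ℝ)} {u : ℝ × ℝ → ℝ}

/-- The strict subsolution `K s² - √(1 + t²)`. -/
def bowl (K : ℝ) (p : ℝ × ℝ) : ℝ := K * p.1 ^ 2 - √(1 + p.2 ^ 2)

lemma bowl_continuous (K : ℝ) : Continuous (bowl K) := by unfold bowl; fun_prop

lemma Sol.bowl_barrier (hS : Sol (c * m) c w Ω u) (hc : 0 < c) {ε : ℝ} (hε : 0 < ε)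
    (hεw : 2 * (2 + c) * w * ε ≤ 1) {p : ℝ × ℝ} (hp : p ∈ Ω)
    (hmin : IsLocalMin (fun q => hgt m u q - ε * bowl (2 + c) q) p) : False := by
  set K := 2 + c with hK
  have hr : ∀ t : ℝ, 0 < √(1 + t ^ 2) := fun t => Real.sqrt_pos.2 (by positivity)
  have hsq : ∀ t : ℝ, √(1 + t ^ 2) ^ 2 = 1 + t ^ 2 := fun t => Real.sq_sqrt (by positivity)
  have d1 : ∀ t : ℝ, HasDerivAt (fun t : ℝ => √(1 + t ^ 2)) (t / √(1 + t ^ 2)) t := fun t => by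
    refine (((hasDerivAt_pow 2 t).const_add 1).sqrt (by positivity)).congr_deriv ?_
    have := hr t
    field_simp
    norm_num
  have d2 : ∀ t : ℝ, HasDerivAt (fun t : ℝ => t / √(1 + t ^ 2)) (1 / √(1 + t ^ 2) ^ 3) t :=
    fun t => by
    refine ((hasDerivAt_id t).div (d1 t) (hr t).ne').congr_deriv ?_
    have := hr t
    have h2 := hsq t
    simp only [id]
    field_simp
    rw [h2]; ring
  have hU : ∀ᶠ q in 𝓝 p, HasFDerivAt (fun q => m * q.2 + ε * bowl K q)
      (lin (ε * (2 * K * q.1)) (m - ε * (q.2 / √(1 + q.2 ^ 2)))) q := by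
    refine Eventually.of_forall fun q => ?_
    have h1 := ((hasFDerivAt_fst_lin q).pow 2).const_mul K
    have h2 := (d1 q.2).comp_hasFDerivAt q (hasFDerivAt_snd_lin q)
    refine ((hasFDerivAt_mul_snd m q).add ((h1.sub h2).const_mul ε)).congr_fderiv ?_
    ext
    · simp; left; ring
    · simp; ring
  have hgs : HasFDerivAt (fun q : ℝ × ℝ => ε * (2 * K * q.1)) (lin (2 * K * ε) 0) p := by
    refine (((hasFDerivAt_fst_lin p).const_mul (2 * K)).const_mul ε).congr_fderiv ?_
    ext <;> simp; ring
  have hgt' : HasFDerivAt (fun q : ℝ × ℝ => m - ε * (q.2 / √(1 + q.2 ^ 2)))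
      (lin 0 (-(ε * (1 / √(1 + p.2 ^ 2) ^ 3)))) p := by
    have h2 := (d2 p.2).comp_hasFDerivAt p (hasFDerivAt_snd_lin p)
    refine ((h2.const_mul ε).const_sub m).congr_fderiv ?_
    ext <;> simp
  have h := hS.comparison hp hU hgs hgt' (by
    convert hmin using 2 with q
    unfold hgt; ring)
  have hp1 := abs_le.1 (hS.strip p hp)
  have hs := hr p.2
  have hs2 := hsq p.2
  set S := √(1 + p.2 ^ 2)
  have hS1 : 1 ≤ S := by nlinarith [sq_nonneg p.2]
  set y := p.2 / S with hy
  set z := 1 / S ^ 3 with hz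
  have hz1 : z ≤ 1 := by
    rw [hz, div_le_one (by positivity)]; exact one_le_pow₀ hS1
  have hz0 : 0 < z := by positivity
  have hy1 : y ≤ 1 := by
    rw [hy, div_le_one hs]; nlinarith
  set X := ε * (2 * K * p.1) with hX
  have hK0 : 0 < K := by linarith
  have hX1 : X ^ 2 ≤ 1 := by
    rw [sq_le_one_iff_abs_le_one, abs_le]
    have h1 : 0 < 2 * K * ε := by positivity
    constructor <;> nlinarith
  set T := m - ε * y
  have e1 : c * m - c * T = ε * (c * y) := by simp only [T]; ring
  rw [e1] at h
  have h3 : 0 ≤ T ^ 2 := sq_nonneg T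
  have h4 : (1 + T ^ 2) * (2 * K) - (1 + X ^ 2) * z ≤ (1 + X ^ 2 + T ^ 2) * (c * y) := by
    have : ε * ((1 + T ^ 2) * (2 * K) - (1 + X ^ 2) * z) ≤ ε * ((1 + X ^ 2 + T ^ 2) * (c * y)) := by
      linarith
    exact le_of_mul_le_mul_left this hε
  have h5 : (1 + X ^ 2 + T ^ 2) * (c * y) ≤ (1 + X ^ 2 + T ^ 2) * c := by
    have : c * y ≤ c := by nlinarith
    gcongr
  have h6 : (1 + X ^ 2) * z ≤ 2 := by nlinarith [sq_nonneg X]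
  have h7 : (1 + X ^ 2 + T ^ 2) * c ≤ (2 + T ^ 2) * c := by gcongr; linarith
  nlinarith

/-- The height function cannot have an interior perturbed minimum on a closed subset of the
domain on which it is bounded below. -/
theorem Sol.no_bounded_below_piece (hS : Sol (c * m) c w Ω u) (hc : 0 < c) {C : Set (ℝ × ℝ)}
    (hC : IsClosed C) (hCΩ : C ⊆ Ω) {B : ℝ} (hB : ∀ p ∈ C, B ≤ hgt m u p) {p0 : ℝ × ℝ}
    (hp0 : p0 ∈ C) {ε : ℝ} (hε : 0 < ε) (hεw : 2 * (2 + c) * w * ε ≤ 1)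
    (hn : ∀ p ∈ C, hgt m u p - ε * bowl (2 + c) p ≤ hgt m u p0 - ε * bowl (2 + c) p0 →
      C ∈ 𝓝 p) : False := by
  set K := 2 + c with hK
  have hK0 : 0 < K := by linarith
  set f := fun p => hgt m u p - ε * bowl K p with hf
  have hw := fun p hp => abs_le.1 (hS.strip p (hCΩ hp))
  set R := (f p0 - B + ε * (K * w ^ 2)) / ε with hR
  have hbd : ∀ p ∈ C, f p ≤ f p0 → |p.2| ≤ R := by
    intro p hp hle
    have h1 := hB p hp
    have h2 : p.1 ^ 2 ≤ w ^ 2 := by nlinarith [hw p hp]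
    have h3 : |p.2| ≤ √(1 + p.2 ^ 2) := Real.abs_le_sqrt (by linarith)
    rw [hR, le_div_iff₀ hε]
    simp only [hf, bowl] at hle ⊢
    have h4 : ε * (K * p.1 ^ 2) ≤ ε * (K * w ^ 2) := by gcongr
    nlinarith
  set Kc := C ∩ (Icc (-w) w ×ˢ Icc (-R) R) with hKc
  have hcomp : IsCompact Kc := (isCompact_Icc.prod isCompact_Icc).inter_left hC
  have hmem : ∀ p ∈ C, f p ≤ f p0 → p ∈ Kc := fun p hp hle =>
    ⟨hp, ⟨(hw p hp).1, (hw p hp).2⟩, abs_le.1 (hbd p hp hle)⟩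
  have hfc : ContinuousOn f Kc :=
    ((hS.hgt_continuousOn.mono hCΩ).mono inter_subset_left).sub
      ((bowl_continuous K).const_mul ε |>.continuousOn)
  obtain ⟨p1, hp1, hmin⟩ := hcomp.exists_isMinOn ⟨p0, hmem p0 hp0 le_rfl⟩ hfc
  have hle : f p1 ≤ f p0 := hmin (hmem p0 hp0 le_rfl)
  refine hS.bowl_barrier hc hε hεw (hCΩ hp1.1) ?_
  filter_upwards [hn p1 hp1.1 hle] with p hp
  by_cases h : f p ≤ f p0
  · exact hmin (hmem p hp h)
  · exact hle.trans (not_le.1 h).le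
end

end

section
variable {c w m : ℝ} {Ω : Set (ℝ × ℝ)} {u χ : ℝ × ℝ → ℝ}

lemma bowl_sub_le {K : ℝ} (hK : 0 ≤ K) {p q : ℝ × ℝ} (hp : |p.1| ≤ w) :
    bowl K p - bowl K q ≤ K * w ^ 2 + √(1 + q.2 ^ 2) - √(1 + p.2 ^ 2) := by
  have h1 : p.1 ^ 2 ≤ w ^ 2 := by rw [← sq_abs]; gcongr
  have h2 : K * p.1 ^ 2 ≤ K * w ^ 2 := by gcongr
  have h3 : 0 ≤ K * q.1 ^ 2 := by positivity
  unfold bowl; linarith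

lemma Sol.nonneg {σ : ℝ} (hS : Sol σ c w Ω u) : 0 ≤ w := by
  obtain ⟨p, hp⟩ := hS.isConnected.nonempty
  exact (abs_nonneg _).trans (hS.strip p hp)

lemma exists_small {μ D w c : ℝ} (hμ : 0 < μ) (hD : 0 ≤ D) (hc : 0 < c) (hw : 0 ≤ w) :
    ∃ ε, 0 < ε ∧ 2 * (2 + c) * w * ε ≤ 1 ∧ ε * D < μ := by
  refine ⟨min (1 / (2 * (2 + c) * w + 1)) (μ / (D + 1)), by positivity, ?_, ?_⟩
  · calc 2 * (2 + c) * w * min (1 / (2 * (2 + c) * w + 1)) (μ / (D + 1))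
        ≤ 2 * (2 + c) * w * (1 / (2 * (2 + c) * w + 1)) := by gcongr; exact min_le_left _ _
      _ ≤ 1 := by
        rw [mul_one_div, div_le_one (by positivity)]; linarith
  · calc min (1 / (2 * (2 + c) * w + 1)) (μ / (D + 1)) * D ≤ μ / (D + 1) * D := by
          gcongr; exact min_le_right _ _
      _ < μ := by rw [div_mul_eq_mul_div, div_lt_iff₀ (by positivity)]; nlinarith

lemma abs_le_sqrt_one_add_sq (x : ℝ) : |x| ≤ √(1 + x ^ 2) := Real.abs_le_sqrt (by linarith)

/-- The height function is unbounded below on every clopen piece of a sublevel set. -/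
theorem Data.exists_lt_of_clopen (hD : Data (c * m) c w m Ω u χ) (hc : 0 < c) {r : ℝ}
    {P : Set (ℝ × ℝ)} (hP : IsOpen P) (hPr : ∀ p ∈ P, χ p < rho r)
    (hP' : IsOpen ({p | χ p < rho r} \ P)) (hne : P.Nonempty) (x : ℝ) :
    ∃ p ∈ P, p ∈ Ω ∧ hgt m u p < x := by
  by_contra! hcon
  by_cases hF : ∃ p ∈ P, χ p = -1
  · obtain ⟨f, hfP, hf⟩ := hF
    have ho : IsOpen (P ∩ {p | χ p ≤ -1}) := by
      have : P ∩ {p | χ p ≤ -1} = P ∩ {p | χ p < rho x} := by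
        ext p
        simp only [mem_inter_iff, mem_ofPred_eq, and_congr_right_iff]
        intro hp
        refine ⟨fun h => h.trans_lt (neg_one_lt_rho x), fun h => ?_⟩
        by_contra! h'
        have hpΩ := hD.mem_of h' (h.trans (rho_lt_one x))
        exact absurd ((hD.lt_iff hpΩ).1 h) (not_lt.2 (hcon p hp hpΩ))
      rw [this]
      exact hP.inter (isOpen_lt hD.cont continuous_const)
    have hcl : IsClosed (P ∩ {p | χ p ≤ -1}) := by
      rw [← isOpen_compl_iff]
      have : (P ∩ {p | χ p ≤ -1})ᶜ = {p | -1 < χ p} ∪ ({p | χ p < rho r} \ P) := by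
        ext p
        simp only [mem_compl_iff, mem_inter_iff, mem_ofPred_eq, mem_union, Set.mem_sdiff]
        have := neg_one_lt_rho r
        have := hPr p
        constructor
        · intro h
          by_cases h1 : -1 < χ p
          · exact Or.inl h1
          · exact Or.inr ⟨by linarith, fun h2 => h ⟨h2, not_lt.1 h1⟩⟩
        · rintro (h | h) ⟨h1, h2⟩
          · linarith
          · exact h.2 h1
      rw [this]
      exact (isOpen_lt continuous_const hD.cont).union hP'
    have huniv := IsClopen.eq_univ ⟨hcl, ho⟩ ⟨f, hfP, hf.le⟩
    obtain ⟨q, hq⟩ := hD.sol.isConnected.nonempty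
    have h1 : q ∈ P ∩ {p | χ p ≤ -1} := huniv ▸ mem_univ q
    have h2 := abs_lt.1 (hD.mem_iff.1 hq)
    have h3 : χ q ≤ -1 := h1.2
    linarith
  · push Not at hF
    have hPΩ : P ⊆ Ω := fun p hp => by
      by_contra h
      exact hF p hp (hD.eq_neg_one_of h ((hPr p hp).trans (rho_lt_one r)))
    obtain ⟨p0, hp0⟩ := hne
    have h0 := (hD.lt_iff (hPΩ hp0)).1 (hPr p0 hp0)
    obtain ⟨r', hr1, hr2⟩ := exists_between h0
    have hCc : IsClosed (P ∩ {p | χ p ≤ rho r'}) := by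
      rw [← isOpen_compl_iff]
      have : (P ∩ {p | χ p ≤ rho r'})ᶜ = {p | rho r' < χ p} ∪ ({p | χ p < rho r} \ P) := by
        ext p
        simp only [mem_compl_iff, mem_inter_iff, mem_ofPred_eq, mem_union, Set.mem_sdiff]
        have := rho_strictMono hr2
        constructor
        · intro h
          by_cases h1 : rho r' < χ p
          · exact Or.inl h1
          · exact Or.inr ⟨by linarith, fun h2 => h ⟨h2, not_lt.1 h1⟩⟩
        · rintro (h | h) ⟨h1, h2⟩
          · linarith
          · exact h.2 h1
      rw [this]
      exact (isOpen_lt continuous_const hD.cont).union hP'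
    have hw0 := hD.sol.nonneg
    obtain ⟨ε, hε, hεw, hεD⟩ := exists_small (μ := r' - hgt m u p0)
      (D := (2 + c) * w ^ 2 + √(1 + p0.2 ^ 2)) (by linarith) (by positivity) hc hw0
    refine hD.sol.no_bounded_below_piece (m := m) hc (B := x) (p0 := p0) hCc
      (fun p hp => hPΩ hp.1) (fun p hp => hcon p hp.1 (hPΩ hp.1))
      ⟨hp0, (rho_strictMono hr1).le.trans' ((hD.le_iff (hPΩ hp0)).2 le_rfl)⟩ hε hεw ?_
    intro p hp hle
    have h1 := bowl_sub_le (K := 2 + c) (p := p) (q := p0) (by linarith)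
      (hD.sol.strip p (hPΩ hp.1))
    have h2 := Real.sqrt_nonneg (1 + p.2 ^ 2)
    have h3 : ε * (bowl (2 + c) p - bowl (2 + c) p0) ≤ ε * ((2 + c) * w ^ 2 + √(1 + p0.2 ^ 2)) := by
      gcongr; linarith
    have h4 : χ p < rho r' := (hD.lt_iff (hPΩ hp.1)).2 (by linarith)
    filter_upwards [hP.mem_nhds hp.1, (isOpen_lt hD.cont continuous_const).mem_nhds h4] with q h5 h6
    exact ⟨h5, le_of_lt h6⟩

/-- Passing from an open to a closed sublevel set. -/
theorem Data.isPreconnected_le (hD : Data (c * m) c w m Ω u χ) (hc : 0 < c) {r : ℝ}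
    (hpre : IsPreconnected {p | p ∈ Ω ∧ hgt m u p < r}) :
    IsPreconnected {p | p ∈ Ω ∧ hgt m u p ≤ r} := by
  have hcont := hD.sol.hgt_continuousOn (m := m)
  have main : ∀ U V : Set (ℝ × ℝ), IsOpen U → IsOpen V →
      {p | p ∈ Ω ∧ hgt m u p ≤ r} ⊆ U ∪ V → {p | p ∈ Ω ∧ hgt m u p ≤ r} ∩ (U ∩ V) = ∅ →
      {p | p ∈ Ω ∧ hgt m u p < r} ⊆ U → ∀ p0 ∈ V, p0 ∈ Ω → hgt m u p0 ≤ r → False := by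
    intro U V hU hV hsub hdis hlt p0 hp0V hp0 hp0r
    have hV' : ∀ p ∈ V, p ∈ Ω → r ≤ hgt m u p := by
      intro p hp hpΩ
      by_contra! h
      have : p ∈ {p | p ∈ Ω ∧ hgt m u p ≤ r} ∩ (U ∩ V) := ⟨⟨hpΩ, h.le⟩, hlt ⟨hpΩ, h⟩, hp⟩
      rw [hdis] at this; exact this
    have hAr : ∀ p, p ∈ Ω → hgt m u p = r → p ∉ U → p ∈ V := fun p h1 h2 h3 =>
      (hsub ⟨h1, h2.le⟩).resolve_left h3
    set K := 2 + c with hK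
    have hK0 : 0 < K := by linarith
    have hw0 := hD.sol.nonneg
    set T := K * w ^ 2 + √(1 + p0.2 ^ 2) with hT
    set A := {p | χ p = rho r} \ U with hA
    have hAΩ : ∀ p, χ p = rho r ↔ p ∈ Ω ∧ hgt m u p = r := by
      intro p
      constructor
      · intro h
        have hp : p ∈ Ω := hD.mem_iff.2 (h ▸ abs_rho_lt r)
        exact ⟨hp, rho_strictMono.injective (by rw [← hD.eq_rho p hp, h])⟩
      · rintro ⟨h1, h2⟩; rw [hD.eq_rho p h1, h2]
    have hAc : IsClosed A := (isClosed_eq hD.cont continuous_const).sdiff hU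
    set AT := A ∩ (Icc (-w) w ×ˢ Icc (-T) T) with hAT
    have hATc : IsCompact AT := (isCompact_Icc.prod isCompact_Icc).inter_left hAc
    have hATV : AT ⊆ V ∩ Ω := fun p hp =>
      ⟨hAr p ((hAΩ p).1 hp.1.1).1 ((hAΩ p).1 hp.1.1).2 hp.1.2, ((hAΩ p).1 hp.1.1).1⟩
    have hATmem : ∀ p, p ∈ Ω → hgt m u p = r → p ∉ U → |p.2| ≤ T → p ∈ AT := by
      intro p h1 h2 h3 h4
      exact ⟨⟨(hAΩ p).2 ⟨h1, h2⟩, h3⟩, abs_le.1 (hD.sol.strip p h1), abs_le.1 h4⟩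
    obtain ⟨δ, hδ, hδV⟩ := hATc.exists_cthickening_subset_open (hV.inter hD.sol.isOpen) hATV
    have hp0r' : hgt m u p0 = r := le_antisymm hp0r (hV' p0 hp0V hp0)
    have hp0U : p0 ∉ U := fun h => by
      have : p0 ∈ {p | p ∈ Ω ∧ hgt m u p ≤ r} ∩ (U ∩ V) := ⟨⟨hp0, hp0r⟩, h, hp0V⟩
      rw [hdis] at this; exact this
    have hp0T : |p0.2| ≤ T :=
      (abs_le_sqrt_one_add_sq _).trans (le_add_of_nonneg_left (by positivity))
    have hp0A : p0 ∈ AT := hATmem p0 hp0 hp0r' hp0U hp0T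
    set Q := (cthickening δ AT \ thickening δ AT) ∩ {p | |p.2| ≤ T} with hQ
    have hCcomp : IsCompact (cthickening δ AT) := hATc.cthickening
    have hQc : IsCompact Q := (hCcomp.diff isOpen_thickening).inter_right
      (isClosed_le (by fun_prop) continuous_const)
    have hQr : ∀ p ∈ Q, r < hgt m u p := by
      intro p hp
      have h1 := hδV hp.1.1
      refine lt_of_le_of_ne (hV' p h1.1 h1.2) fun h => hp.1.2 ?_
      refine self_subset_thickening hδ _ (hATmem p h1.2 h.symm (fun hpU => ?_) hp.2)
      have : p ∈ {p | p ∈ Ω ∧ hgt m u p ≤ r} ∩ (U ∩ V) := ⟨⟨h1.2, h.symm.le⟩, hpU, h1.1⟩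
      rw [hdis] at this; exact this
    obtain ⟨r', hr', hQr'⟩ : ∃ r', r < r' ∧ ∀ p ∈ Q, r' ≤ hgt m u p := by
      rcases Q.eq_empty_or_nonempty with h | h
      · exact ⟨r + 1, by linarith, by simp [h]⟩
      · obtain ⟨p, hp, hmin⟩ := hQc.exists_isMinOn h
          (hcont.mono fun p hp => (hδV hp.1.1).2)
        exact ⟨_, hQr p hp, hmin⟩
    obtain ⟨ε, hε, hεw, hεD⟩ := exists_small (μ := r' - r) (D := T) (by linarith)
      (by positivity) hc hw0
    refine hD.sol.no_bounded_below_piece (m := m) hc (B := r) (p0 := p0) hCcomp.isClosed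
      (fun p hp => (hδV hp).2) (fun p hp => hV' p (hδV hp).1 (hδV hp).2)
      (self_subset_cthickening _ hp0A) hε hεw ?_
    intro p hp hle
    have h1 := bowl_sub_le (K := K) (p := p) (q := p0) hK0.le (hD.sol.strip p (hδV hp).2)
    have h2 := Real.sqrt_nonneg (1 + p.2 ^ 2)
    have h3 := hV' p (hδV hp).1 (hδV hp).2
    have h4 : 0 ≤ bowl K p - bowl K p0 := by
      by_contra! h
      have : ε * (bowl K p - bowl K p0) < 0 := mul_neg_of_pos_of_neg hε h
      linarith
    have h5 : |p.2| ≤ T := (abs_le_sqrt_one_add_sq _).trans (by linarith)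
    have h6 : ε * (bowl K p - bowl K p0) ≤ ε * T := by gcongr; linarith
    have h7 : p ∈ thickening δ AT := by
      by_contra h
      have := hQr' p ⟨⟨hp, h⟩, h5⟩
      linarith
    exact mem_of_superset (isOpen_thickening.mem_nhds h7) (thickening_subset_cthickening _ _)
  rw [isPreconnected_iff_subset_of_disjoint]
  intro U V hU hV hsub hdis
  have hlt : {p | p ∈ Ω ∧ hgt m u p < r} ⊆ {p | p ∈ Ω ∧ hgt m u p ≤ r} := fun p hp =>
    ⟨hp.1, hp.2.le⟩
  rcases isPreconnected_iff_subset_of_disjoint.1 hpre U V hU hV (hlt.trans hsub)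
    (subset_eq_empty (inter_subset_inter_left _ hlt) hdis) with h | h
  · left
    intro p hp
    rcases hsub hp with h' | h'
    · exact h'
    · exact (main U V hU hV hsub hdis h p h' hp.1 hp.2).elim
  · right
    intro p hp
    rcases hsub hp with h' | h'
    · exact (main V U hV hU (by rwa [union_comm]) (by rwa [inter_comm V U]) h p h' hp.1 hp.2).elim
    · exact h'
end

section

/-- `P` is a union of connected components of the open sublevel set `{χ < e}`. -/
structure Piece (χ : ℝ × ℝ → ℝ) (e : ℝ) (P : Set (ℝ × ℝ)) : Prop where
  isOpen : IsOpen P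
  lt : ∀ p ∈ P, χ p < e
  isOpen_diff : IsOpen ({p | χ p < e} \ P)

lemma Piece.isClosed {χ : ℝ × ℝ → ℝ} (hχ : Continuous χ) {e e' : ℝ} {P : Set (ℝ × ℝ)}
    (hP : Piece χ e P) (he : e' < e) : IsClosed (P ∩ {p | χ p ≤ e'}) := by
  rw [← isOpen_compl_iff]
  have : (P ∩ {p | χ p ≤ e'})ᶜ = {p | e' < χ p} ∪ ({p | χ p < e} \ P) := by
    ext p
    simp only [mem_compl_iff, mem_inter_iff, mem_ofPred_eq, mem_union, Set.mem_sdiff]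
    constructor
    · intro h
      by_cases h1 : e' < χ p
      · exact Or.inl h1
      · exact Or.inr ⟨by linarith, fun h2 => h ⟨h2, not_lt.1 h1⟩⟩
    · rintro (h | h) ⟨h1, h2⟩
      · linarith
      · exact h.2 h1
  rw [this]
  exact (isOpen_lt continuous_const hχ).union hP.isOpen_diff

lemma Piece.mem_nhds {χ : ℝ × ℝ → ℝ} (hχ : Continuous χ) {e e' : ℝ} {P : Set (ℝ × ℝ)}
    (hP : Piece χ e P) {p : ℝ × ℝ} (hp : p ∈ P) (hpe : χ p < e') : P ∩ {p | χ p ≤ e'} ∈ 𝓝 p := by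
  filter_upwards [hP.isOpen.mem_nhds hp, (isOpen_lt hχ continuous_const).mem_nhds hpe] with q h1 h2
  exact ⟨h1, le_of_lt h2⟩

lemma isOpen_diff_connectedComponentIn {O : Set (ℝ × ℝ)} (hO : IsOpen O) (z : ℝ × ℝ) :
    IsOpen (O \ connectedComponentIn O z) := by
  have : O \ connectedComponentIn O z =
      ⋃ y ∈ O \ connectedComponentIn O z, connectedComponentIn O y := by
    ext y
    simp only [mem_iUnion, exists_prop]
    constructor
    · exact fun hy => ⟨y, hy, mem_connectedComponentIn hy.1⟩
    · rintro ⟨x, hx, hy⟩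
      refine ⟨connectedComponentIn_subset _ _ hy, fun h => hx.2 ?_⟩
      rw [connectedComponentIn_eq h, ← connectedComponentIn_eq hy]
      exact mem_connectedComponentIn hx.1
  rw [this]
  exact isOpen_biUnion fun y _ => hO.connectedComponentIn

lemma piece_component {χ : ℝ × ℝ → ℝ} (hχ : Continuous χ) (e : ℝ) (z : ℝ × ℝ) :
    Piece χ e (connectedComponentIn {p | χ p < e} z) :=
  ⟨(isOpen_lt hχ continuous_const).connectedComponentIn,
    fun p hp => show p ∈ {p | χ p < e} from connectedComponentIn_subset _ _ hp,
    isOpen_diff_connectedComponentIn (isOpen_lt hχ continuous_const) z⟩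

section
variable {σ c w m : ℝ} {Ω : Set (ℝ × ℝ)} {u χ : ℝ × ℝ → ℝ}

lemma Sol.strip_lt (hS : Sol σ c w Ω u) {p : ℝ × ℝ} (hp : p ∈ Ω) : |p.1| < w := by
  obtain ⟨δ, hδ, hb⟩ := Metric.isOpen_iff.1 hS.isOpen p hp
  have key : ∀ x, |x| < δ → |p.1 + x| ≤ w := fun x hx => by
    refine hS.strip (p.1 + x, p.2) (hb ?_)
    rw [mem_ball, Prod.dist_eq]
    simp [hx]
  have h1 := abs_le.1 (key (δ / 2) (by rw [abs_of_pos (by positivity)]; linarith))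
  have h2 := abs_le.1 (key (-(δ / 2)) (by rw [abs_neg, abs_of_pos (by positivity)]; linarith))
  rw [abs_lt]
  constructor <;> linarith

lemma Data.eq_of_convex (hD : Data σ c w m Ω u χ) {C : Set (ℝ × ℝ)} (hC : IsPreconnected C)
    (hd : ∀ p ∈ C, p ∉ Ω) {p q : ℝ × ℝ} (hp : p ∈ C) (hq : q ∈ C) : χ p = χ q := by
  obtain ⟨n, hn⟩ := hC.exists_int_eq hD.cont.continuousOn (fun x hx => by
    rcases (_root_.abs_eq zero_le_one).1 (hD.abs_eq x (hd x hx)) with h | h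
    · exact ⟨1, by simp [h]⟩
    · exact ⟨-1, by simp [h]⟩)
  rw [hn p hp, hn q hq]

lemma Data.outer_right (hD : Data σ c w m Ω u χ) {p q : ℝ × ℝ} (hp : w ≤ p.1) (hq : w ≤ q.1) :
    χ p = χ q := by
  refine hD.eq_of_convex (C := Ici w ×ˢ univ) (isPreconnected_Ici.prod isPreconnected_univ) ?_
    ⟨hp, mem_univ _⟩ ⟨hq, mem_univ _⟩
  intro x hx h
  have := (abs_lt.1 (hD.sol.strip_lt h)).2
  have h2 : w ≤ x.1 := hx.1
  linarith

lemma Data.outer_left (hD : Data σ c w m Ω u χ) {p q : ℝ × ℝ} (hp : p.1 ≤ -w) (hq : q.1 ≤ -w) :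
    χ p = χ q := by
  refine hD.eq_of_convex (C := Iic (-w) ×ˢ univ) (isPreconnected_Iic.prod isPreconnected_univ) ?_
    ⟨hp, mem_univ _⟩ ⟨hq, mem_univ _⟩
  intro x hx h
  have := (abs_lt.1 (hD.sol.strip_lt h)).1
  have h2 : x.1 ≤ -w := hx.1
  linarith

/-- The half-plane `{s ≥ w}` meets a connected component either fully or not at all. -/
lemma Data.outer_subset_component (hD : Data σ c w m Ω u χ) {e : ℝ} {z p : ℝ × ℝ}
    (hp : p ∈ connectedComponentIn {p | χ p < e} z) (hw : w ≤ |p.1|) :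
    ∃ s, |s| = w ∧ (s, 0) ∈ connectedComponentIn {p | χ p < e} z := by
  have hpe : χ p < e := show p ∈ {p | χ p < e} from connectedComponentIn_subset _ _ hp
  have hw0 := hD.sol.nonneg
  rw [connectedComponentIn_eq hp]
  rcases le_abs.1 hw with h | h
  · refine ⟨w, abs_of_nonneg hw0, ?_⟩
    refine IsPreconnected.subset_connectedComponentIn (s := Ici w ×ˢ univ)
      (isPreconnected_Ici.prod isPreconnected_univ) ⟨h, mem_univ _⟩ ?_ ⟨mem_Ici.2 le_rfl, mem_univ _⟩
    exact fun x hx => (hD.outer_right hx.1 h).trans_lt hpe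
  · refine ⟨-w, by rw [abs_neg, abs_of_nonneg hw0], ?_⟩
    refine IsPreconnected.subset_connectedComponentIn (s := Iic (-w) ×ˢ univ)
      (isPreconnected_Iic.prod isPreconnected_univ) ⟨by simp; linarith, mem_univ _⟩ ?_
      ⟨mem_Iic.2 le_rfl, mem_univ _⟩
    exact fun x hx => (hD.outer_left hx.1 (by linarith)).trans_lt hpe

lemma Data.exists_lt_of_piece (hD : Data (c * m) c w m Ω u χ) (hc : 0 < c) {r : ℝ}
    {P : Set (ℝ × ℝ)} (hP : Piece χ (rho r) P) (hne : P.Nonempty) (x : ℝ) :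
    ∃ p ∈ P, p ∈ Ω ∧ hgt m u p < x :=
  hD.exists_lt_of_clopen hc hP.isOpen hP.lt hP.isOpen_diff hne x

lemma isCompact_of_strip {X : Set (ℝ × ℝ)} (hX : IsClosed X) {w a b : ℝ}
    (hw : ∀ p ∈ X, |p.1| ≤ w) (hab : ∀ p ∈ X, p.2 ∈ Icc a b) : IsCompact X :=
  (isCompact_Icc.prod isCompact_Icc : IsCompact (Icc (-w) w ×ˢ Icc a b)).of_isClosed_subset hX
    fun p hp => ⟨abs_le.1 (hw p hp), hab p hp⟩

/-- No union of components of a sublevel set is contained in a lower half strip. -/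
theorem Data.not_subset_lower (hD : Data (c * m) c w m Ω u χ) (hc : 0 < c) {r : ℝ}
    {P : Set (ℝ × ℝ)} (hP : Piece χ (rho r) P) (hne : P.Nonempty) (hPw : ∀ p ∈ P, |p.1| ≤ w)
    {b : ℝ} (hb : ∀ p ∈ P, p.2 ≤ b) : False := by
  have hk : 0 < c / (2 * (1 + m ^ 2)) := by positivity
  obtain ⟨A, φ, φ1, φ2, hA, hφ, hode, -⟩ := exists_profile hk 0 0 le_rfl
  obtain ⟨p, hpP, hpΩ, hpx⟩ := hD.exists_lt_of_piece hc hP hne (r - 1 - (A + 1))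
  have hrr : rho (r - 1) < rho r := rho_strictMono (by linarith)
  set X := P ∩ {q | χ q ≤ rho (r - 1)} ∩ {q | p.2 - 1 ≤ q.2} with hX
  have hXc : IsCompact X := isCompact_of_strip
    ((hP.isClosed hD.cont hrr).inter (isClosed_le continuous_const continuous_snd))
    (fun q hq => hPw q hq.1.1) (fun q hq => ⟨hq.2, hb q hq.1.1⟩)
  have hpχ : χ p < rho (r - 1 - (A + 1)) := (hD.lt_iff hpΩ).2 hpx
  have e1 : -(-(r - 1)) = r - 1 := by ring
  have := hD.barrier_bound hφ (a := 0) (b := 0) (d := 1) (L := -(r - 1)) (κ := p.2 - 1)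
    one_ne_zero hXc (fun q hq => by rw [e1]; exact hq.1.2) ?_ ?_ (lt_add_one A) p
    ⟨⟨hpP, hpχ.le.trans (rho_strictMono.monotone (by linarith))⟩, by simp⟩ (by simp [quad])
  · rw [e1] at this
    linarith
  · intro q hq h1 h2
    rw [e1] at h1
    simp only [quad, zero_mul, zero_add, one_mul] at h2
    filter_upwards [hP.mem_nhds hD.cont hq.1.1 h1,
      (isOpen_lt continuous_const continuous_snd).mem_nhds h2] with x h3 h4
    exact ⟨h3, le_of_lt h4⟩
  · intro q _ x hx _
    have := barrierOp_pos_vertical (c := c) (m := m) (y := φ2 x) hc (hφ.pos1 x hx)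
      (div_mul_cancel₀ c (by positivity)).le (hode x hx)
    simpa using this
end

end

section

lemma integral_fderiv_eq_zero {G : ℝ × ℝ → ℝ} (hG : ContDiff ℝ 1 G) (hc : HasCompactSupport G)
    (v : ℝ × ℝ) : ∫ p, fderiv ℝ G p v = 0 := by
  have hd : Continuous fun p => fderiv ℝ G p v :=
    (hG.continuous_fderiv one_ne_zero).clm_apply continuous_const
  have := integral_mul_fderiv_eq_neg_fderiv_mul_of_integrable (μ := (volume : Measure (ℝ × ℝ)))
    (f := fun _ => (1 : ℝ)) (g := G) (v := v) (by simp) (by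
      simpa using hd.integrable_of_hasCompactSupport (hc.fderiv_apply ℝ v)) (by
      simpa using hG.continuous.integrable_of_hasCompactSupport hc) (fun x _ => by fun_prop)
      (fun x _ => (hG.differentiable one_ne_zero).differentiableAt)
  simpa using this

lemma one_le_integral_abs_deriv {g g' : ℝ → ℝ} (hg : ∀ x, HasDerivAt g (g' x) x)
    (hc : Continuous g') (hcs : HasCompactSupport g') {a b : ℝ} (hab : a ≤ b) (ha : g a = 0)
    (hb : g b = 1) : 1 ≤ ∫ x, |g' x| := by
  have h1 : ∫ x in a..b, g' x = 1 := by
    rw [intervalIntegral.integral_eq_sub_of_hasDerivAt (fun x _ => hg x)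
      (hc.intervalIntegrable _ _), ha, hb, sub_zero]
  have hi : Integrable (fun x => |g' x|) := (hc.integrable_of_hasCompactSupport hcs).abs
  calc (1 : ℝ) = |∫ x in a..b, g' x| := by rw [h1, abs_one]
    _ ≤ ∫ x in a..b, |g' x| := intervalIntegral.abs_integral_le_integral_abs hab
    _ = ∫ x in Ioc a b, |g' x| := intervalIntegral.integral_of_le hab
    _ ≤ ∫ x, |g' x| := setIntegral_le_integral hi (Eventually.of_forall fun x => abs_nonneg _)

lemma contDiff_indicator_of_closed {P C : Set (ℝ × ℝ)} (hP : IsOpen P) (hC : IsClosed C)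
    (hCP : C ⊆ P) {f : ℝ × ℝ → ℝ} {n : WithTop ℕ∞} (hf : ContDiffOn ℝ n f P)
    (h0 : ∀ p ∈ P, p ∉ C → f p = 0) : ContDiff ℝ n (P.indicator f) := by
  rw [contDiff_iff_contDiffAt]
  intro p
  by_cases hp : p ∈ P
  · refine (hf.contDiffAt (hP.mem_nhds hp)).congr_of_eventuallyEq ?_
    filter_upwards [hP.mem_nhds hp] with q hq using indicator_of_mem hq f
  · have : P.indicator f =ᶠ[𝓝 p] fun _ => 0 := by
      filter_upwards [hC.isOpen_compl.mem_nhds fun h => hp (hCP h)] with q hq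
      by_cases h : q ∈ P
      · rw [indicator_of_mem h, h0 q h hq]
      · exact indicator_of_notMem h f
    exact contDiffAt_const.congr_of_eventuallyEq this

lemma exists_step : ∃ (H H' : ℝ → ℝ) (M : ℝ), ContDiff ℝ 1 H ∧ (∀ x, HasDerivAt H (H' x) x) ∧
    (∀ x, -M ≤ H' x) ∧ (∀ x, H' x ≤ 0) ∧ (∀ x, 0 ≤ H x) ∧ (∀ x, H x ≤ 1) ∧
    (∀ x, -2 ≤ x → H x = 0) ∧ ∀ x, x ≤ -3 → H x = 1 := by
  set H : ℝ → ℝ := fun x => Real.smoothTransition (-2 - x) with hH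
  have hcd : ContDiff ℝ 1 H :=
    (Real.smoothTransition.contDiff (n := 1)).comp (contDiff_const.sub contDiff_id)
  have hd : Differentiable ℝ H := hcd.differentiable one_ne_zero
  have hanti : Antitone H := fun x y h => Real.smoothTransition.monotone (by linarith)
  have hzero : ∀ x, x ∉ Icc (-3 : ℝ) (-2) → deriv H x = 0 := by
    intro x hx
    rcases lt_or_ge x (-3) with h | h
    · have : H =ᶠ[𝓝 x] fun _ => 1 := by
        filter_upwards [Iio_mem_nhds h] with y hy
        exact Real.smoothTransition.one_of_one_le (by linarith [mem_Iio.1 hy])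
      rw [this.deriv_eq]; simp
    · have h2 : -2 < x := by by_contra! h2; exact hx ⟨h, h2⟩
      have : H =ᶠ[𝓝 x] fun _ => 0 := by
        filter_upwards [Ioi_mem_nhds h2] with y hy
        exact Real.smoothTransition.zero_of_nonpos (by linarith [mem_Ioi.1 hy])
      rw [this.deriv_eq]; simp
  obtain ⟨M, hM⟩ := (hcd.continuous_deriv le_rfl).bounded_above_of_compact_support
    (HasCompactSupport.intro isCompact_Icc hzero)
  refine ⟨H, deriv H, M, hcd, fun x => (hd x).hasDerivAt, fun x => (abs_le.1 (hM x)).1,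
    fun x => hanti.deriv_nonpos, fun x => Real.smoothTransition.nonneg _,
    fun x => Real.smoothTransition.le_one _, fun x h =>
    Real.smoothTransition.zero_of_nonpos (by linarith), fun x h =>
    Real.smoothTransition.one_of_one_le (by linarith)⟩

lemma exists_bump : ∃ (ζ ζ' : ℝ → ℝ) (M : ℝ), ContDiff ℝ 1 ζ ∧ (∀ x, HasDerivAt ζ (ζ' x) x) ∧
    (∀ x, |ζ' x| ≤ M) ∧ (∀ x, 0 ≤ ζ x) ∧ (∀ x, ζ x ≤ 1) ∧
    (∀ x, x ∉ Icc (0 : ℝ) 3 → ζ x = 0) ∧ ∀ x, x ∈ Icc (1 : ℝ) 2 → ζ x = 1 := by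
  set ζ : ℝ → ℝ := fun x => Real.smoothTransition x * Real.smoothTransition (3 - x) with hζ
  have hcd : ContDiff ℝ 1 ζ := (Real.smoothTransition.contDiff (n := 1)).mul
    ((Real.smoothTransition.contDiff (n := 1)).comp (contDiff_const.sub contDiff_id))
  have hd : Differentiable ℝ ζ := hcd.differentiable one_ne_zero
  have hz : ∀ x, x ∉ Icc (0 : ℝ) 3 → ζ x = 0 := by
    intro x hx
    rcases lt_or_ge x 0 with h | h
    · simp [hζ, Real.smoothTransition.zero_of_nonpos h.le]
    · have h2 : 3 < x := by by_contra! h2; exact hx ⟨h, h2⟩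
      simp [hζ, Real.smoothTransition.zero_of_nonpos (show 3 - x ≤ 0 by linarith)]
  obtain ⟨M, hM⟩ := (hcd.continuous_deriv le_rfl).bounded_above_of_compact_support
    (HasCompactSupport.intro isCompact_Icc hz).deriv
  refine ⟨ζ, deriv ζ, M, hcd, fun x => (hd x).hasDerivAt, hM, fun x => mul_nonneg
    (Real.smoothTransition.nonneg _) (Real.smoothTransition.nonneg _), fun x => mul_le_one₀
    (Real.smoothTransition.le_one _) (Real.smoothTransition.nonneg _)
    (Real.smoothTransition.le_one _), hz, fun x hx => ?_⟩
  simp [hζ, Real.smoothTransition.one_of_one_le hx.1,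
    Real.smoothTransition.one_of_one_le (show 1 ≤ 3 - x by linarith [hx.2])]

section
variable {σ c w m : ℝ} {Ω : Set (ℝ × ℝ)} {u χ : ℝ × ℝ → ℝ}

/-- The area element of the graph. -/
def areaElt (u : ℝ × ℝ → ℝ) (p : ℝ × ℝ) : ℝ := √(1 + pds u p ^ 2 + pdt u p ^ 2)

lemma areaElt_pos (u : ℝ × ℝ → ℝ) (p : ℝ × ℝ) : 0 < areaElt u p := Real.sqrt_pos.2 (by positivity)

lemma areaElt_sq (u : ℝ × ℝ → ℝ) (p : ℝ × ℝ) :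
    areaElt u p ^ 2 = 1 + pds u p ^ 2 + pdt u p ^ 2 := Real.sq_sqrt (by positivity)

lemma Sol.contDiffOn_areaElt (hS : Sol σ c w Ω u) : ContDiffOn ℝ 1 (areaElt u) Ω := by
  have h1 := (smooth_pds hS.isOpen hS.smooth).of_le (m := 1) (by exact_mod_cast le_top)
  have h2 := (smooth_pdt hS.isOpen hS.smooth).of_le (m := 1) (by exact_mod_cast le_top)
  exact ((contDiffOn_const.add (h1.pow 2)).add (h2.pow 2)).sqrt fun p _ => by positivity

/-- The divergence form of the translator equation. -/
lemma Sol.divergence (hS : Sol σ c w Ω u) {p : ℝ × ℝ} (hp : p ∈ Ω) :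
    ∃ x1 x2 y1 y2, HasFDerivAt (fun q => pds u q / areaElt u q) (lin x1 x2) p ∧
      HasFDerivAt (fun q => pdt u q / areaElt u q) (lin y1 y2) p ∧
      x1 + y2 = (σ - c * pdt u p) / areaElt u p := by
  have h1 := smooth_hasFDerivAt hS.isOpen (smooth_pds hS.isOpen hS.smooth) hp
  have h2 := smooth_hasFDerivAt hS.isOpen (smooth_pdt hS.isOpen hS.smooth) hp
  rw [pdt_pds hS.isOpen hS.smooth hp] at h2
  have h0 := areaElt_pos u p
  have hsq := areaElt_sq u p
  have hpde := hS.pde p hp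
  set a := pds u p
  set b := pdt u p
  set r := pds (pds u) p
  set q := pdt (pds u) p
  set t := pdt (pdt u) p
  have hA : HasFDerivAt (areaElt u)
      (lin ((a * r + b * q) / areaElt u p) ((a * q + b * t) / areaElt u p)) p := by
    have := (((h1.pow 2).const_add 1).add (h2.pow 2)).sqrt (show 1 + a ^ 2 + b ^ 2 ≠ 0 by positivity)
    refine this.congr_fderiv ?_
    change (1 / (2 * areaElt u p)) • _ = _
    ext <;> simp <;> field_simp <;> simp only [a, b] <;> ring
  set W := areaElt u p
  have hne : W ≠ 0 := h0.ne'
  have hi := (hasDerivAt_inv hne).comp_hasFDerivAt p hA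
  have e1 := h1.mul hi
  have e2 := h2.mul hi
  refine ⟨_, _, _, _, e1.congr_fderiv (eq_lin _), e2.congr_fderiv (eq_lin _), ?_⟩
  simp
  change -(a * ((W ^ 2)⁻¹ * ((a * r + b * q) / W))) + W⁻¹ * r +
    (-(b * ((W ^ 2)⁻¹ * ((a * q + b * t) / W))) + W⁻¹ * t) = (σ - c * b) / W
  field_simp
  rw [hsq]
  linear_combination hpde
end

end

section
variable {σ c w m : ℝ} {Ω : Set (ℝ × ℝ)} {u χ : ℝ × ℝ → ℝ}

lemma flux_pointwise {σ c m a b W h z d M : ℝ} (hW : 0 < W) (hsq : W ^ 2 = 1 + a ^ 2 + b ^ 2)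
    (hz0 : 0 ≤ z) (hz1 : z ≤ 1) (hh : h ≤ 0) (hhM : -M ≤ h) (hd : |d| ≤ M) :
    |h * a| ≤ -(h * a * (a / W) + (h * (b - m) + d) * (b / W) + z * ((σ - c * b) / W))
      + (M * (1 + |m|) + M + (|σ| + |c|)) := by
  have ha : |a| ≤ W := abs_le_of_sq_le_sq (by nlinarith [sq_nonneg b]) hW.le
  have hb : |b| ≤ W := abs_le_of_sq_le_sq (by nlinarith [sq_nonneg a]) hW.le
  have h1W : 1 ≤ W := by nlinarith [sq_nonneg a, sq_nonneg b]
  have hbW : |b / W| ≤ 1 := by rw [abs_div, abs_of_pos hW, div_le_one hW]; exact hb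
  have hb' := abs_le.1 hbW
  have hW1 : 1 / W ≤ 1 := by rw [div_le_one hW]; exact h1W
  have hW0 : 0 < 1 / W := by positivity
  have e1 : h * a * (a / W) + h * (b - m) * (b / W) = h * (W - 1 / W - m * (b / W)) := by
    field_simp; rw [hsq]; ring
  have h2 : |m * (b / W)| ≤ |m| := by
    rw [abs_mul]; exact mul_le_of_le_one_right (abs_nonneg _) hbW
  have h2' := abs_le.1 h2
  have h3 : |d * (b / W)| ≤ M := by
    rw [abs_mul]; exact (mul_le_of_le_one_right (abs_nonneg _) hbW).trans hd
  have h3' := abs_le.1 h3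
  have h4 : |z * ((σ - c * b) / W)| ≤ |σ| + |c| := by
    have e : (σ - c * b) / W = σ * (1 / W) - c * (b / W) := by ring
    rw [abs_mul, abs_of_nonneg hz0, e]
    have : |σ * (1 / W) - c * (b / W)| ≤ |σ| + |c| := by
      refine (abs_sub _ _).trans (add_le_add ?_ ?_)
      · rw [abs_mul, abs_of_pos hW0]; exact mul_le_of_le_one_right (abs_nonneg _) hW1
      · rw [abs_mul]; exact mul_le_of_le_one_right (abs_nonneg _) hbW
    exact (mul_le_of_le_one_left (abs_nonneg _) hz1).trans this
  have h4' := abs_le.1 h4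
  have h5 : |h * a| ≤ -h * W := by
    rw [abs_mul, abs_of_nonpos hh]; gcongr; linarith
  have h6 : -h * (1 / W + m * (b / W)) ≤ M * (1 + |m|) := by
    have hm : 1 / W + m * (b / W) ≤ 1 + |m| := by linarith
    have : -h * (1 / W + m * (b / W)) ≤ -h * (1 + |m|) :=
      mul_le_mul_of_nonneg_left hm (by linarith)
    have h7 : -h * (1 + |m|) ≤ M * (1 + |m|) := by gcongr; linarith
    linarith
  nlinarith

lemma hasCompactSupport_indicator {P C : Set (ℝ × ℝ)} (hC : IsCompact C) {f : ℝ × ℝ → ℝ}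
    (h0 : ∀ p ∈ P, p ∉ C → f p = 0) : HasCompactSupport (P.indicator f) := by
  refine HasCompactSupport.intro hC fun p hp => ?_
  by_cases h : p ∈ P
  · rw [indicator_of_mem h, h0 p h hp]
  · exact indicator_of_notMem h f

theorem Data.exists_area_bound (hD : Data σ c w m Ω u χ) : ∃ a0 : ℝ, 0 < a0 ∧
    ∀ (T : ℝ) (P : Set (ℝ × ℝ)), Piece χ (rho (-1)) P → P ⊆ Ω →
      (∀ τ, T ≤ τ → ∃ p ∈ P, p.2 = τ ∧ hgt m u p ≤ -3) →
      a0 ≤ volume.real (P ∩ {p | p.2 ∈ Icc T (T + 3)}) := by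
  obtain ⟨H, H', M1, hHc, hH', hHM, hHn, hH0, hH1, hHz, hHo⟩ := exists_step
  obtain ⟨ζ, ζ', M2, hζc, hζ', hζM, hζ0, hζ1, hζz, hζo⟩ := exists_bump
  set M := max M1 M2 with hM
  have hM0 : 0 ≤ M := (abs_nonneg _).trans ((hζM 0).trans (le_max_right _ _))
  set C := M * (1 + |m|) + M + (|σ| + |c|) with hCdef
  have hC0 : 0 ≤ C := by positivity
  refine ⟨1 / (C + 1), by positivity, ?_⟩
  intro T P hP hPΩ hslice
  have hw0 := hD.sol.nonneg
  have hrr : rho (-2) < rho (-1) := rho_strictMono (by norm_num)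
  set K := P ∩ {p | χ p ≤ rho (-2)} ∩ {p | p.2 ∈ Icc T (T + 3)} with hK
  have hKc : IsCompact K := isCompact_of_strip
    ((hP.isClosed hD.cont hrr).inter (isClosed_Icc.preimage continuous_snd))
    (fun p hp => hD.sol.strip p (hPΩ hp.1.1)) (fun p hp => hp.2)
  have hKP : K ⊆ P := fun p hp => hp.1.1
  set f : ℝ × ℝ → ℝ := fun p => ζ (p.2 - T) * H (hgt m u p) with hf
  have hf0 : ∀ p ∈ P, p ∉ K → f p = 0 := by
    intro p hp hpK
    by_cases h1 : p.2 ∈ Icc T (T + 3)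
    · have : ¬ χ p ≤ rho (-2) := fun h => hpK ⟨⟨hp, h⟩, h1⟩
      rw [hD.le_iff (hPΩ hp)] at this
      simp [hf, hHz _ (not_le.1 this).le]
    · have : ζ (p.2 - T) = 0 := hζz _ fun h => h1 ⟨by linarith [h.1], by linarith [h.2]⟩
      simp [hf, this]
  have hfc : ContDiffOn ℝ 1 f P := by
    have h1 : ContDiffOn ℝ 1 (hgt m u) P :=
      ((hD.sol.smooth.of_le (by exact_mod_cast le_top)).mono hPΩ).sub
        (contDiff_const.mul contDiff_snd).contDiffOn
    exact (hζc.comp (contDiff_snd.sub contDiff_const)).contDiffOn.mul (hHc.comp_contDiffOn h1)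
  have hAc := hD.sol.contDiffOn_areaElt.mono hPΩ
  have hpc : ContDiffOn ℝ 1 (fun p => pds u p / areaElt u p) P :=
    (((smooth_pds hD.sol.isOpen hD.sol.smooth).of_le (by exact_mod_cast le_top)).mono hPΩ).div hAc
      fun p _ => (areaElt_pos u p).ne'
  have hqc : ContDiffOn ℝ 1 (fun p => pdt u p / areaElt u p) P :=
    (((smooth_pdt hD.sol.isOpen hD.sol.smooth).of_le (by exact_mod_cast le_top)).mono hPΩ).div hAc
      fun p _ => (areaElt_pos u p).ne'
  set g1 : ℝ × ℝ → ℝ := fun p => f p * (pds u p / areaElt u p) with hg1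
  set g2 : ℝ × ℝ → ℝ := fun p => f p * (pdt u p / areaElt u p) with hg2
  have hg10 : ∀ p ∈ P, p ∉ K → g1 p = 0 := fun p h1 h2 => by simp [hg1, hf0 p h1 h2]
  have hg20 : ∀ p ∈ P, p ∉ K → g2 p = 0 := fun p h1 h2 => by simp [hg2, hf0 p h1 h2]
  have cW := contDiff_indicator_of_closed hP.isOpen hKc.isClosed hKP hfc hf0
  have c1 := contDiff_indicator_of_closed hP.isOpen hKc.isClosed hKP (hfc.mul hpc) hg10
  have c2 := contDiff_indicator_of_closed hP.isOpen hKc.isClosed hKP (hfc.mul hqc) hg20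
  have sW := hasCompactSupport_indicator hKc hf0
  have s1 := hasCompactSupport_indicator hKc hg10
  have s2 := hasCompactSupport_indicator hKc hg20
  set W := P.indicator f with hW
  set G1 := P.indicator g1 with hG1
  set G2 := P.indicator g2 with hG2
  have hcont : ∀ {G : ℝ × ℝ → ℝ} (v : ℝ × ℝ), ContDiff ℝ 1 G →
      Continuous fun p => fderiv ℝ G p v := fun v h =>
    (h.continuous_fderiv one_ne_zero).clm_apply continuous_const
  set E := P ∩ {p : ℝ × ℝ | p.2 ∈ Icc T (T + 3)} with hE
  have hEm : MeasurableSet E :=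
    hP.isOpen.measurableSet.inter (isClosed_Icc.preimage continuous_snd).measurableSet
  have hEfin : volume E ≠ ⊤ := by
    have : E ⊆ Icc (-w) w ×ˢ Icc T (T + 3) := fun p hp =>
      ⟨abs_le.1 (hD.sol.strip p (hPΩ hp.1)), hp.2⟩
    exact ((measure_mono this).trans_lt (isCompact_Icc.prod isCompact_Icc).measure_lt_top).ne
  have hpoint : ∀ p, |fderiv ℝ W p (1, 0)| ≤ -(fderiv ℝ G1 p (1, 0) + fderiv ℝ G2 p (0, 1))
      + E.indicator (fun _ => C) p := by
    intro p
    by_cases hpE : p ∈ E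
    · have hpΩ := hPΩ hpE.1
      obtain ⟨x1, x2, y1, y2, hx, hy, hxy⟩ := hD.sol.divergence hpΩ
      have hh := hD.sol.hgt_hasFDerivAt (m := m) hpΩ
      have hz : HasFDerivAt (fun q : ℝ × ℝ => ζ (q.2 - T)) (lin 0 (ζ' (p.2 - T))) p :=
        ((hζ' (p.2 - T)).comp_hasFDerivAt p
          ((hasFDerivAt_snd_lin p).sub_const T)).congr_fderiv (by ext <;> simp)
      have hHf := (hH' (hgt m u p)).comp_hasFDerivAt p hh
      have hff : HasFDerivAt f _ p := hz.mul hHf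
      have hg1' : HasFDerivAt g1 _ p := hff.mul hx
      have hg2' : HasFDerivAt g2 _ p := hff.mul hy
      have hind : ∀ g : ℝ × ℝ → ℝ, P.indicator g =ᶠ[𝓝 p] g := fun g => by
        filter_upwards [hP.isOpen.mem_nhds hpE.1] with q hq using indicator_of_mem hq g
      rw [indicator_of_mem hpE, hW, hG1, hG2, (hind f).fderiv_eq, (hind g1).fderiv_eq,
        (hind g2).fderiv_eq, hff.fderiv, hg1'.fderiv, hg2'.fderiv]
      have key := flux_pointwise (σ := σ) (c := c) (m := m) (a := pds u p) (b := pdt u p)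
        (W := areaElt u p) (h := ζ (p.2 - T) * H' (hgt m u p)) (z := f p)
        (d := ζ' (p.2 - T) * H (hgt m u p)) (M := M) (areaElt_pos u p) (areaElt_sq u p)
        (mul_nonneg (hζ0 _) (hH0 _)) (mul_le_one₀ (hζ1 _) (hH0 _) (hH1 _))
        (mul_nonpos_of_nonneg_of_nonpos (hζ0 _) (hHn _)) ?_ ?_
      · rw [← hxy] at key
        refine (le_of_eq ?_).trans (key.trans (le_of_eq ?_))
        · congr 1
          simp
          ring
        · simp [hCdef, hf]
          ring
      · have h1 := hHM (hgt m u p)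
        have h2 := hHn (hgt m u p)
        have h3 := hζ1 (p.2 - T)
        have h4 := hζ0 (p.2 - T)
        have h5 : M1 ≤ M := le_max_left _ _
        nlinarith
      · rw [abs_mul, abs_of_nonneg (hH0 _)]
        exact (mul_le_of_le_one_right (abs_nonneg _) (hH1 _)).trans
          ((hζM _).trans (le_max_right _ _))
    · have hpK : p ∉ K := fun h => hpE ⟨h.1.1, h.2⟩
      have hzero : ∀ g : ℝ × ℝ → ℝ, (∀ p ∈ P, p ∉ K → g p = 0) →
          P.indicator g =ᶠ[𝓝 p] fun _ => 0 := by
        intro g hg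
        filter_upwards [hKc.isClosed.isOpen_compl.mem_nhds hpK] with q hq
        by_cases h : q ∈ P
        · rw [indicator_of_mem h, hg q h hq]
        · exact indicator_of_notMem h g
      rw [indicator_of_notMem hpE, hW, hG1, hG2, (hzero f hf0).fderiv_eq,
        (hzero g1 hg10).fderiv_eq, (hzero g2 hg20).fderiv_eq]
      simp
  have hiW : Integrable (fun p => |fderiv ℝ W p (1, 0)|) :=
    ((hcont _ cW).integrable_of_hasCompactSupport (sW.fderiv_apply ℝ _)).abs
  have hi1 : Integrable (fun p => fderiv ℝ G1 p (1, 0)) :=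
    (hcont _ c1).integrable_of_hasCompactSupport (s1.fderiv_apply ℝ _)
  have hi2 : Integrable (fun p => fderiv ℝ G2 p (0, 1)) :=
    (hcont _ c2).integrable_of_hasCompactSupport (s2.fderiv_apply ℝ _)
  have hiE : Integrable (E.indicator fun _ => C) :=
    (integrable_indicator_iff hEm).2 (integrableOn_const hEfin)
  have i12 : Integrable (fun p => -(fderiv ℝ G1 p (1, 0) + fderiv ℝ G2 p (0, 1))) :=
    (hi1.add hi2).neg
  have hupper : ∫ p, |fderiv ℝ W p (1, 0)| ≤ C * volume.real E := by
    calc ∫ p, |fderiv ℝ W p (1, 0)|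
        ≤ ∫ p, (-(fderiv ℝ G1 p (1, 0) + fderiv ℝ G2 p (0, 1)) + E.indicator (fun _ => C) p) :=
          integral_mono hiW (i12.add hiE) hpoint
      _ = C * volume.real E := by
          rw [integral_add i12 hiE, integral_neg, integral_add hi1 hi2,
            integral_fderiv_eq_zero c1 s1, integral_fderiv_eq_zero c2 s2,
            integral_indicator_const _ hEm]
          simp [mul_comm]
  have hlower : 1 ≤ ∫ p, |fderiv ℝ W p (1, 0)| := by
    have hfib : ∀ τ ∈ Icc (T + 1) (T + 2), 1 ≤ ∫ s, |fderiv ℝ W (s, τ) (1, 0)| := by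
      intro τ hτ
      obtain ⟨p, hpP, hp2, hph⟩ := hslice τ (by linarith [hτ.1])
      have hps := abs_le.1 (hD.sol.strip p (hPΩ hpP))
      refine one_le_integral_abs_deriv (g := fun s => W (s, τ)) (a := -w - 1) (b := p.1) ?_ ?_ ?_
        (by linarith) ?_ ?_
      · intro x
        have h1 : HasDerivAt (fun s : ℝ => (s, τ)) ((1 : ℝ), (0 : ℝ)) x :=
          (hasDerivAt_id x).prodMk (hasDerivAt_const x τ)
        exact (((cW.differentiable one_ne_zero) (x, τ)).hasFDerivAt).comp_hasDerivAt x h1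
      · exact (hcont _ cW).comp (by fun_prop : Continuous fun s : ℝ => (s, τ))
      · refine HasCompactSupport.intro (K := Icc (-w) w) isCompact_Icc fun s hs => ?_
        have hnot : (s, τ) ∉ K := fun h => hs (abs_le.1 (hD.sol.strip _ (hPΩ h.1.1)))
        have : W =ᶠ[𝓝 (s, τ)] fun _ => 0 := by
          filter_upwards [hKc.isClosed.isOpen_compl.mem_nhds hnot] with q hq
          by_cases h : q ∈ P
          · rw [hW, indicator_of_mem h, hf0 q h hq]
          · exact indicator_of_notMem h f
        rw [this.fderiv_eq]; simp
      · refine indicator_of_notMem (fun h => ?_) f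
        have := (abs_le.1 (hD.sol.strip _ (hPΩ h))).1
        simp only at this
        linarith
      · have hp : (p.1, τ) = p := by rw [← hp2]
        simp only [hp, hW]
        rw [indicator_of_mem hpP]
        simp only [hf]
        rw [hHo _ hph, hζo _ ⟨by linarith [hτ.1], by linarith [hτ.2]⟩, one_mul]
    rw [Measure.volume_eq_prod] at hiW ⊢
    rw [integral_prod_symm _ hiW]
    have hi := hiW.integral_prod_right
    calc (1 : ℝ) = ∫ τ, (Icc (T + 1) (T + 2)).indicator (fun _ => (1 : ℝ)) τ := by
          rw [integral_indicator_const _ measurableSet_Icc]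
          simp [Measure.real]
          norm_num
      _ ≤ _ := by
        refine integral_mono ((integrable_indicator_iff measurableSet_Icc).2
          (integrableOn_const measure_Icc_lt_top.ne)) hi fun τ => ?_
        by_cases hτ : τ ∈ Icc (T + 1) (T + 2)
        · rw [indicator_of_mem hτ]; exact hfib τ hτ
        · rw [indicator_of_notMem hτ]; exact integral_nonneg fun _ => abs_nonneg _
  rw [div_le_iff₀ (by positivity)]
  have : 0 ≤ volume.real E := measureReal_nonneg
  nlinarith
end

section

variable {c w m : ℝ} {Ω : Set (ℝ × ℝ)} {u χ : ℝ × ℝ → ℝ}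

lemma Piece.component_subset {e e' : ℝ} {P : Set (ℝ × ℝ)} (hP : Piece χ e P) (he : e' ≤ e)
    {z : ℝ × ℝ} (hz : z ∈ P) : connectedComponentIn {p | χ p < e'} z ⊆ P := by
  by_cases hze : χ z < e'
  · have hsub : connectedComponentIn {p | χ p < e'} z ⊆ P ∪ ({p | χ p < e} \ P) := by
      intro p hp
      have : χ p < e := lt_of_lt_of_le (connectedComponentIn_subset _ _ hp :) he
      by_cases h : p ∈ P
      · exact Or.inl h
      · exact Or.inr ⟨this, h⟩
    exact isPreconnected_connectedComponentIn.subset_left_of_subset_union hP.isOpen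
      hP.isOpen_diff (disjoint_sdiff_self_right) hsub ⟨z, mem_connectedComponentIn hze, hz⟩
  · rw [connectedComponentIn_eq_empty (show z ∉ {p | χ p < e'} from hze)]
    exact empty_subset _

lemma Data.exists_slices (hD : Data (c * m) c w m Ω u χ) (hc : 0 < c) {Z : Set (ℝ × ℝ)}
    (hZ : Piece χ (rho (-1)) Z) (hne : Z.Nonempty) (hZΩ : Z ⊆ Ω) :
    ∃ T, ∀ τ, T ≤ τ → ∃ p ∈ Z, p.2 = τ ∧ hgt m u p ≤ -3 := by
  obtain ⟨z, hz, hzΩ, hzv⟩ := hD.exists_lt_of_piece hc hZ hne (-3)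
  have hzc : χ z < rho (-3) := (hD.lt_iff hzΩ).2 hzv
  set C := connectedComponentIn {p | χ p < rho (-3)} z with hC
  have hCZ : C ⊆ Z := hZ.component_subset (rho_strictMono (by norm_num)).le hz
  have hzC : z ∈ C := mem_connectedComponentIn hzc
  have hub : ∀ b, ∃ p ∈ C, b < p.2 := by
    intro b
    by_contra! h
    exact hD.not_subset_lower hc (piece_component hD.cont _ z) ⟨z, hzC⟩
      (fun p hp => hD.sol.strip p (hZΩ (hCZ hp))) h
  refine ⟨z.2, fun τ hτ => ?_⟩
  obtain ⟨q, hq, hqτ⟩ := hub τ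
  have := (isPreconnected_connectedComponentIn (F := {p | χ p < rho (-3)}) (x := z)).intermediate_value
    hzC hq continuous_snd.continuousOn ⟨hτ, hqτ.le⟩
  obtain ⟨p, hp, hpτ⟩ := this
  have h3 : χ p < rho (-3) := (connectedComponentIn_subset _ _ hp :)
  exact ⟨p, hCZ hp, hpτ, ((hD.lt_iff (hZΩ (hCZ hp))).1 h3).le⟩

theorem Data.card_wings_le (hD : Data (c * m) c w m Ω u χ) (hc : 0 < c) : ∃ N : ℕ,
    ∀ (s : Finset ℕ) (Z : ℕ → Set (ℝ × ℝ)), (∀ i ∈ s, Piece χ (rho (-1)) (Z i)) →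
      (∀ i ∈ s, (Z i).Nonempty) → (∀ i ∈ s, Z i ⊆ Ω) →
      (∀ i ∈ s, ∀ j ∈ s, i ≠ j → Disjoint (Z i) (Z j)) → s.card ≤ N := by
  obtain ⟨a0, ha0, harea⟩ := hD.exists_area_bound
  refine ⟨⌊6 * w / a0⌋₊, fun s Z hZ hne hZΩ hdis => Nat.le_floor ?_⟩
  have hw0 := hD.sol.nonneg
  have hsl : ∀ i ∈ s, ∃ T, ∀ τ, T ≤ τ → ∃ p ∈ Z i, p.2 = τ ∧ hgt m u p ≤ -3 := fun i hi =>
    hD.exists_slices hc (hZ i hi) (hne i hi) (hZΩ i hi)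
  choose! T hT using hsl
  obtain ⟨B, hB⟩ : ∃ B, ∀ i ∈ s, T i ≤ B := by
    obtain ⟨B, hB⟩ := (s.image T).bddAbove
    exact ⟨B, fun i hi => hB (by simpa using ⟨i, hi, rfl⟩)⟩
  have hi : ∀ i ∈ s, a0 ≤ volume.real (Z i ∩ {p | p.2 ∈ Icc B (B + 3)}) := fun i hi =>
    harea B (Z i) (hZ i hi) (hZΩ i hi) fun τ hτ => hT i hi τ ((hB i hi).trans hτ)
  set R : Set (ℝ × ℝ) := Icc (-w) w ×ˢ Icc B (B + 3) with hR
  have hsubR : ∀ i ∈ s, Z i ∩ {p | p.2 ∈ Icc B (B + 3)} ⊆ R := fun i hi p hp =>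
    ⟨abs_le.1 (hD.sol.strip p (hZΩ i hi hp.1)), hp.2⟩
  have hRfin : volume R ≠ ⊤ := (isCompact_Icc.prod isCompact_Icc).measure_lt_top.ne
  have hRvol : volume.real R = 6 * w := by
    rw [hR, Measure.volume_eq_prod, measureReal_prod_prod, Real.volume_real_Icc_of_le (by linarith),
      Real.volume_real_Icc_of_le (by linarith)]
    ring
  rw [le_div_iff₀ ha0]
  calc (s.card : ℝ) * a0 = ∑ _i ∈ s, a0 := by simp
    _ ≤ ∑ i ∈ s, volume.real (Z i ∩ {p | p.2 ∈ Icc B (B + 3)}) := Finset.sum_le_sum hi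
    _ = volume.real (⋃ i ∈ s, Z i ∩ {p | p.2 ∈ Icc B (B + 3)}) := by
        refine (measureReal_biUnion_finset ?_ ?_ ?_).symm
        · intro i hi j hj hij
          exact (hdis i hi j hj hij).mono inter_subset_left inter_subset_left
        · intro i hi
          exact (hZ i hi).isOpen.measurableSet.inter
            (isClosed_Icc.preimage continuous_snd).measurableSet
        · intro i hi
          exact ((measure_mono (hsubR i hi)).trans_lt hRfin.lt_top).ne
    _ ≤ volume.real R := measureReal_mono (iUnion₂_subset hsubR) hRfin
    _ = 6 * w := hRvol

end

section

variable {c w m : ℝ} {Ω : Set (ℝ × ℝ)} {u χ : ℝ × ℝ → ℝ}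

lemma Data.tilted_bound (hD : Data (c * m) c w m Ω u χ) (hc : 0 < c) {X : Set (ℝ × ℝ)}
    (hX : IsCompact X) {L β η κ b : ℝ} (hη : 0 < η) (hb : b ^ 2 = 1)
    (hXL : ∀ p ∈ X, χ p ≤ rho (-L)) (hXβ : ∀ p ∈ X, p.2 ≤ β)
    (hnhds : ∀ p ∈ X, χ p < rho (-L) → p.2 < β → X ∈ 𝓝 p)
    (htop : ∀ p ∈ X, p.2 = β → b * p.1 + η * β ≤ κ) :
    ∃ B, 0 < B ∧ ∀ p ∈ X, κ < b * p.1 + η * p.2 → rho (-L - B) < χ p := by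
  have hk : 0 < c * η / (1 + η ^ 2 + m ^ 2) := by positivity
  obtain ⟨A, φ, φ1, φ2, hA, hφ, hy, -⟩ := exists_profile hk 0 0 le_rfl
  have hq : ∀ p : ℝ × ℝ, quad 0 b η p = b * p.1 + η * p.2 := fun p => by simp [quad]
  refine ⟨A + 1, by positivity, fun p hp hκ => ?_⟩
  refine hD.barrier_bound hφ (a := 0) (b := b) (κ := κ) hη.ne' hX hXL ?_ ?_ (lt_add_one A) p hp
    (by rwa [hq])
  · intro p hp h1 h2
    refine hnhds p hp h1 (lt_of_le_of_ne (hXβ p hp) fun h => ?_)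
    have := htop p hp h
    rw [hq, h] at h2
    linarith
  · intro p hp r hr _
    exact barrierOp_pos_tilted hc hη (hφ.pos1 r hr) (by simpa using hb)
      (by rw [div_mul_cancel₀ _ (by positivity)]) (hy r hr)

theorem Data.not_top_subset (hD : Data (c * m) c w m Ω u χ) (hc : 0 < c) {c0 : ℝ} (hc0 : 0 < c0)
    (hc0' : 36 * c ^ 2 * c0 ^ 2 * (1 + m ^ 2) ≤ 1) {X : Set (ℝ × ℝ)} (hX : IsCompact X)
    {L β s0 : ℝ} (hβ : 0 < β) (hXL : ∀ p ∈ X, χ p ≤ rho (-L)) (hX0 : ∀ p ∈ X, 0 ≤ p.2)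
    (hXβ : ∀ p ∈ X, p.2 ≤ β) (hnhds : ∀ p ∈ X, χ p < rho (-L) → p.2 < β → X ∈ 𝓝 p)
    (htop : ∀ p ∈ X, p.2 = β → p.1 ∈ Icc s0 (s0 + c0)) {f : ℝ × ℝ} (hf : f ∈ X)
    (hfχ : χ f = -1) (hfβ : f.2 + 9 / 2 * c * c0 ^ 2 < β) : False := by
  have hη : 0 < c0 / β := by positivity
  have hηβ : c0 / β * β = c0 := div_mul_cancel₀ _ hβ.ne'
  obtain ⟨B1, hB1, h1⟩ := hD.tilted_bound hc hX (κ := s0 + 2 * c0) hη (b := 1) (by norm_num) hXL hXβ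
    hnhds fun p hp h => by
      rw [hηβ]; linarith [(htop p hp h).2]
  obtain ⟨B2, hB2, h2⟩ := hD.tilted_bound hc hX (κ := c0 - s0) hη (b := -1) (by norm_num) hXL hXβ
    hnhds fun p hp h => by
      rw [hηβ]; linarith [(htop p hp h).1]
  set L2 := L + B1 + B2 with hL2
  set X2 := X ∩ {p | χ p ≤ rho (-L2)} with hX2
  have hX2s : ∀ p ∈ X2, s0 - c0 ≤ p.1 ∧ p.1 ≤ s0 + 2 * c0 := by
    intro p hp
    have hpos : 0 ≤ c0 / β * p.2 := mul_nonneg hη.le (hX0 p hp.1)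
    have hχp : χ p ≤ rho (-L2) := hp.2
    constructor
    · by_contra! h
      have := h2 p hp.1 (by linarith)
      have h3 : rho (-L2) ≤ rho (-L - B2) := rho_strictMono.monotone (by linarith)
      linarith
    · by_contra! h
      have := h1 p hp.1 (by linarith)
      have h3 : rho (-L2) ≤ rho (-L - B1) := rho_strictMono.monotone (by linarith)
      linarith
  have hX2c : IsCompact X2 := hX.inter_right (isClosed_le hD.cont continuous_const)
  have hk : 0 < c / (2 * (1 + m ^ 2)) := by positivity
  obtain ⟨A, φ, φ1, φ2, hA, hφ, hy, -⟩ := exists_profile hk 0 0 le_rfl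
  set sc := s0 + c0 / 2 with hsc
  have hq : ∀ p : ℝ × ℝ, quad (2 * c) (-(4 * c * sc)) (-1) p
      = 2 * c * (p.1 - sc) ^ 2 - 2 * c * sc ^ 2 - p.2 := fun p => by simp [quad]; ring
  have hsq : ∀ p ∈ X2, (p.1 - sc) ^ 2 ≤ 9 / 4 * c0 ^ 2 := by
    intro p hp
    have := hX2s p hp
    have : |p.1 - sc| ≤ 3 / 2 * c0 := abs_le.2 ⟨by linarith, by linarith⟩
    calc (p.1 - sc) ^ 2 = |p.1 - sc| ^ 2 := (sq_abs _).symm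
      _ ≤ (3 / 2 * c0) ^ 2 := by gcongr
      _ = _ := by ring
  have hfX2 : f ∈ X2 := ⟨hf, by
    show χ f ≤ _
    rw [hfχ]; exact (neg_one_lt_rho _).le⟩
  have := hD.barrier_bound hφ (a := 2 * c) (b := -(4 * c * sc)) (d := -1) (L := L2)
    (κ := 9 / 2 * c * c0 ^ 2 - 2 * c * sc ^ 2 - β) (by norm_num) hX2c (fun p hp => hp.2) ?_ ?_
    (lt_add_one A) f hfX2 ?_
  · rw [hfχ] at this
    linarith [neg_one_lt_rho (-L2 - (A + 1))]
  · intro p hp hp1 hp2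
    have hlt : χ p < rho (-L) := hp1.trans (rho_strictMono (by linarith))
    refine inter_mem (hnhds p hp.1 hlt (lt_of_le_of_ne (hXβ p hp.1) fun h => ?_)) ?_
    · rw [hq, h] at hp2
      have := hsq p hp
      nlinarith
    · filter_upwards [(isOpen_lt hD.cont continuous_const).mem_nhds hp1] with q hq
      exact le_of_lt hq
  · intro p hp r hr _
    refine barrierOp_pos_parabolic hc (hφ.pos1 r hr) hk ?_
      (by rw [div_mul_cancel₀ _ (by positivity)]) (hy r hr)
    have h3 := hsq p hp
    have : (2 * (2 * c) * p.1 + -(4 * c * sc)) ^ 2 = 16 * c ^ 2 * (p.1 - sc) ^ 2 := by ring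
    rw [this]
    calc 16 * c ^ 2 * (p.1 - sc) ^ 2 * (1 + m ^ 2)
        ≤ 16 * c ^ 2 * (9 / 4 * c0 ^ 2) * (1 + m ^ 2) := by gcongr
      _ = 36 * c ^ 2 * c0 ^ 2 * (1 + m ^ 2) := by ring
      _ ≤ 1 := hc0'
  · rw [hq]
    have : 0 ≤ 2 * c * (f.1 - sc) ^ 2 := by positivity
    linarith

lemma isClosed_connectedComponentIn' {X : Type*} [TopologicalSpace X] {K : Set X} (hK : IsClosed K)
    (x : X) : IsClosed (connectedComponentIn K x) := by
  by_cases hx : x ∈ K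
  · refine closure_subset_iff_isClosed.1 ?_
    exact isPreconnected_connectedComponentIn.closure.subset_connectedComponentIn
      (subset_closure (mem_connectedComponentIn hx))
      (closure_minimal (connectedComponentIn_subset _ _) hK)
  · rw [connectedComponentIn_eq_empty hx]; exact isClosed_empty

theorem Data.exists_top_pair (hD : Data (c * m) c w m Ω u χ) (hc : 0 < c) {c0 : ℝ} (hc0 : 0 < c0)
    (hc0' : 36 * c ^ 2 * c0 ^ 2 * (1 + m ^ 2) ≤ 1) {Z : Set (ℝ × ℝ)} (hZ : Piece χ (rho (-1)) Z)
    (hZw : ∀ p ∈ Z, |p.1| ≤ w) (hZ0 : ∀ p ∈ Z, 0 < p.2) {f : ℝ × ℝ} (hf : f ∈ Z) (hfχ : χ f = -1)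
    {L β : ℝ} (hL : 1 < L) (hfβ : f.2 + 9 / 2 * c * c0 ^ 2 < β) :
    IsCompact (connectedComponentIn (Z ∩ {p | χ p ≤ rho (-L)} ∩ {p | p.2 ≤ β}) f) ∧
    ∃ l r, l + c0 / 2 ≤ r ∧
      (l, β) ∈ connectedComponentIn (Z ∩ {p | χ p ≤ rho (-L)} ∩ {p | p.2 ≤ β}) f ∧
      (r, β) ∈ connectedComponentIn (Z ∩ {p | χ p ≤ rho (-L)} ∩ {p | p.2 ≤ β}) f := by
  set K := Z ∩ {p | χ p ≤ rho (-L)} ∩ {p | p.2 ≤ β} with hK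
  have hLr : rho (-L) < rho (-1) := rho_strictMono (by linarith)
  have hKc : IsCompact K := isCompact_of_strip (a := 0) (b := β)
    ((hZ.isClosed hD.cont hLr).inter (isClosed_le continuous_snd continuous_const))
    (fun p hp => hZw p hp.1.1) fun p hp => ⟨(hZ0 p hp.1.1).le, hp.2⟩
  have hpos : 0 < 9 / 2 * c * c0 ^ 2 := by positivity
  have hfK : f ∈ K := ⟨⟨hf, by
    show χ f ≤ _
    rw [hfχ]; exact (neg_one_lt_rho _).le⟩, (by linarith : f.2 ≤ β)⟩
  refine ⟨hKc.of_isClosed_subset (isClosed_connectedComponentIn' hKc.isClosed f)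
    (connectedComponentIn_subset _ _), ?_⟩
  by_contra! hno
  obtain ⟨s1, hs1⟩ : ∃ s1, ∀ s, (s, β) ∈ connectedComponentIn K f → |s - s1| < c0 / 2 := by
    by_cases h : ∃ s, (s, β) ∈ connectedComponentIn K f
    · obtain ⟨s1, hs1⟩ := h
      refine ⟨s1, fun s hs => abs_lt.2 ⟨?_, ?_⟩⟩
      · by_contra! h
        exact hno s s1 (by linarith) hs hs1
      · by_contra! h
        exact hno s1 s (by linarith) hs1 hs
    · push Not at h
      exact ⟨0, fun s hs => absurd hs (h s)⟩
  set U : Set (ℝ × ℝ) := {p | p.2 < β} ∪ {p | |p.1 - s1| < c0 / 2} with hU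
  have hUo : IsOpen U := (isOpen_lt continuous_snd continuous_const).union
    (isOpen_lt (by fun_prop) continuous_const)
  obtain ⟨Y, hYK, hfY, hYU, hYc, hYc'⟩ := exists_clopen_piece hKc hUo hfK (by
    rintro ⟨s, τ⟩ hp
    have h1 : τ ≤ β := (connectedComponentIn_subset _ _ hp).2
    rcases h1.lt_or_eq with h1 | h1
    · exact Or.inl h1
    · subst h1
      exact Or.inr (hs1 s hp))
  refine hD.not_top_subset hc hc0 hc0' hYc (L := L) (β := β) (s0 := s1 - c0 / 2) ?_
    (fun p hp => (hYK hp).1.2) (fun p hp => (hZ0 p (hYK hp).1.1).le) (fun p hp => (hYK hp).2) ?_ ?_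
    hfY hfχ hfβ
  · linarith [hZ0 f hf]
  · intro p hp h1 h2
    filter_upwards [hZ.mem_nhds hD.cont (hYK hp).1.1 h1,
      (isOpen_lt continuous_snd continuous_const).mem_nhds h2,
      hYc'.isClosed.isOpen_compl.mem_nhds (fun h : p ∈ K \ Y => h.2 hp)] with q h3 h4 h5
    by_contra hq
    exact h5 ⟨⟨h3, le_of_lt h4⟩, hq⟩
  · intro p hp h
    rcases hYU hp with h1 | h1
    · exact absurd h1 (not_lt.2 h.ge)
    · have h2 : |p.1 - s1| < c0 / 2 := h1
      have := abs_lt.1 h2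
      exact ⟨by linarith [this.1], by linarith [this.2]⟩

end

lemma card_le_of_separated {s : Finset ℕ} {l : ℕ → ℝ} {w d : ℝ} (hd : 0 < d)
    (hl : ∀ i ∈ s, |l i| ≤ w) (hsep : ∀ i ∈ s, ∀ j ∈ s, i ≠ j → l i < l j + d → l i + d ≤ l j) :
    s.card ≤ (Finset.Icc ⌊-w / d⌋ ⌊w / d⌋).card := by
  refine Finset.card_le_card_of_injOn (fun i => ⌊l i / d⌋) ?_ ?_
  · intro i hi
    have := abs_le.1 (hl i hi)
    simp only [Finset.coe_Icc, mem_Icc]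
    constructor <;> refine Int.floor_mono ?_ <;> gcongr <;> tauto
  · intro i hi j hj hij
    by_contra hne
    have h1 := Int.abs_sub_lt_one_of_floor_eq_floor hij
    rw [← sub_div, abs_div, abs_of_pos hd, div_lt_one hd] at h1
    have h2 := abs_lt.1 h1
    have := hsep i hi j hj hne (by linarith)
    linarith

/-- Intervals of length at least `d` in `[-w, w]` such that the end points of all the others lie
on one side of each of them are bounded in number. -/
lemma card_le_of_unlinked {w d : ℝ} (hd : 0 < d) : ∃ N : ℕ, ∀ (s : Finset ℕ) (l r : ℕ → ℝ),
    (∀ i ∈ s, |l i| ≤ w) → (∀ i ∈ s, l i + d ≤ r i) →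
    (∀ i ∈ s, ∀ j ∈ s, i ≠ j → l i ≠ l j) →
    (∀ i ∈ s, ∀ j ∈ s, ∀ k ∈ s, i ≠ j → i ≠ k → l i < l j → l j < r i →
      l i < l k ∧ r k < r i) →
    s.card ≤ N := by
  refine ⟨(Finset.Icc ⌊-w / d⌋ ⌊w / d⌋).card + 1, fun s l r hl hlr hne hun => ?_⟩
  by_cases h : ∃ i ∈ s, ∃ j ∈ s, i ≠ j ∧ l i < l j ∧ l j < r i
  · obtain ⟨i, hi, j, hj, hij, h1, h2⟩ := h
    have hall := hun i hi j hj
    have : (s.erase i).card ≤ (Finset.Icc ⌊-w / d⌋ ⌊w / d⌋).card := by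
      refine card_le_of_separated hd (fun k hk => hl k (Finset.mem_of_mem_erase hk)) ?_
      intro a ha b hb hab hlt
      obtain ⟨hai, has⟩ := Finset.mem_erase.1 ha
      obtain ⟨hbi, hbs⟩ := Finset.mem_erase.1 hb
      have ga := hall a has hij hai.symm h1 h2
      have gb := hall b hbs hij hbi.symm h1 h2
      by_contra! hcon
      have ha' := hlr a has
      have hb' := hlr b hbs
      rcases lt_or_gt_of_ne (hne a has b hbs hab) with h | h
      · have := hun a has b hbs i hi hab hai h (by linarith)
        linarith
      · have := hun b hbs a has i hi hab.symm hbi h (by linarith)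
        linarith
    have := Finset.card_erase_add_one hi
    omega
  · push Not at h
    refine (card_le_of_separated hd hl ?_).trans (Nat.le_succ _)
    intro a ha b hb hab hlt
    rcases lt_or_gt_of_ne (hne a ha b hb hab) with h1 | h1
    · linarith [h a ha b hb hab h1, hlr a ha]
    · linarith [h b hb a ha hab.symm h1, hlr b hb]

section

variable {σ c w m : ℝ} {Ω : Set (ℝ × ℝ)} {u χ : ℝ × ℝ → ℝ}

lemma IsOpen.exists_compact_connecting {U : Set (ℝ × ℝ)} (hU : IsOpen U) (hc : IsPreconnected U)
    {a b : ℝ × ℝ} (ha : a ∈ U) (hb : b ∈ U) :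
    ∃ G ⊆ U, IsCompact G ∧ IsPreconnected G ∧ a ∈ G ∧ b ∈ G := by
  have hp : IsPathConnected U := hU.isConnected_iff_isPathConnected.1 ⟨⟨a, ha⟩, hc⟩
  have hj := hp.joinedIn a ha b hb
  refine ⟨range hj.somePath, ?_, isCompact_range hj.somePath.continuous,
    isPreconnected_range hj.somePath.continuous, ⟨0, hj.somePath.source⟩, ⟨1, hj.somePath.target⟩⟩
  rintro _ ⟨t, rfl⟩
  exact hj.somePath_mem t

lemma Data.exists_lower_level (hD : Data σ c w m Ω u χ) {G : Set (ℝ × ℝ)} (hG : IsCompact G)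
    (hGΩ : ∀ p ∈ G, -1 < χ p) : ∃ L, 1 < L ∧ ∀ p ∈ G, rho (-L) < χ p := by
  obtain ⟨e, he, heG⟩ : ∃ e, -1 < e ∧ ∀ p ∈ G, e ≤ χ p := by
    rcases G.eq_empty_or_nonempty with rfl | hne
    · exact ⟨0, by norm_num, by simp⟩
    · obtain ⟨p, hp, hmin⟩ := hG.exists_isMinOn hne hD.cont.continuousOn
      exact ⟨χ p, hGΩ p hp, fun q hq => hmin hq⟩
  have h1 : -1 < min e (rho (-1)) := lt_min he (neg_one_lt_rho _)
  have h2 : min e (rho (-1)) ≤ rho (-1) := min_le_right _ _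
  have h3 := rho_lt_one (-1)
  obtain ⟨x, hx⟩ := exists_rho_eq (e := (-1 + min e (rho (-1))) / 2)
    (abs_lt.2 ⟨by linarith, by linarith⟩)
  refine ⟨-x, ?_, fun p hp => ?_⟩
  · have : rho x < rho (-1) := by rw [hx]; linarith
    linarith [rho_strictMono.lt_iff_lt.1 this]
  · rw [neg_neg, hx]
    linarith [heG p hp, min_le_left e (rho (-1))]

theorem Data.card_marked_wings_le (hD : Data (c * m) c w m Ω u χ) (hc : 0 < c) : ∃ N : ℕ,
    ∀ (s : Finset ℕ) (y f : ℕ → ℝ × ℝ) (Y Z : ℕ → Set (ℝ × ℝ)), (∀ i ∈ s, IsOpen (Y i)) →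
      (∀ i ∈ s, IsPreconnected (Y i)) → (∀ i ∈ s, y i ∈ Ω) → (∀ i ∈ s, y i ∈ Y i) →
      (∀ i ∈ s, Z i ⊆ Y i) → (∀ i ∈ s, Piece χ (rho (-1)) (Z i)) →
      (∀ i ∈ s, ∀ p ∈ Z i, |p.1| ≤ w) → (∀ i ∈ s, ∀ p ∈ Z i, 0 < p.2) →
      (∀ i ∈ s, f i ∈ Z i) → (∀ i ∈ s, χ (f i) = -1) →
      (∀ i ∈ s, ∀ j ∈ s, i ≠ j → Disjoint (Y i) (Y j)) → s.card ≤ N := by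
  set c0 := 1 / (6 * c * (1 + m ^ 2)) with hc0def
  have hc0 : 0 < c0 := by positivity
  have hc0' : 36 * c ^ 2 * c0 ^ 2 * (1 + m ^ 2) ≤ 1 := by
    have h1 : (1 : ℝ) ≤ 1 + m ^ 2 := by nlinarith [sq_nonneg m]
    have : 36 * c ^ 2 * c0 ^ 2 * (1 + m ^ 2) = 1 / (1 + m ^ 2) := by
      rw [hc0def]; field_simp; norm_num
    rw [this, div_le_one (by positivity)]
    exact h1
  obtain ⟨N, hN⟩ := card_le_of_unlinked (w := w) (d := c0 / 2) (by positivity)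
  refine ⟨N, fun s y f Y Z hYo hYc hyΩ hyY hZY hZ hZw hZ0 hfZ hfχ hdis => ?_⟩
  obtain ⟨a, ha⟩ := hD.sol.isConnected.nonempty
  have hΓ : ∀ i ∈ s, ∃ G ⊆ Ω, IsCompact G ∧ IsPreconnected G ∧ a ∈ G ∧ y i ∈ G := fun i hi =>
    hD.sol.isOpen.exists_compact_connecting hD.sol.isConnected.isPreconnected ha (hyΩ i hi)
  have hδ : ∀ i ∈ s, ∃ G ⊆ Y i, IsCompact G ∧ IsPreconnected G ∧ y i ∈ G ∧ f i ∈ G := fun i hi =>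
    (hYo i hi).exists_compact_connecting (hYc i hi) (hyY i hi) (hZY i hi (hfZ i hi))
  choose! Γ hΓΩ hΓk hΓc hΓa hΓy using hΓ
  choose! δ hδY hδk hδc hδy hδf using hδ
  obtain ⟨L, hL, hLΓ⟩ := hD.exists_lower_level (G := ⋃ i ∈ s, Γ i) (s.isCompact_biUnion hΓk)
    (fun p hp => by
      obtain ⟨i, hi, hp⟩ := mem_iUnion₂.1 hp
      exact (abs_lt.1 (hD.mem_iff.1 (hΓΩ i hi hp))).1)
  obtain ⟨b, hb⟩ : ∃ b, ∀ p ∈ ⋃ i ∈ s, (Γ i ∪ δ i), p.2 ≤ b := by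
    obtain ⟨b, hb⟩ := ((s.isCompact_biUnion fun i hi => (hΓk i hi).union (hδk i hi)).image
      continuous_snd).bddAbove
    exact ⟨b, fun p hp => hb ⟨p, hp, rfl⟩⟩
  set β := b + 9 / 2 * c * c0 ^ 2 + 1 with hβ
  have hpos : 0 < 9 / 2 * c * c0 ^ 2 := by positivity
  have hΓβ : ∀ i ∈ s, ∀ p ∈ Γ i, p.2 ≤ b := fun i hi p hp => hb p
    (mem_iUnion₂.2 ⟨i, hi, Or.inl hp⟩)
  have hδβ : ∀ i ∈ s, ∀ p ∈ δ i, p.2 ≤ b := fun i hi p hp => hb p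
    (mem_iUnion₂.2 ⟨i, hi, Or.inr hp⟩)
  set K : ℕ → Set (ℝ × ℝ) := fun i => Z i ∩ {p | χ p ≤ rho (-L)} ∩ {p | p.2 ≤ β} with hK
  set X : ℕ → Set (ℝ × ℝ) := fun i => connectedComponentIn (K i) (f i) with hX
  have hpair : ∀ i ∈ s, IsCompact (X i) ∧ ∃ l r, l + c0 / 2 ≤ r ∧ (l, β) ∈ X i ∧ (r, β) ∈ X i :=
    fun i hi => hD.exists_top_pair hc hc0 hc0' (hZ i hi) (hZw i hi) (hZ0 i hi) (hfZ i hi)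
      (hfχ i hi) hL (by linarith [hδβ i hi _ (hδf i hi)])
  have hXk : ∀ i ∈ s, IsCompact (X i) := fun i hi => (hpair i hi).1
  have hpair' : ∀ i ∈ s, ∃ l r, l + c0 / 2 ≤ r ∧ (l, β) ∈ X i ∧ (r, β) ∈ X i :=
    fun i hi => (hpair i hi).2
  choose! l r hlr hl hr using hpair'
  have hXK : ∀ i, X i ⊆ K i := fun i => connectedComponentIn_subset _ _
  have hXY : ∀ i ∈ s, X i ⊆ Y i := fun i hi p hp => hZY i hi (hXK i hp).1.1
  have hXc : ∀ i, IsPreconnected (X i) := fun i => isPreconnected_connectedComponentIn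
  have hfX : ∀ i ∈ s, f i ∈ X i := fun i hi => by
    refine mem_connectedComponentIn ⟨⟨hfZ i hi, ?_⟩, ?_⟩
    · show χ (f i) ≤ _
      rw [hfχ i hi]; exact (neg_one_lt_rho _).le
    · show (f i).2 ≤ β
      linarith [hδβ i hi _ (hδf i hi)]
  set T : ℕ → Set (ℝ × ℝ) := fun i => Γ i ∪ (δ i ∪ X i) with hT
  have hTk : ∀ i ∈ s, IsCompact (T i) := fun i hi =>
    (hΓk i hi).union ((hδk i hi).union (hXk i hi))
  have hTc : ∀ i ∈ s, IsPreconnected (T i) := fun i hi =>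
    (hΓc i hi).union (y i) (hΓy i hi) (Or.inl (hδy i hi))
      ((hδc i hi).union (f i) (hδf i hi) (hfX i hi) (hXc i))
  have hTβ : ∀ i ∈ s, ∀ p ∈ T i, p.2 ≤ β := by
    rintro i hi p (hp | hp | hp)
    · linarith [hΓβ i hi p hp]
    · linarith [hδβ i hi p hp]
    · exact (hXK i hp).2
  have hTX : ∀ i ∈ s, ∀ j ∈ s, i ≠ j → ∀ p ∈ T j, p ∉ X i := by
    rintro i hi j hj hij p (hp | hp | hp) hpX
    · have h1 : χ p ≤ rho (-L) := (hXK i hpX).1.2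
      have := hLΓ p (mem_iUnion₂.2 ⟨j, hj, hp⟩)
      linarith
    · exact (hdis i hi j hj hij).le_bot ⟨hXY i hi hpX, hδY j hj hp⟩
    · exact (hdis i hi j hj hij).le_bot ⟨hXY i hi hpX, hXY j hj hp⟩
  have hlT : ∀ i ∈ s, (l i, β) ∈ T i := fun i hi => Or.inr (Or.inr (hl i hi))
  have hrT : ∀ i ∈ s, (r i, β) ∈ T i := fun i hi => Or.inr (Or.inr (hr i hi))
  have hTT : ∀ j ∈ s, ∀ k ∈ s, IsPreconnected (T j ∪ T k) := fun j hj k hk =>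
    (hTc j hj).union a (Or.inl (hΓa j hj)) (Or.inl (hΓa k hk)) (hTc k hk)
  refine hN s l r (fun i hi => hZw i hi _ (hXK i (hl i hi)).1.1) hlr ?_ ?_
  · intro i hi j hj hij h
    exact hTX i hi j hj hij (l j, β) (hlT j hj) (h ▸ hl i hi)
  · intro i hi j hj k hk hij hik h1 h2
    have hdisj : ∀ p ∈ T j ∪ T k, p ∉ X i := by
      rintro p (hp | hp)
      · exact hTX i hi j hj hij p hp
      · exact hTX i hi k hk hik p hp
    have hQβ : ∀ p ∈ T j ∪ T k, p.2 ≤ β := by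
      rintro p (hp | hp)
      · exact hTβ j hj p hp
      · exact hTβ k hk p hp
    have hXβ : ∀ p ∈ X i, p.2 ≤ β := fun p hp => (hXK i hp).2
    constructor
    · by_contra! h
      rcases h.lt_or_eq with h | h
      · obtain ⟨p, hp, hpX⟩ := connected_sets_meet ((hTk j hj).union (hTk k hk)) (hXk i hi)
          (hTT j hj k hk) (hXc i) hQβ hXβ (Or.inr (hlT k hk)) (Or.inl (hlT j hj)) (hl i hi)
          (hr i hi) h h1 h2
        exact hdisj p hp hpX
      · exact hdisj (l k, β) (Or.inr (hlT k hk)) (h ▸ hl i hi)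
    · by_contra! h
      rcases h.lt_or_eq with h | h
      · obtain ⟨p, hpX, hp⟩ := connected_sets_meet (hXk i hi) ((hTk j hj).union (hTk k hk))
          (hXc i) (hTT j hj k hk) hXβ hQβ (hl i hi) (hr i hi) (Or.inl (hlT j hj))
          (Or.inr (hrT k hk)) h1 h2 h
        exact hdisj p hp hpX
      · exact hdisj (r k, β) (Or.inr (hrT k hk)) (h ▸ hr i hi)

end

section

variable {c w m : ℝ} {Ω : Set (ℝ × ℝ)} {u χ : ℝ × ℝ → ℝ}

lemma Data.exists_wing (hD : Data (c * m) c w m Ω u χ) (hc : 0 < c) {z : ℝ × ℝ}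
    (hz : χ z < rho 0)
    (hJ : ∀ p ∈ connectedComponentIn {p | χ p < rho 0} z, |p.1| ≤ w → p.2 = 0 → rho (-1) < χ p) :
    ∃ Z ⊆ connectedComponentIn {p | χ p < rho 0} z, Piece χ (rho (-1)) Z ∧ Z.Nonempty ∧
      ∀ p ∈ Z, |p.1| ≤ w ∧ 0 < p.2 := by
  set Y := connectedComponentIn {p | χ p < rho 0} z with hY
  have hYP : Piece χ (rho 0) Y := piece_component hD.cont _ z
  have hrr : rho (-1) ≤ rho 0 := (rho_strictMono (by norm_num)).le
  obtain ⟨z', hz', hzΩ, hzv⟩ := hD.exists_lt_of_piece hc hYP ⟨z, mem_connectedComponentIn hz⟩ (-1)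
  have hz'χ : χ z' < rho (-1) := (hD.lt_iff hzΩ).2 hzv
  set Z := connectedComponentIn {p | χ p < rho (-1)} z' with hZ
  have hZY : Z ⊆ Y := hYP.component_subset hrr hz'
  have hZP : Piece χ (rho (-1)) Z := piece_component hD.cont _ z'
  have hzZ : z' ∈ Z := mem_connectedComponentIn hz'χ
  have hZw : ∀ p ∈ Z, |p.1| < w := by
    intro p hp
    by_contra! h
    obtain ⟨s, hs, hsZ⟩ := hD.outer_subset_component hp h
    exact (hZP.lt _ hsZ).not_ge (hJ _ (hZY hsZ) hs.le rfl).le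
  have hZ0 : ∀ p ∈ Z, p.2 ≠ 0 := fun p hp h =>
    (hZP.lt _ hp).not_ge (hJ _ (hZY hp) (hZw p hp).le h).le
  have hZc : IsPreconnected Z := isPreconnected_connectedComponentIn
  refine ⟨Z, hZY, hZP, ⟨z', hzZ⟩, fun p hp => ⟨(hZw p hp).le, ?_⟩⟩
  by_contra! h
  refine hD.not_subset_lower hc hZP ⟨z', hzZ⟩ (fun p hp => (hZw p hp).le) (b := 0) fun q hq => ?_
  by_contra! hq0
  obtain ⟨x, hx, hx0⟩ := hZc.intermediate_value hp hq continuous_snd.continuousOn ⟨h, hq0.le⟩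
  exact hZ0 x hx hx0

theorem Data.exists_finite_cover (hD : Data (c * m) c w m Ω u χ) (hc : 0 < c) :
    ∃ F : Finset (ℝ × ℝ), (∀ q ∈ F, q ∈ Ω ∧ χ q < rho 0) ∧ ∀ p ∈ Ω, χ p < rho 0 →
      ∃ q ∈ F, p ∈ connectedComponentIn {p | χ p < rho 0} q := by
  by_contra! hcon
  set C : ℝ × ℝ → Set (ℝ × ℝ) := fun z => connectedComponentIn {p | χ p < rho 0} z with hC
  obtain ⟨y, hy, hyC⟩ := exists_seq_of_forall_finset_exists (fun p => p ∈ Ω ∧ χ p < rho 0)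
    (fun x y => y ∉ C x) fun F hF => by
      obtain ⟨p, hp, hp0, hpF⟩ := hcon F hF
      exact ⟨p, ⟨hp, hp0⟩, hpF⟩
  have hmem : ∀ z, χ z < rho 0 → z ∈ C z := fun z hz => mem_connectedComponentIn hz
  have hCeq : ∀ {x p}, p ∈ C x → C x = C p := fun h => connectedComponentIn_eq h
  have hne : ∀ i j, i ≠ j → C (y i) ≠ C (y j) := by
    intro i j hij h
    rcases lt_or_gt_of_ne hij with h1 | h1
    · exact hyC i j h1 (h ▸ hmem _ (hy j).2)
    · exact hyC j i h1 (h ▸ hmem _ (hy i).2)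
  have hdis : ∀ i j, i ≠ j → Disjoint (C (y i)) (C (y j)) := fun i j hij =>
    disjoint_left.2 fun p hp hp' => hne i j hij ((hCeq hp).trans (hCeq hp').symm)
  set J : Set (ℝ × ℝ) := {p | χ p ≤ rho (-1)} ∩ (Icc (-w) w ×ˢ {0}) with hJ
  have hJk : IsCompact J := (isCompact_Icc.prod isCompact_singleton).inter_left
    (isClosed_le hD.cont continuous_const)
  have hopen : IsOpen {p | χ p < rho 0} := isOpen_lt hD.cont continuous_const
  have hJ0 : ∀ p ∈ J, χ p < rho 0 := fun p hp =>
    lt_of_le_of_lt (hp.1 :) (rho_strictMono (by norm_num))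
  obtain ⟨t, ht⟩ := hJk.elim_finite_subcover (fun z : J => C z) (fun z => hopen.connectedComponentIn)
    (fun p hp => mem_iUnion.2 ⟨⟨p, hp⟩, hmem p (hJ0 p hp)⟩)
  obtain ⟨N1, hN1⟩ := hD.card_wings_le hc
  obtain ⟨N2, hN2⟩ := hD.card_marked_wings_le hc
  classical
  set s := Finset.range (t.card + N1 + N2 + 1) with hs
  set hit : ℕ → Prop := fun i => ∃ p ∈ C (y i), p ∈ J with hhit
  have h1 : (s.filter hit).card ≤ t.card := by
    have : ∀ i ∈ s.filter hit, ∃ z ∈ t.image Subtype.val, C (y i) = C z := by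
      intro i hi
      obtain ⟨p, hp, hpJ⟩ := (Finset.mem_filter.1 hi).2
      obtain ⟨z, hz, hpz⟩ := mem_iUnion₂.1 (ht hpJ)
      exact ⟨z, Finset.mem_image_of_mem _ hz, (hCeq hp).trans (hCeq hpz).symm⟩
    choose! g hg hgC using this
    refine (Finset.card_le_card_of_injOn g hg fun i hi j hj hij => by_contra fun h =>
      hne i j h (by rw [hgC i hi, hgC j hj, hij])).trans
      Finset.card_image_le
  have hwing : ∀ i, ¬ hit i → ∃ Z ⊆ C (y i), Piece χ (rho (-1)) Z ∧ Z.Nonempty ∧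
      ∀ p ∈ Z, |p.1| ≤ w ∧ 0 < p.2 := by
    intro i hi
    refine hD.exists_wing hc (hy i).2 fun p hp h1 h2 => ?_
    by_contra! h
    exact hi ⟨p, hp, h, abs_le.1 h1, h2⟩
  choose! Z hZC hZP hZne hZw using hwing
  have h2 : ((s.filter fun i => ¬ hit i).filter fun i => Z i ⊆ Ω).card ≤ N1 := by
    refine hN1 _ Z ?_ ?_ ?_ ?_
    · intro i hi
      simp only [Finset.mem_filter] at hi
      exact hZP i hi.1.2
    · intro i hi
      simp only [Finset.mem_filter] at hi
      exact hZne i hi.1.2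
    · intro i hi
      exact (Finset.mem_filter.1 hi).2
    · intro i hi j hj hij
      simp only [Finset.mem_filter] at hi hj
      exact (hdis i j hij).mono (hZC i hi.1.2) (hZC j hj.1.2)
  have h3 : ((s.filter fun i => ¬ hit i).filter fun i => ¬ Z i ⊆ Ω).card ≤ N2 := by
    have : ∀ i ∈ ((s.filter fun i => ¬ hit i).filter fun i => ¬ Z i ⊆ Ω),
        ∃ f ∈ Z i, χ f = -1 := by
      intro i hi
      simp only [Finset.mem_filter] at hi
      obtain ⟨f, hf, hfΩ⟩ := not_subset.1 hi.2
      exact ⟨f, hf, hD.eq_neg_one_of hfΩ (((hZP i hi.1.2).lt f hf).trans (rho_lt_one _))⟩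
    choose! f hf hfχ using this
    have hnh : ∀ i ∈ ((s.filter fun i => ¬ hit i).filter fun i => ¬ Z i ⊆ Ω), ¬ hit i :=
      fun i hi => (Finset.mem_filter.1 (Finset.mem_filter.1 hi).1).2
    exact hN2 _ y f (fun i => C (y i)) Z (fun i _ => hopen.connectedComponentIn)
      (fun i _ => isPreconnected_connectedComponentIn) (fun i _ => (hy i).1)
      (fun i _ => hmem _ (hy i).2) (fun i hi => hZC i (hnh i hi)) (fun i hi => hZP i (hnh i hi))
      (fun i hi p hp => (hZw i (hnh i hi) p hp).1) (fun i hi p hp => (hZw i (hnh i hi) p hp).2)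
      hf hfχ fun i _ j _ hij => hdis i j hij
  have e1 := Finset.card_filter_add_card_filter_not (s := s) hit
  have e2 := Finset.card_filter_add_card_filter_not (s := s.filter fun i => ¬ hit i)
    (fun i => Z i ⊆ Ω)
  have e3 : s.card = t.card + N1 + N2 + 1 := Finset.card_range _
  omega

theorem Data.exists_isPreconnected_lt (hD : Data (c * m) c w m Ω u χ) (hc : 0 < c) :
    ∃ r1, ∀ r, r1 < r → IsPreconnected {p | χ p < rho r} := by
  obtain ⟨F, hF, hcov⟩ := hD.exists_finite_cover hc
  obtain ⟨a, ha⟩ := hD.sol.isConnected.nonempty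
  have hΓ : ∀ q ∈ F, ∃ G ⊆ Ω, IsCompact G ∧ IsPreconnected G ∧ a ∈ G ∧ q ∈ G := fun q hq =>
    hD.sol.isOpen.exists_compact_connecting hD.sol.isConnected.isPreconnected ha (hF q hq).1
  choose! Γ hΓΩ hΓk hΓc hΓa hΓq using hΓ
  obtain ⟨r1, hr1⟩ := (F.isCompact_biUnion hΓk).bddAbove_image
    ((hD.sol.hgt_continuousOn (m := m)).mono (iUnion₂_subset hΓΩ))
  refine ⟨max r1 0, fun r hr => ?_⟩
  have hr0 : rho 0 ≤ rho r := (rho_strictMono ((le_max_right _ _).trans_lt hr)).le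
  have key : ∀ A B : Set (ℝ × ℝ), IsOpen A → IsOpen B → Disjoint A B →
      A ∪ B = {p | χ p < rho r} → A.Nonempty → a ∈ A := by
    intro A B hA hB hAB hU hne
    have hAP : Piece χ (rho r) A := by
      refine ⟨hA, fun p hp => ?_, ?_⟩
      · have : p ∈ A ∪ B := Or.inl hp
        rw [hU] at this
        exact this
      · rw [← hU, union_sdiff_left, hAB.symm.sdiff_eq_left]
        exact hB
    obtain ⟨p, hpA, hpΩ, hp0⟩ := hD.exists_lt_of_piece hc hAP hne 0
    obtain ⟨q, hqF, hpq⟩ := hcov p hpΩ ((hD.lt_iff hpΩ).2 hp0)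
    have hCA : connectedComponentIn {p | χ p < rho 0} q ⊆ A := by
      refine isPreconnected_connectedComponentIn.subset_left_of_subset_union hA hB hAB ?_
        ⟨p, hpq, hpA⟩
      rw [hU]
      exact fun x hx => lt_of_lt_of_le (connectedComponentIn_subset _ _ hx :) hr0
    have hqA : q ∈ A := hCA (mem_connectedComponentIn (hF q hqF).2)
    refine (hΓc q hqF).subset_left_of_subset_union hA hB hAB ?_ ⟨q, hΓq q hqF, hqA⟩ (hΓa q hqF)
    rw [hU]
    intro x hx
    refine (hD.lt_iff (hΓΩ q hqF hx)).2 (lt_of_le_of_lt ?_ ((le_max_left _ _).trans_lt hr))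
    exact hr1 ⟨x, mem_iUnion₂.2 ⟨q, hqF, hx⟩, rfl⟩
  refine isPreconnected_of_split (isOpen_lt hD.cont continuous_const) ?_
  intro A B hA hB hAB hU hAne hBne
  exact hAB.le_bot ⟨key A B hA hB hAB hU hAne,
    key B A hB hA hAB.symm (by rw [union_comm, hU]) hBne⟩

theorem Data.exists_isPreconnected_le (hD : Data (c * m) c w m Ω u χ) (hc : 0 < c) :
    ∃ r1, ∀ r, r1 < r → IsPreconnected {p | p ∈ Ω ∧ hgt m u p ≤ r} := by
  obtain ⟨r1, hr1⟩ := hD.exists_isPreconnected_lt hc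
  refine ⟨r1, fun r hr => hD.isPreconnected_le hc ?_⟩
  have hΩ : {p | |χ p| < 1} = Ω := by
    ext p; exact hD.mem_iff.symm
  have := isPreconnected_inter_of_lt hD.cont hD.abs_le_one
    (by rw [hΩ]; exact hD.sol.isConnected.nonempty)
    (by rw [hΩ]; exact hD.sol.isConnected.isPreconnected) (abs_rho_lt r) (hr1 r hr)
  convert this using 1
  ext p
  constructor
  · rintro ⟨h1, h2⟩
    exact ⟨hD.mem_iff.1 h1, (hD.lt_iff h1).2 h2⟩
  · rintro ⟨h1, h2⟩
    exact ⟨hD.mem_iff.2 h1, (hD.lt_iff (hD.mem_iff.2 h1)).1 h2⟩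

end

section

variable {σ c w m : ℝ} {Ω : Set (ℝ × ℝ)} {u χ : ℝ × ℝ → ℝ}

lemma pds_neg (u : ℝ × ℝ → ℝ) : pds (fun p => -u p) = fun p => -pds u p := by
  ext p; simp [pds, fderiv_fun_neg]

lemma pdt_neg (u : ℝ × ℝ → ℝ) : pdt (fun p => -u p) = fun p => -pdt u p := by
  ext p; simp [pdt, fderiv_fun_neg]

lemma Sol.neg (hS : Sol σ c w Ω u) : Sol (-σ) c w Ω (fun p => -u p) where
  isOpen := hS.isOpen
  isConnected := hS.isConnected
  smooth := hS.smooth.neg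
  pde := fun p hp => by
    have := hS.pde p hp
    simp only [pds_neg, pdt_neg]
    linear_combination -this
  strip := hS.strip
  blowup := fun p hp => by simpa using hS.blowup p hp

lemma Data.neg (hD : Data σ c w m Ω u χ) :
    Data (-σ) c w (-m) Ω (fun p => -u p) (fun p => -χ p) where
  sol := hD.sol.neg
  cont := hD.cont.neg
  eq_rho := fun p hp => by
    rw [hD.eq_rho p hp, ← rho_neg]
    congr 1
    simp only [hgt]
    ring
  abs_eq := fun p hp => by rw [abs_neg]; exact hD.abs_eq p hp

/-- The reflection `(s, τ) ↦ (s, -τ)`. -/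
def vflip : (ℝ × ℝ) ≃L[ℝ] ℝ × ℝ :=
  (ContinuousLinearEquiv.refl ℝ ℝ).prodCongr (ContinuousLinearEquiv.neg ℝ)

@[simp] lemma vflip_apply (p : ℝ × ℝ) : vflip p = (p.1, -p.2) := rfl

lemma vflip_vflip (p : ℝ × ℝ) : vflip (vflip p) = p := by simp

lemma pds_vflip (u : ℝ × ℝ → ℝ) : pds (fun p => u (vflip p)) = fun p => pds u (vflip p) := by
  ext p
  have : fderiv ℝ (fun p => u (vflip p)) p = (fderiv ℝ u (vflip p)).comp (vflip : ℝ × ℝ →L[ℝ] ℝ × ℝ) :=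
    vflip.comp_right_fderiv (f := u)
  simp only [pds, this]
  simp

lemma pdt_vflip (u : ℝ × ℝ → ℝ) : pdt (fun p => u (vflip p)) = fun p => -pdt u (vflip p) := by
  ext p
  have : fderiv ℝ (fun p => u (vflip p)) p = (fderiv ℝ u (vflip p)).comp (vflip : ℝ × ℝ →L[ℝ] ℝ × ℝ) :=
    vflip.comp_right_fderiv (f := u)
  simp only [pdt, this]
  rw [← map_neg]
  simp

lemma Sol.vflip (hS : Sol σ c w Ω u) : Sol σ (-c) w (vflip ⁻¹' Ω) (fun p => u (vflip p)) where
  isOpen := hS.isOpen.preimage _root_.vflip.continuous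
  isConnected := by
    have : _root_.vflip ⁻¹' Ω = _root_.vflip '' Ω := by
      ext p
      constructor
      · exact fun h => ⟨_, h, vflip_vflip p⟩
      · rintro ⟨q, hq, rfl⟩
        show _root_.vflip (_root_.vflip q) ∈ Ω
        rwa [vflip_vflip]
    rw [this]
    exact hS.isConnected.image _ _root_.vflip.continuous.continuousOn
  smooth := hS.smooth.comp _root_.vflip.contDiff.contDiffOn fun p hp => hp
  pde := fun p hp => by
    have := hS.pde _ hp
    simp only [pds_vflip, pdt_vflip, pdt_neg]
    linear_combination this
  strip := fun p hp => hS.strip (_root_.vflip p) hp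
  blowup := fun p hp => by
    refine (hS.blowup _ hp).comp (tendsto_nhdsWithin_iff.2 ⟨?_, ?_⟩)
    · exact _root_.vflip.continuous.continuousAt.tendsto.mono_left nhdsWithin_le_nhds
    · filter_upwards [self_mem_nhdsWithin] with q hq using hq

lemma Sol.exists_data (hS : Sol σ c w Ω u) (m : ℝ) : ∃ χ, Data σ c w m Ω u χ := by
  obtain ⟨χ, h1, h2, h3⟩ := exists_extension hS.isOpen hS.isConnected
    (hS.hgt_continuousOn (m := m)) fun p hp => by
      have h1 := hS.blowup p hp
      have h2 : Tendsto (fun q : ℝ × ℝ => |m * q.2|) (𝓝[Ω] p) (𝓝 |m * p.2|) :=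
        ((by fun_prop : Continuous fun q : ℝ × ℝ => |m * q.2|).tendsto p).mono_left
          nhdsWithin_le_nhds
      refine tendsto_atTop_mono (fun q => ?_) (h1.atTop_add h2.neg)
      have := abs_sub_abs_le_abs_sub (u q) (m * q.2)
      simp only [hgt]
      linarith
  exact ⟨χ, hS, h1, h2, h3⟩

end

section

variable {σ w : ℝ} {Ω : Set (ℝ × ℝ)} {u χ : ℝ × ℝ → ℝ}

theorem Data.ne_neg_one_of_horizontal (hD : Data σ 0 w 0 Ω u χ) (hσ : |σ| ≤ 1)
    {X : Set (ℝ × ℝ)} (hX : IsCompact X) {L β η : ℝ} (hη : 0 < η) (hXw : ∀ p ∈ X, |p.1| ≤ w)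
    (hXL : ∀ p ∈ X, χ p ≤ rho (-L)) (hXβ : ∀ p ∈ X, p.2 ≤ β)
    (hnhds : ∀ p ∈ X, χ p < rho (-L) → p.2 < β → X ∈ 𝓝 p) {f : ℝ × ℝ} (hf : f ∈ X)
    (hfβ : f.2 + η ≤ β) : χ f ≠ -1 := by
  intro hfχ
  have hw0 := hD.sol.nonneg
  set δ := min (η / (2 * (w ^ 2 + 1))) (1 / (2 * (w + 1))) with hδdef
  have hδ : 0 < δ := lt_min (by positivity) (by positivity)
  have hδ1 : δ * w ^ 2 < η := by
    have h1 : δ ≤ η / (2 * (w ^ 2 + 1)) := min_le_left _ _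
    rw [le_div_iff₀ (by positivity)] at h1
    nlinarith [sq_nonneg w]
  have hδ2 : 2 * δ * w ≤ 1 := by
    have h1 : δ ≤ 1 / (2 * (w + 1)) := min_le_right _ _
    rw [le_div_iff₀ (by positivity)] at h1
    nlinarith
  have hsq : ∀ p ∈ X, δ * p.1 ^ 2 ≤ δ * w ^ 2 := fun p hp => by
    have : p.1 ^ 2 ≤ w ^ 2 := sq_le_sq.2 ((hXw p hp).trans (le_abs_self w))
    gcongr
  obtain ⟨b, hb⟩ := hX.bddBelow_image continuous_snd.continuousOn
  have hb' : ∀ p ∈ X, b ≤ p.2 := fun p hp => hb ⟨p, hp, rfl⟩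
  obtain ⟨A, φ, φ1, φ2, hA, hφ, hy, hX0⟩ := exists_profile (k := δ / 2) (by positivity) (β - b)
    (2 / δ) (by linarith [hXβ f hf, hb' f hf])
  have hq : ∀ p : ℝ × ℝ, quad δ 0 (-1) p = δ * p.1 ^ 2 - p.2 := fun p => by simp [quad]; ring
  have := hD.barrier_bound hφ (a := δ) (b := 0) (d := -1) (L := L) (κ := δ * w ^ 2 - β)
    (by norm_num) hX hXL ?_ ?_ (lt_add_one A) f hf ?_
  · rw [hfχ] at this
    linarith [neg_one_lt_rho (-L - (A + 1))]
  · intro p hp h1 h2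
    refine hnhds p hp h1 (lt_of_le_of_ne (hXβ p hp) fun h => ?_)
    rw [hq, h] at h2
    linarith [hsq p hp]
  · intro p hp r hr hrq
    rw [hq] at hrq
    have hx := hX0 r hr (by linarith [hsq p hp, hb' p hp])
    refine barrierOp_pos_horizontal hσ ?_ ?_ (hφ.pos1 r hr) (hy r hr)
    · rw [sq_le_one_iff_abs_le_one, add_zero, abs_mul, abs_of_pos (by positivity : 0 < 2 * δ)]
      exact (mul_le_mul_of_nonneg_left (hXw p hp) (by positivity)).trans hδ2
    · rw [div_le_iff₀ hδ] at hx
      linarith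
  · rw [hq]
    have : 0 ≤ δ * f.1 ^ 2 := by positivity
    linarith

theorem Data.no_pole_between (hD : Data σ 0 w 0 Ω u χ) (hσ : |σ| ≤ 1) {Γ : Set (ℝ × ℝ)}
    (hΓΩ : Γ ⊆ Ω) (hΓk : IsCompact Γ) (hΓc : IsPreconnected Γ) {ε sa sb sf : ℝ}
    (hΓε : ∀ p ∈ Γ, p.2 ≤ ε) (ha : (sa, ε) ∈ Γ) (hb : (sb, ε) ∈ Γ) (h1 : sa < sf) (h2 : sf < sb)
    (hf : χ (sf, ε) = -1) : False := by
  obtain ⟨η, hη, hηΩ⟩ : ∃ η, 0 < η ∧ ∀ τ ∈ Icc ε (ε + η), (sa, τ) ∈ Ω ∧ (sb, τ) ∈ Ω := by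
    have ca : ∀ᶠ τ in 𝓝 ε, (sa, τ) ∈ Ω :=
      (by fun_prop : Continuous fun τ : ℝ => (sa, τ)).continuousAt.eventually_mem
        (hD.sol.isOpen.mem_nhds (hΓΩ ha))
    have cb : ∀ᶠ τ in 𝓝 ε, (sb, τ) ∈ Ω :=
      (by fun_prop : Continuous fun τ : ℝ => (sb, τ)).continuousAt.eventually_mem
        (hD.sol.isOpen.mem_nhds (hΓΩ hb))
    obtain ⟨η, hη, h⟩ := Metric.eventually_nhds_iff.1 (ca.and cb)
    refine ⟨η / 2, by positivity, fun τ hτ => h ?_⟩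
    rw [Real.dist_eq, abs_lt]
    constructor <;> linarith [hτ.1, hτ.2]
  set β := ε + η with hβ
  have hεβ : ε ≤ β := by linarith
  set Q : Set (ℝ × ℝ) := Γ ∪ ({sa} ×ˢ Icc ε β ∪ {sb} ×ˢ Icc ε β) with hQ
  have hQΩ : Q ⊆ Ω := by
    rintro ⟨s, τ⟩ (h | ⟨h, h'⟩ | ⟨h, h'⟩)
    · exact hΓΩ h
    · obtain rfl : s = sa := h
      exact (hηΩ τ h').1
    · obtain rfl : s = sb := h
      exact (hηΩ τ h').2
  have hQk : IsCompact Q := hΓk.union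
    ((isCompact_singleton.prod isCompact_Icc).union (isCompact_singleton.prod isCompact_Icc))
  have hQc : IsPreconnected Q := by
    have e : Q = (Γ ∪ {sa} ×ˢ Icc ε β) ∪ {sb} ×ˢ Icc ε β := (union_assoc _ _ _).symm
    rw [e]
    have m1 : (sa, ε) ∈ ({sa} : Set ℝ) ×ˢ Icc ε β := ⟨rfl, le_rfl, hεβ⟩
    have m2 : (sb, ε) ∈ ({sb} : Set ℝ) ×ˢ Icc ε β := ⟨rfl, le_rfl, hεβ⟩
    exact (hΓc.union (sa, ε) ha m1
      (isPreconnected_singleton.prod isPreconnected_Icc)).union (sb, ε) (Or.inl hb)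
      m2 (isPreconnected_singleton.prod isPreconnected_Icc)
  have hQβ : ∀ p ∈ Q, p.2 ≤ β := by
    rintro p (h | h | h)
    · exact (hΓε p h).trans hεβ
    · exact h.2.2
    · exact h.2.2
  obtain ⟨L, -, hL⟩ := hD.exists_lower_level hQk fun p hp => (abs_lt.1 (hD.mem_iff.1 (hQΩ hp))).1
  obtain ⟨b, hb0⟩ := hQk.bddBelow_image continuous_snd.continuousOn
  set t0 := b - 1 with ht0
  have hQt : ∀ p ∈ Q, t0 < p.2 := fun p hp => by
    have : b ≤ p.2 := hb0 ⟨p, hp, rfl⟩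
    linarith
  have haQ : (sa, ε) ∈ Q := Or.inl ha
  have htε : t0 < ε := hQt _ haQ
  set K : Set (ℝ × ℝ) := {p | χ p ≤ rho (-L)} ∩ (Icc (-w) w ×ˢ Icc t0 β) with hK
  have hKk : IsCompact K := (isCompact_Icc.prod isCompact_Icc).inter_left
    (isClosed_le hD.cont continuous_const)
  have hKQ : ∀ p ∈ K, p ∉ Q := fun p hp hq => (hL p hq).not_ge hp.1
  have hwa := abs_le.1 (hD.sol.strip _ (hΓΩ ha))
  have hwb := abs_le.1 (hD.sol.strip _ (hΓΩ hb))
  simp only at hwa hwb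
  have hfΩ : (sf, ε) ∉ Ω := fun h => by
    have := hD.mem_iff.1 h
    rw [hf] at this
    norm_num at this
  have hfK : (sf, ε) ∈ K := by
    refine ⟨?_, ⟨by linarith, by linarith⟩, htε.le, hεβ⟩
    show χ _ ≤ _
    rw [hf]; exact (neg_one_lt_rho _).le
  set X := connectedComponentIn K (sf, ε) with hX
  have hXK : X ⊆ K := connectedComponentIn_subset _ _
  have hfX : (sf, ε) ∈ X := mem_connectedComponentIn hfK
  have hXk : IsCompact X := hKk.of_isClosed_subset (isClosed_connectedComponentIn' hKk.isClosed _)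
    hXK
  obtain ⟨s0, hs0⟩ : ∃ s0, (s0, t0) ∈ X := by
    by_contra! hno
    obtain ⟨Y, hYK, hfY, hYU, hYc, hYc'⟩ := exists_clopen_piece hKk
      (isOpen_lt (continuous_const (y := t0)) continuous_snd) hfK (by
        rintro ⟨s, τ⟩ hp
        refine lt_of_le_of_ne (hXK hp).2.2.1 fun h => ?_
        simp only at h
        subst h
        exact hno s hp)
    have hYt : ∀ p ∈ Y, t0 < p.2 := fun p hp => hYU hp
    have hYw : ∀ p ∈ Y, |p.1| < w := by
      intro p hp
      refine lt_of_le_of_ne (abs_le.2 (hYK hp).2.1) fun h => ?_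
      set V : Set (ℝ × ℝ) := {p.1} ×ˢ Icc t0 β with hV
      have hVc : IsPreconnected V := isPreconnected_singleton.prod isPreconnected_Icc
      have hpV : p ∈ V := ⟨rfl, (hYK hp).2.2⟩
      have hVΩ : ∀ q ∈ V, q ∉ Ω := fun q hq hqΩ => by
        have h1 := hD.sol.strip_lt hqΩ
        rw [show q.1 = p.1 from hq.1] at h1
        linarith
      have hVK : V ⊆ K := by
        intro q hq
        refine ⟨?_, ?_, hq.2⟩
        · show χ q ≤ _
          rw [hD.eq_of_convex hVc hVΩ hq hpV]
          exact (hYK hp).1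
        · rw [show q.1 = p.1 from hq.1]
          exact (hYK hp).2.1
      have hVY : V ⊆ Y := by
        have : IsPreconnected V := hVc
        refine (isPreconnected_iff_subset_of_disjoint_closed.1 this Y (K \ Y) hYc.isClosed
          hYc'.isClosed ?_ ?_).resolve_right ?_
        · rw [union_sdiff_cancel hYK]; exact hVK
        · rw [inter_sdiff_self, inter_empty]
        · exact fun h => (h hpV).2 hp
      have : (p.1, t0) ∈ Y := hVY ⟨rfl, le_rfl, htε.le.trans hεβ⟩
      exact (hYt _ this).ne rfl
    refine hD.ne_neg_one_of_horizontal hσ hYc (L := L) (β := β) hη (fun p hp => (hYw p hp).le)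
      (fun p hp => (hYK hp).1) (fun p hp => (hYK hp).2.2.2) ?_ hfY le_rfl hf
    intro p hp h3 h4
    have hw' := abs_lt.1 (hYw p hp)
    filter_upwards [(isOpen_lt hD.cont continuous_const).mem_nhds h3,
      hYc'.isClosed.isOpen_compl.mem_nhds (fun h : p ∈ K \ Y => h.2 hp),
      prod_mem_nhds (Icc_mem_nhds hw'.1 hw'.2) (Icc_mem_nhds (hYt p hp) h4)] with q q1 q2 q3
    by_contra hq
    exact q2 ⟨⟨le_of_lt q1, q3⟩, hq⟩
  have hs0w := (hXK hs0).2.1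
  simp only at hs0w
  set P : Set (ℝ × ℝ) := ((X ∪ {sf} ×ˢ Icc ε β) ∪ Icc s0 (w + 1) ×ˢ {t0}) ∪ {w + 1} ×ˢ Icc t0 β
    with hP
  have hPk : IsCompact P := ((hXk.union (isCompact_singleton.prod isCompact_Icc)).union
    (isCompact_Icc.prod isCompact_singleton)).union (isCompact_singleton.prod isCompact_Icc)
  have hPc : IsPreconnected P := by
    have m1 : (sf, ε) ∈ ({sf} : Set ℝ) ×ˢ Icc ε β := ⟨rfl, le_rfl, hεβ⟩
    have m2 : (s0, t0) ∈ Icc s0 (w + 1) ×ˢ ({t0} : Set ℝ) :=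
      ⟨⟨le_rfl, by linarith [hs0w.2]⟩, rfl⟩
    have m3 : (w + 1, t0) ∈ Icc s0 (w + 1) ×ˢ ({t0} : Set ℝ) :=
      ⟨⟨by linarith [hs0w.2], le_rfl⟩, rfl⟩
    have m4 : (w + 1, t0) ∈ ({w + 1} : Set ℝ) ×ˢ Icc t0 β := ⟨rfl, le_rfl, htε.le.trans hεβ⟩
    exact ((isPreconnected_connectedComponentIn.union (sf, ε) hfX m1
      (isPreconnected_singleton.prod isPreconnected_Icc)).union (s0, t0) (Or.inl hs0) m2
      (isPreconnected_Icc.prod isPreconnected_singleton)).union (w + 1, t0) (Or.inr m3) m4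
      (isPreconnected_singleton.prod isPreconnected_Icc)
  have hPβ : ∀ p ∈ P, p.2 ≤ β := by
    rintro p (((h | h) | h) | h)
    · exact (hXK h).2.2.2
    · exact h.2.2
    · rw [show p.2 = t0 from h.2]; exact htε.le.trans hεβ
    · exact h.2.2
  obtain ⟨p, hpQ, hpP⟩ := connected_sets_meet hQk hPk hQc hPc hQβ hPβ (p1 := sa) (p2 := sb)
    (q1 := sf) (q2 := w + 1) (Or.inr (Or.inl ⟨rfl, hεβ, le_rfl⟩))
    (Or.inr (Or.inr ⟨rfl, hεβ, le_rfl⟩)) (Or.inl (Or.inl (Or.inr ⟨rfl, hεβ, le_rfl⟩)))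
    (Or.inr ⟨rfl, htε.le.trans hεβ, le_rfl⟩) h1 h2 (by linarith)
  rcases hpP with ((h | h) | h) | h
  · exact hKQ p (hXK h) hpQ
  · have hs : p.1 = sf := h.1
    rcases hpQ with h' | h' | h'
    · have : p = (sf, ε) := Prod.ext hs (le_antisymm (hΓε p h') h.2.1)
      exact hfΩ (this ▸ hΓΩ h')
    · have : p.1 = sa := h'.1
      linarith
    · have : p.1 = sb := h'.1
      linarith
  · exact (hQt p hpQ).ne' h.2
  · have := (abs_le.1 (hD.sol.strip p (hQΩ hpQ))).2
    rw [show p.1 = w + 1 from h.1] at this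
    linarith

end

section

variable {σ c w : ℝ} {Ω : Set (ℝ × ℝ)} {u χ : ℝ × ℝ → ℝ}

lemma Sol.mem_of_between (hS : Sol σ 0 w Ω u) (hσ : |σ| ≤ 1) {Γ : Set (ℝ × ℝ)}
    (hΓΩ : Γ ⊆ Ω) (hΓk : IsCompact Γ) (hΓc : IsPreconnected Γ) {ε sa sb sf : ℝ}
    (hΓε : ∀ p ∈ Γ, p.2 ≤ ε) (ha : (sa, ε) ∈ Γ) (hb : (sb, ε) ∈ Γ) (h1 : sa < sf) (h2 : sf < sb) :
    (sf, ε) ∈ Ω := by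
  by_contra hf
  obtain ⟨χ, hD⟩ := hS.exists_data 0
  rcases eq_or_eq_neg_of_abs_eq (hD.abs_eq _ hf) with h | h
  · have hD' := hD.neg
    rw [neg_zero] at hD'
    exact hD'.no_pole_between (by rwa [abs_neg]) hΓΩ hΓk hΓc hΓε ha hb h1 h2 (by rw [h])
  · exact hD.no_pole_between hσ hΓΩ hΓk hΓc hΓε ha hb h1 h2 h

theorem Sol.isPreconnected_snd_gt (hS : Sol σ 0 w Ω u) (hσ : |σ| ≤ 1) (a : ℝ) :
    IsPreconnected {p | p ∈ Ω ∧ a < p.2} := by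
  have hopen : IsOpen {p : ℝ × ℝ | p ∈ Ω ∧ a < p.2} :=
    hS.isOpen.inter (isOpen_lt continuous_const continuous_snd)
  refine isPreconnected_of_split hopen ?_
  rintro A B hA hB hAB hU ⟨α, hα⟩ ⟨b, hb⟩
  have hAU : ∀ p ∈ A, p ∈ Ω ∧ a < p.2 := fun p hp => by
    have : p ∈ A ∪ B := Or.inl hp
    rwa [hU] at this
  have hBU : ∀ p ∈ B, p ∈ Ω ∧ a < p.2 := fun p hp => by
    have : p ∈ A ∪ B := Or.inr hp
    rwa [hU] at this
  have hor : ∀ p ∈ Ω, a < p.2 → p ∈ A ∨ p ∈ B := fun p hp h => by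
    have : p ∈ A ∪ B := by rw [hU]; exact ⟨hp, h⟩
    exact this
  have hnot : ∀ p ∈ A, p ∉ B := fun p h1 h2 => hAB.le_bot ⟨h1, h2⟩
  obtain ⟨ε, hεa, hεα⟩ := exists_between (lt_min (hAU α hα).2 (hBU b hb).2)
  rw [lt_min_iff] at hεα
  have hj := (hS.isOpen.isConnected_iff_isPathConnected.1 hS.isConnected).joinedIn α (hAU α hα).1
    b (hBU b hb).1
  set g : ℝ → ℝ × ℝ := fun t => hj.somePath.extend t with hg
  have hgc : Continuous g := hj.somePath.extend.continuous
  have hg0 : g 0 = α := hj.somePath.extend_zero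
  have hg1 : g 1 = b := hj.somePath.extend_one
  have hgΩ : ∀ t, g t ∈ Ω := fun t => hj.somePath_mem _
  have hgs : Continuous fun t => (g t).2 := continuous_snd.comp hgc
  obtain ⟨t1, ⟨⟨ht1, ht1ε⟩, ht1B⟩, ht1max⟩ :=
    ((isCompact_Icc (a := (0 : ℝ)) (b := 1)).inter_right (isClosed_le continuous_const hgs)
      |>.inter_right (hB.preimage hgc).isClosed_compl).exists_isGreatest
      ⟨0, ⟨⟨le_rfl, zero_le_one⟩, by
        show ε ≤ (g 0).2
        rw [hg0]; exact hεα.1.le⟩, fun h => hnot α hα (by rwa [← hg0])⟩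
  have ht1A : g t1 ∈ A := (hor _ (hgΩ t1) (hεa.trans_le ht1ε)).resolve_right ht1B
  obtain ⟨t2, ⟨⟨ht2, ht2ε⟩, ht2A⟩, ht2min⟩ :=
    ((isCompact_Icc (a := t1) (b := 1)).inter_right (isClosed_le continuous_const hgs)
      |>.inter_right (hA.preimage hgc).isClosed_compl).exists_isLeast
      ⟨1, ⟨⟨ht1.2, le_rfl⟩, by
        show ε ≤ (g 1).2
        rw [hg1]; exact hεα.2.le⟩, fun h => hnot b (by rwa [← hg1]) hb⟩
  have ht2B : g t2 ∈ B := (hor _ (hgΩ t2) (hεa.trans_le ht2ε)).resolve_left ht2A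
  have h12 : t1 < t2 := lt_of_le_of_ne ht2.1 fun h => ht2A (h ▸ ht1A)
  have hlow : ∀ t ∈ Icc t1 t2, (g t).2 ≤ ε := by
    have : Icc t1 t2 ⊆ {t | (g t).2 ≤ ε} := by
      rw [← closure_Ioo h12.ne]
      refine closure_minimal (fun t ht => ?_) (isClosed_le hgs continuous_const)
      show (g t).2 ≤ ε
      by_contra! h
      rcases hor _ (hgΩ t) (hεa.trans h) with h' | h'
      · exact ht.1.not_ge (ht1max ⟨⟨⟨ht1.1.trans ht.1.le, ht.2.le.trans ht2.2⟩, h.le⟩, hnot _ h'⟩)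
      · exact ht.2.not_ge (ht2min ⟨⟨⟨ht.1.le, ht.2.le.trans ht2.2⟩, h.le⟩,
          fun h'' => hnot _ h'' h'⟩)
    exact this
  have m1 : t1 ∈ Icc t1 t2 := ⟨le_rfl, h12.le⟩
  have m2 : t2 ∈ Icc t1 t2 := ⟨h12.le, le_rfl⟩
  have e1 : g t1 = ((g t1).1, ε) := Prod.ext rfl (le_antisymm (hlow _ m1) ht1ε)
  have e2 : g t2 = ((g t2).1, ε) := Prod.ext rfl (le_antisymm (hlow _ m2) ht2ε)
  set sa := (g t1).1
  set sb := (g t2).1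
  set Γ := g '' Icc t1 t2 with hΓ
  have hΓΩ : Γ ⊆ Ω := by
    rintro _ ⟨t, -, rfl⟩
    exact hgΩ t
  have hΓk : IsCompact Γ := isCompact_Icc.image hgc
  have hΓc : IsPreconnected Γ := isPreconnected_Icc.image _ hgc.continuousOn
  have hΓε : ∀ p ∈ Γ, p.2 ≤ ε := by
    rintro _ ⟨t, ht, rfl⟩
    exact hlow t ht
  have haΓ : (sa, ε) ∈ Γ := ⟨t1, m1, e1⟩
  have hbΓ : (sb, ε) ∈ Γ := ⟨t2, m2, e2⟩
  have hseg : uIcc sa sb ×ˢ ({ε} : Set ℝ) ⊆ Ω := by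
    rintro ⟨s, τ⟩ ⟨hs, hτ⟩
    obtain rfl : τ = ε := hτ
    rcases eq_or_ne s sa with rfl | hsa
    · exact hΓΩ haΓ
    rcases eq_or_ne s sb with rfl | hsb
    · exact hΓΩ hbΓ
    rcases mem_uIcc.1 hs with h | h
    · exact hS.mem_of_between hσ hΓΩ hΓk hΓc hΓε haΓ hbΓ (lt_of_le_of_ne h.1 hsa.symm)
        (lt_of_le_of_ne h.2 hsb)
    · exact hS.mem_of_between hσ hΓΩ hΓk hΓc hΓε hbΓ haΓ (lt_of_le_of_ne h.1 hsb.symm)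
        (lt_of_le_of_ne h.2 hsa)
  have hsegc : IsPreconnected (uIcc sa sb ×ˢ ({ε} : Set ℝ)) :=
    isPreconnected_uIcc.prod isPreconnected_singleton
  have hsa : (sa, ε) ∈ uIcc sa sb ×ˢ ({ε} : Set ℝ) := ⟨left_mem_uIcc, rfl⟩
  have hsb : (sb, ε) ∈ uIcc sa sb ×ˢ ({ε} : Set ℝ) := ⟨right_mem_uIcc, rfl⟩
  have hne : ((uIcc sa sb ×ˢ ({ε} : Set ℝ)) ∩ A).Nonempty := ⟨(sa, ε), hsa, e1 ▸ ht1A⟩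
  have hsub := hsegc.subset_left_of_subset_union hA hB hAB (by
    rintro p hp
    have h2 : p.2 = ε := hp.2
    exact hor p (hseg hp) (by rw [h2]; exact hεa)) hne
  have : (sb, ε) ∈ A := hsub hsb
  exact ht2A (show g t2 ∈ A by rw [e2]; exact this)

lemma Sol.isPreconnected_snd_ge (hS : Sol σ 0 w Ω u) (hσ : |σ| ≤ 1) (a : ℝ) :
    IsPreconnected {p | p ∈ Ω ∧ a ≤ p.2} := by
  refine (hS.isPreconnected_snd_gt hσ a).subset_closure (fun p hp => ⟨hp.1, hp.2.le⟩) ?_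
  rintro ⟨s, τ⟩ ⟨hp, hτ⟩
  have h : ContinuousWithinAt (fun x : ℝ => (s, x)) (Ioi τ) τ := by fun_prop
  refine mem_closure_of_tendsto h (b := 𝓝[>] τ) ?_
  filter_upwards [h (hS.isOpen.mem_nhds hp), self_mem_nhdsWithin] with x h1 h2
  exact ⟨h1, lt_of_le_of_lt hτ h2⟩

lemma isPreconnected_of_vflip {P : ℝ × ℝ → Prop}
    (h : IsPreconnected {p | vflip p ∈ Ω ∧ P (vflip p)}) : IsPreconnected {p | p ∈ Ω ∧ P p} := by
  have := h.image vflip vflip.continuous.continuousOn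
  convert this using 1
  ext p
  constructor
  · intro hp
    exact ⟨vflip p, by simpa only [mem_ofPred_eq, vflip_vflip] using hp, vflip_vflip p⟩
  · rintro ⟨q, hq, rfl⟩
    exact hq

lemma Sol.exists_isPreconnected_of_pos (hS : Sol σ c w Ω u) (hc : 0 < c) :
    ∃ r1, ∀ r, r1 < r → IsPreconnected {p | p ∈ Ω ∧ c * u p - σ * p.2 ≤ r} := by
  obtain ⟨m, rfl⟩ : ∃ m, σ = c * m := ⟨σ / c, by field_simp⟩
  obtain ⟨χ, hD⟩ := hS.exists_data m
  obtain ⟨r1, hr1⟩ := hD.exists_isPreconnected_le hc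
  refine ⟨c * r1, fun r hr => ?_⟩
  have := hr1 (r / c) (by rwa [lt_div_iff₀' hc])
  convert this using 4 with p
  rw [le_div_iff₀' hc, hgt]
  constructor <;> intro h <;> linarith

theorem Sol.exists_isPreconnected (hS : Sol σ c w Ω u) (h1 : σ ^ 2 + c ^ 2 = 1) :
    ∃ r1, ∀ r, r1 < r → IsPreconnected {p | p ∈ Ω ∧ c * u p - σ * p.2 ≤ r} := by
  rcases lt_trichotomy c 0 with hc | rfl | hc
  · obtain ⟨r1, hr1⟩ := hS.vflip.neg.exists_isPreconnected_of_pos (neg_pos.2 hc)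
    refine ⟨r1, fun r hr => isPreconnected_of_vflip ?_⟩
    convert hr1 r hr using 1
    ext p
    refine and_congr Iff.rfl ?_
    simp only [vflip_apply]
    constructor <;> intro h <;> linarith
  · have hσ : |σ| ≤ 1 := by
      rw [← sq_le_one_iff_abs_le_one]; linarith
    refine ⟨0, fun r _ => ?_⟩
    have hσ0 : σ ≠ 0 := by rintro rfl; norm_num at h1
    rcases lt_or_gt_of_ne hσ0 with h | h
    · have hv := hS.vflip
      rw [neg_zero] at hv
      refine isPreconnected_of_vflip ?_
      convert hv.isPreconnected_snd_ge hσ (r / σ) using 1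
      ext p
      refine and_congr Iff.rfl ?_
      rw [div_le_iff_of_neg h]
      simp only [vflip_apply]
      constructor <;> intro h <;> linarith
    · convert hS.isPreconnected_snd_ge hσ (-r / σ) using 4 with p
      rw [div_le_iff₀ h]
      constructor <;> intro h <;> linarith
  · exact hS.exists_isPreconnected_of_pos hc

end

lemma graphPtθ_apply (θ : ℝ) (u : ℝ × ℝ → ℝ) (p : ℝ × ℝ) :
    graphPtθ θ u p = !₂[p.1, cos θ * u p - sin θ * p.2, cos θ * p.2 + sin θ * u p] := by
  ext i
  fin_cases i <;> simp [graphPtθ, e1, bθ, vθ, e2, e3] <;> ring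

lemma inner_e3_basis (θ : ℝ) :
    ⟪e3, vθ θ⟫ = sin θ ∧ ⟪e3, e1⟫ = 0 ∧ ⟪e3, bθ θ⟫ = cos θ := by
  refine ⟨?_, ?_, ?_⟩ <;> simp [e1, bθ, vθ, e2, e3, PiLp.inner_apply]

lemma mem_graph_of_frequently_bounded {θ : ℝ} {Ω : Set (ℝ × ℝ)} {u : ℝ × ℝ → ℝ} {S : Set E3}
    (hS : S = graphPtθ θ u '' Ω) (hc : IsClosed S) {p : ℝ × ℝ} {R : ℝ}
    (h : ∃ᶠ q in 𝓝[Ω] p, |u q| ≤ R) : p ∈ Ω := by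
  have h' := h.and_eventually (self_mem_nhdsWithin (s := Ω) (a := p))
  obtain ⟨x, hx, hxP⟩ := exists_seq_forall_of_frequently h'
  have hx' : Tendsto x atTop (𝓝 p) := hx.mono_right nhdsWithin_le_nhds
  obtain ⟨z, -, φ, hφ, hz⟩ := isCompact_Icc.tendsto_subseq (x := fun n => u (x n))
    (s := Icc (-R) R) fun n => abs_le.1 (hxP n).1
  have hxφ := hx'.comp hφ.tendsto_atTop
  have hlim : Tendsto (fun n => graphPtθ θ u (x (φ n))) atTop
      (𝓝 (p.1 • e1 + p.2 • bθ θ + z • vθ θ)) :=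
    (((continuous_fst.tendsto p).comp hxφ).smul_const _ |>.add
      (((continuous_snd.tendsto p).comp hxφ).smul_const _)).add (hz.smul_const _)
  have hmem : p.1 • e1 + p.2 • bθ θ + z • vθ θ ∈ S := hc.mem_of_tendsto hlim
    (Eventually.of_forall fun n => by rw [hS]; exact ⟨_, (hxP (φ n)).2, rfl⟩)
  rw [hS] at hmem
  obtain ⟨q, hq, he⟩ := hmem
  have he' : graphPtθ θ u q = graphPtθ θ (fun _ => z) p := he
  rw [graphPtθ_apply, graphPtθ_apply] at he'
  have h0 := congrArg (fun v : E3 => v 0) he'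
  have h1 := congrArg (fun v : E3 => v 1) he'
  have h2 := congrArg (fun v : E3 => v 2) he'
  simp at h0 h1 h2
  have h3 : q.2 = p.2 := by
    linear_combination cos θ * h2 - sin θ * h1 - (q.2 - p.2) * sin_sq_add_cos_sq θ
  rwa [← Prod.ext h0 h3]

lemma IsTranslatingGraph.eq_image {θ : ℝ} {Ω : Set (ℝ × ℝ)} {u : ℝ × ℝ → ℝ} {S : Set E3}
    (hg : IsTranslatingGraph e1 (bθ θ) (vθ θ) Ω u S) : S = graphPtθ θ u '' Ω := by
  rw [hg.graph_eq]
  ext q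
  exact ⟨fun ⟨p, hp, h⟩ => ⟨p, hp, h.symm⟩, fun ⟨p, hp, h⟩ => ⟨p, hp, h.symm⟩⟩

lemma IsTranslatingGraph.sol {θ w : ℝ} {Ω : Set (ℝ × ℝ)} {u : ℝ × ℝ → ℝ} {S : Set E3}
    (hg : IsTranslatingGraph e1 (bθ θ) (vθ θ) Ω u S) (hc : IsClosed S)
    (hslab : S ⊆ {q : E3 | |q 0| ≤ w}) : Sol (sin θ) (cos θ) w Ω u where
  isOpen := hg.isOpen_dom
  isConnected := hg.isConnected_dom
  smooth := hg.smooth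
  pde p hp := by
    have h := hg.pde p hp
    obtain ⟨h1, h2, h3⟩ := inner_e3_basis θ
    rw [h1, h2, h3] at h
    refine h.trans ?_
    ring
  strip p hp := by
    have h := hslab (hg.eq_image ▸ mem_image_of_mem _ hp)
    simpa [graphPtθ_apply] using h
  blowup p hp := by
    by_contra h
    rw [Filter.tendsto_atTop] at h
    push Not at h
    obtain ⟨R, hR⟩ := h
    refine hp (mem_graph_of_frequently_bounded hg.eq_image hc (R := R) ?_)
    exact hR.mono fun q hq => le_of_lt hq

lemma isConnected_graph_slice {θ : ℝ} {Ω : Set (ℝ × ℝ)} {u : ℝ × ℝ → ℝ}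
    (hu : ContinuousOn u Ω) {P : ℝ → Prop} {p₀ : ℝ × ℝ} (hp₀ : p₀ ∈ Ω)
    (hP : P (cos θ * u p₀ - sin θ * p₀.2))
    (h : IsPreconnected {p | p ∈ Ω ∧ P (cos θ * u p - sin θ * p.2)}) :
    IsConnected (graphPtθ θ u '' Ω ∩ {q : E3 | P (q 1)}) := by
  have h1 : ∀ p, (graphPtθ θ u p) 1 = cos θ * u p - sin θ * p.2 := fun p => by
    simp [graphPtθ_apply]
  have hcont : ContinuousOn (graphPtθ θ u) Ω :=
    (by fun_prop : ContinuousOn (fun p : ℝ × ℝ => p.1 • e1 + p.2 • bθ θ) Ω).add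
      (hu.smul continuousOn_const)
  have h2 : graphPtθ θ u '' Ω ∩ {q : E3 | P (q 1)}
      = graphPtθ θ u '' {p | p ∈ Ω ∧ P (cos θ * u p - sin θ * p.2)} := by
    ext q
    constructor
    · rintro ⟨⟨p, hp, rfl⟩, hq⟩
      exact ⟨p, ⟨hp, h1 p ▸ hq⟩, rfl⟩
    · rintro ⟨p, ⟨hp, hq⟩, rfl⟩
      exact ⟨⟨p, hp, rfl⟩, show P ((graphPtθ θ u p) 1) by rw [h1]; exact hq⟩
  rw [h2]
  exact ⟨⟨_, p₀, ⟨hp₀, hP⟩, rfl⟩, h.image _ (hcont.mono fun p hp => hp.1)⟩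

theorem IsTranslatingGraph.exists_isConnected_slices {θ w : ℝ} {Ω : Set (ℝ × ℝ)}
    {u : ℝ × ℝ → ℝ} {S : Set E3} (hg : IsTranslatingGraph e1 (bθ θ) (vθ θ) Ω u S)
    (hc : IsClosed S) (hslab : S ⊆ {q : E3 | |q 0| ≤ w}) :
    ∃ t₁ : ℝ, 0 < t₁ ∧ ∀ t : ℝ, t₁ < t →
      IsConnected (S ∩ {q : E3 | q 1 ≤ t}) ∧ IsConnected (S ∩ {q : E3 | -t ≤ q 1}) := by
  have hS := hg.sol hc hslab
  have hun : sin θ ^ 2 + cos θ ^ 2 = 1 := sin_sq_add_cos_sq θ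
  obtain ⟨r1, hr1⟩ := hS.exists_isPreconnected hun
  obtain ⟨r2, hr2⟩ := hS.neg.exists_isPreconnected (by rw [neg_sq]; exact hun)
  obtain ⟨p₀, hp₀⟩ := hg.isConnected_dom.nonempty
  set y₀ := cos θ * u p₀ - sin θ * p₀.2 with hy₀
  refine ⟨max (max r1 r2) |y₀| + 1, by positivity, fun t ht => ?_⟩
  have ht1 : r1 < t := by linarith [le_max_left (max r1 r2) |y₀|, le_max_left r1 r2]
  have ht2 : r2 < t := by linarith [le_max_left (max r1 r2) |y₀|, le_max_right r1 r2]
  have ht3 : |y₀| ≤ t := by linarith [le_max_right (max r1 r2) |y₀|]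
  rw [hg.eq_image]
  refine ⟨isConnected_graph_slice (P := fun y => y ≤ t) hg.smooth.continuousOn hp₀
    (abs_le.1 ht3).2 (hr1 t ht1), isConnected_graph_slice (P := fun y => -t ≤ y)
    hg.smooth.continuousOn hp₀ (abs_le.1 ht3).1 ?_⟩
  convert hr2 t ht2 using 1
  ext p
  refine and_congr Iff.rfl ?_
  constructor <;> intro h <;> linarith

end

/-- the lower slices `Σ ∩ {y ≤ t}` and `Σ ∩ {y ≥ −t}` are connected for all
`t` larger than some `t₁ > 0`. -/
theorem stmt8 (θ : ℝ) (hθ : θ ∈ Set.Ico 0 π) (Ω : Set (ℝ × ℝ)) (u : ℝ × ℝ → ℝ) (S : Set E3)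
    (hgraph : IsTranslatingGraph e1 (bθ θ) (vθ θ) Ω u S) (hcomplete : IsClosed S)
    (w : ℝ) (hw : 0 < w) (hslab : S ⊆ {q : E3 | |q 0| ≤ w}) :
    ∃ t₁ : ℝ, 0 < t₁ ∧ ∀ t : ℝ, t₁ < t →
      IsConnected (S ∩ {q : E3 | q 1 ≤ t}) ∧ IsConnected (S ∩ {q : E3 | -t ≤ q 1}) := by
  exact hgraph.exists_isConnected_slices hcomplete hslab
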